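/- A sequence (d_1,…,d_5) of five positive integers is the degree sequence of a hsop of I_7 (the ring of invariants of the binary septimic) if and only if: all d_i are even; no d_i lies in {2, 6, 10}; at most one d_i equals 4; at most three of the d_i lie in {4, 8, 14, 16, 18, 22, 26, 28, 34, 38, 46, 58}; at least three of the d_i are divisible by 4; at least two are divisible by 6; at least one is divisible by 8; at least one is divisible by 10; and at least one is divisible by 12. -/

import Mathlib

set_option synthInstance.maxHeartbeats 1000000
noncomputable section

open MvPolynomial

/-- The binary form of degree `n` with coefficient vector `a`, as a polynomial in two
variables `X 0 = x`, `X 1 = y`. -/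
def formPoly (n : ℕ) (a : Fin (n+1) → ℂ) : MvPolynomial (Fin 2) ℂ :=
  ∑ i : Fin (n+1), C (a i) * X 0 ^ (n - (i : ℕ)) * X 1 ^ (i : ℕ)

/-- The action of `SL(2,ℂ)` on coefficient vectors of binary forms of degree `n`,
given by linear substitution of the variables `x`, `y`. -/
def sl2Act (n : ℕ) (g : Matrix.SpecialLinearGroup (Fin 2) ℂ) (a : Fin (n+1) → ℂ) :
    Fin (n+1) → ℂ := fun i =>
  coeff (Finsupp.single 0 (n - (i : ℕ)) + Finsupp.single 1 (i : ℕ))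
    (bind₁ (fun j : Fin 2 => C (g.1 j 0) * X 0 + C (g.1 j 1) * X 1) (formPoly n a))

/-- The ring of invariants `I_n` of the binary form of degree `n`: the subalgebra of
`ℂ[a_0,…,a_n]` of polynomials invariant under the `SL(2,ℂ)`-action. -/
def invariantRing (n : ℕ) : Subalgebra ℂ (MvPolynomial (Fin (n+1)) ℂ) where
  carrier := {p | ∀ g : Matrix.SpecialLinearGroup (Fin 2) ℂ, ∀ a : Fin (n+1) → ℂ,
    eval (sl2Act n g a) p = eval a p}
  mul_mem' := by
    intro p q hp hq g a
    simp only [Set.mem_setOf_eq, map_mul] at *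
    rw [hp g a, hq g a]
  add_mem' := by
    intro p q hp hq g a
    simp only [Set.mem_setOf_eq, map_add] at *
    rw [hp g a, hq g a]
  algebraMap_mem' := by
    intro c g a
    simp

/-- `IsHSOP n d p` says that `p` is a homogeneous system of parameters of the invariant
ring of the binary form of degree `n`, with degree sequence `d` : the `p k` are
homogeneous of positive degrees `d k`, algebraically independent over `ℂ`, and `I_n` is a
finitely generated module over the subalgebra they generate. -/
def IsHSOP (n : ℕ) (d : Fin (n-2) → ℕ) (p : Fin (n-2) → invariantRing n) : Prop :=
  (∀ k, 0 < d k) ∧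
  (∀ k, ((p k : MvPolynomial (Fin (n+1)) ℂ)).IsHomogeneous (d k)) ∧
  AlgebraicIndependent ℂ p ∧
  Module.Finite (Algebra.adjoin ℂ (Set.range p)) (invariantRing n)

/-- The transcendence degree drops along a non-injective surjection from a domain. -/
theorem trdeg_le_of_surjective_of_not_injective {A B : Type} [CommRing A] [CommRing B]
    [Algebra ℂ A] [Algebra ℂ B] [IsDomain A] [IsDomain B] (f : A →ₐ[ℂ] B)
    (hf : Function.Surjective f) {q : A} (hq : q ≠ 0) (hfq : f q = 0) {k : ℕ}
    (hA : Algebra.trdeg ℂ A ≤ (k + 1 : ℕ)) : Algebra.trdeg ℂ B ≤ k := by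
  obtain ⟨s, hs⟩ := exists_isTranscendenceBasis ℂ B
  rw [← hs.cardinalMk_eq_trdeg]
  choose g hg using hf
  set y : s → A := fun i => g i with hy
  have hfy : f ∘ y = ((↑) : s → B) := by ext i; simp [hy, hg]
  have hcomp : ∀ p : MvPolynomial s ℂ, f (aeval y p) = aeval (f ∘ y) p := fun p => by
    rw [MvPolynomial.comp_aeval_apply]; rfl
  have hyi : AlgebraicIndependent ℂ y := by
    rw [algebraicIndependent_iff_injective_aeval]
    have h1 := hs.1
    rw [algebraicIndependent_iff_injective_aeval, ← hfy] at h1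
    intro a b hab
    apply h1
    rw [← hcomp, ← hcomp, hab]
  have htr : Transcendental (Algebra.adjoin ℂ (Set.range y)) q := by
    intro halg
    obtain ⟨p, hp0, hp⟩ := halg.exists_nonzero_coeff_and_aeval_eq_zero
      (mem_nonZeroDivisors_of_ne_zero hq)
    apply hp0
    have h2 : f ((p.coeff 0 : Algebra.adjoin ℂ (Set.range y)) : A) = 0 := by
      have h3 := congrArg f hp
      rw [← Polynomial.divX_mul_X_add p] at h3
      simp only [map_add, map_mul, Polynomial.aeval_X, Polynomial.aeval_C, hfq, mul_zero,
        zero_add, map_zero] at h3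
      exact h3
    have h4 : ((p.coeff 0 : Algebra.adjoin ℂ (Set.range y)) : A) ∈ (aeval y).range :=
      (Algebra.adjoin_range_eq_range_aeval ℂ y).le (p.coeff 0).2
    obtain ⟨G, hG⟩ := h4
    rw [← hG] at h2
    have h5 : aeval (f ∘ y) G = 0 := by
      rw [← h2]; exact (hcomp G).symm
    rw [hfy] at h5
    have h6 : G = 0 := hs.1.eq_zero_of_aeval_eq_zero _ h5
    apply Subtype.ext
    rw [← hG, h6]; exact map_zero _
  have h7 := (hyi.option_iff_transcendental q).2 htr
  have h8 := h7.cardinalMk_le_trdeg.trans hA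
  rw [Cardinal.mk_option] at h8
  push_cast at h8
  exact (Cardinal.add_one_le_add_one_iff).1 h8

/-- The Krull-style dimension of `R ⧸ P`, measured by transcendence degree, is at most `k`. -/
def DimLE {R : Type} [CommRing R] [Algebra ℂ R] (P : Ideal R) (k : ℕ) : Prop :=
  Algebra.trdeg ℂ (R ⧸ P) ≤ k

section Dim
variable {R : Type} [CommRing R] [Algebra ℂ R]

theorem DimLE.mono {P : Ideal R} {k l : ℕ} (h : DimLE P k) (hkl : k ≤ l) : DimLE P l :=
  le_trans h (by exact_mod_cast hkl)

theorem DimLE.of_lt {P Q : Ideal R} [P.IsPrime] [Q.IsPrime] (hPQ : P < Q) {k : ℕ}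
    (h : DimLE P (k + 1)) : DimLE Q k := by
  obtain ⟨q, hqQ, hqP⟩ := SetLike.exists_of_lt hPQ
  refine trdeg_le_of_surjective_of_not_injective (Ideal.Quotient.factorₐ ℂ hPQ.le)
    (Ideal.Quotient.factor_surjective hPQ.le) (q := Ideal.Quotient.mk P q) ?_ ?_ h
  · rwa [Ne, Ideal.Quotient.eq_zero_iff_mem]
  · exact Ideal.Quotient.eq_zero_iff_mem.2 hqQ

theorem DimLE.of_le {P Q : Ideal R} (hPQ : P ≤ Q) {k : ℕ} (h : DimLE P k) : DimLE Q k :=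
  (trdeg_le_of_surjective (Ideal.Quotient.factorₐ ℂ hPQ)
    (Ideal.Quotient.factor_surjective hPQ)).trans h

theorem DimLE.not_lt {P Q : Ideal R} [P.IsPrime] [Q.IsPrime] (h : DimLE P 0) : ¬ P < Q := by
  intro hPQ
  obtain ⟨q, hqQ, hqP⟩ := SetLike.exists_of_lt hPQ
  have h0 : Algebra.trdeg ℂ (R ⧸ P) = 0 := by simpa [DimLE] using h
  have h1 := trdeg_eq_zero_iff.1 h0
  have hq : Ideal.Quotient.mk P q ≠ 0 := by rwa [Ne, Ideal.Quotient.eq_zero_iff_mem]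
  obtain ⟨p, hp0, hp⟩ :=
      (h1.isAlgebraic (Ideal.Quotient.mk P q)).exists_nonzero_coeff_and_aeval_eq_zero
      (mem_nonZeroDivisors_of_ne_zero hq)
  have h3 := congrArg (Ideal.Quotient.factorₐ ℂ hPQ.le) hp
  have hfq : Ideal.Quotient.factorₐ ℂ hPQ.le (Ideal.Quotient.mk P q) = 0 :=
    Ideal.Quotient.eq_zero_iff_mem.2 hqQ
  rw [← Polynomial.divX_mul_X_add p] at h3
  simp only [map_add, map_mul, Polynomial.aeval_X, Polynomial.aeval_C, hfq, mul_zero,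
    zero_add, map_zero, AlgHom.commutes] at h3
  exact hp0 ((map_eq_zero_iff _ (algebraMap ℂ (R ⧸ Q)).injective).1 h3)

theorem DimLE.of_isAlgebraic {P : Ideal R} {K : Type} [Field K] [Algebra ℂ K] (f : R →ₐ[ℂ] K)
    (hP : ∀ x, f x = 0 → x ∈ P) (L : IntermediateField ℂ K) (k : ℕ)
    (hL : Algebra.trdeg ℂ L ≤ k) (h : ∀ x, f x ∈ L) : DimLE P k := by
  let g : R →ₐ[ℂ] L.toSubalgebra := f.codRestrict L.toSubalgebra h
  have hker : RingHom.ker g ≤ P := fun x hx => hP x (congrArg Subtype.val hx)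
  refine DimLE.of_le hker ?_
  exact (trdeg_le_of_injective (Ideal.kerLiftAlg g) (Ideal.kerLiftAlg_injective g)).trans hL

end Dim

section AlgCl
variable {K : Type} [Field K] [Algebra ℂ K]

/-- The algebraic closure in `K` of the subfield generated by `s`. -/
def algCl (s : Set K) : IntermediateField ℂ K :=
  { (Subalgebra.restrictScalars ℂ (Subalgebra.algebraicClosure (Algebra.adjoin ℂ s) K)) with
    inv_mem' := fun x hx => by
      have hx' : IsAlgebraic (Algebra.adjoin ℂ s) x := hx
      exact hx'.inv }

theorem mem_algCl {s : Set K} {x : K} : x ∈ algCl s ↔ IsAlgebraic (Algebra.adjoin ℂ s) x :=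
  Iff.rfl

theorem coe_algCl (s : Set K) :
    (algCl s : Set K) = (AlgebraicIndependent.matroid ℂ K).closure s := by
  rw [AlgebraicIndependent.matroid_closure_eq]; rfl

theorem subset_algCl {s : Set K} {x : K} (hx : x ∈ s) : x ∈ algCl s :=
  mem_algCl.2 (isAlgebraic_algebraMap (⟨x, Algebra.subset_adjoin hx⟩ : Algebra.adjoin ℂ s))

theorem trdeg_algCl_le (s : Finset K) : Algebra.trdeg ℂ (algCl (s : Set K)) ≤ s.card := by
  obtain ⟨b, hb⟩ := exists_isTranscendenceBasis ℂ (algCl (s : Set K))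
  rw [← hb.cardinalMk_eq_trdeg]
  have h1 : AlgebraicIndependent ℂ (fun x : b => ((x : algCl (s : Set K)) : K)) :=
    hb.1.map' (f := (algCl (s : Set K)).val) Subtype.val_injective
  set M := AlgebraicIndependent.matroid ℂ K
  have h2 : M.Indep (Set.range (fun x : b => ((x : algCl (s : Set K)) : K))) :=
    AlgebraicIndependent.matroid_indep_iff.2 h1.to_subtype_range
  have h3 : Set.range (fun x : b => ((x : algCl (s : Set K)) : K)) ⊆ M.closure s := by
    rw [← coe_algCl]
    rintro _ ⟨x, rfl⟩
    exact x.1.2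
  have h4 := h2.encard_le_eRk_of_subset h3
  rw [Matroid.eRk_closure_eq] at h4
  have h5 := h4.trans (M.eRk_le_encard s)
  rw [Set.encard_coe_eq_coe_finsetCard] at h5
  have h6 : (Set.range (fun x : b => ((x : algCl (s : Set K)) : K))).Finite :=
    Set.finite_of_encard_le_coe h5
  have hinj : Function.Injective (fun x : b => ((x : algCl (s : Set K)) : K)) := h1.injective
  rw [← Cardinal.mk_range_eq _ hinj]
  have := h6.fintype
  rw [Set.encard_eq_coe_toFinset_card] at h5
  rw [Cardinal.mk_fintype, ← Set.toFinset_card]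
  exact_mod_cast h5

theorem algCl_closed {s : Set K} {x : K} (hx : IsAlgebraic (algCl s) x) : x ∈ algCl s := by
  have h := (AlgebraicIndependent.matroid ℂ K).closure_closure s
  rw [← SetLike.mem_coe, coe_algCl, ← h, AlgebraicIndependent.matroid_closure_eq, ← coe_algCl]
  change IsAlgebraic (Algebra.adjoin ℂ (algCl s : Set K)) x
  obtain ⟨p, hp0, hp⟩ := hx
  have hle : ∀ y : algCl s, (y : K) ∈ Algebra.adjoin ℂ (algCl s : Set K) :=
    fun y => Algebra.subset_adjoin y.2
  let φ : algCl s →+* Algebra.adjoin ℂ (algCl s : Set K) :=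
    { toFun := fun y => ⟨y, hle y⟩
      map_one' := rfl
      map_mul' := fun _ _ => rfl
      map_zero' := rfl
      map_add' := fun _ _ => rfl }
  refine ⟨p.map φ, (Polynomial.map_ne_zero_iff φ.injective).2 hp0, ?_⟩
  rw [Polynomial.aeval_def, Polynomial.eval₂_map]
  exact hp

theorem algCl_of_eval {s : Set K} {x : K} (p : Polynomial K) (hc : ∀ n, p.coeff n ∈ algCl s)
    (hp : p ≠ 0) (hx : p.eval x = 0) : x ∈ algCl s := by
  apply algCl_closed
  have hl : p ∈ Polynomial.lifts (algebraMap (algCl s) K) := by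
    rw [Polynomial.lifts_iff_coeff_lifts]
    exact fun n => ⟨⟨_, hc n⟩, rfl⟩
  obtain ⟨q, rfl⟩ := (Polynomial.mem_lifts _).1 hl
  refine ⟨q, fun h => hp (by simp [h]), ?_⟩
  rw [Polynomial.aeval_def, ← Polynomial.eval_map]; exact hx

theorem algCl_of_pow {s : Set K} {x : K} {n : ℕ} (hn : 0 < n) (h : x ^ n ∈ algCl s) :
    x ∈ algCl s := by
  refine algCl_of_eval (Polynomial.X ^ n - Polynomial.C (x ^ n)) (fun m => ?_)
    (Polynomial.X_pow_sub_C_ne_zero hn _) (by simp)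
  rw [Polynomial.coeff_sub, Polynomial.coeff_X_pow, Polynomial.coeff_C]
  refine sub_mem ?_ ?_ <;> split_ifs <;> first | exact one_mem _ | exact zero_mem _ | exact h

theorem exists_algCl_of_relation {n : ℕ} (x : Fin (n + 1) → K) (Q : MvPolynomial (Fin (n + 1)) ℂ)
    (hQ : Q ≠ 0) (hx : aeval x Q = 0) :
    ∃ s : Finset K, s.card ≤ n ∧ ∀ i, x i ∈ algCl (s : Set K) := by
  classical
  set M := AlgebraicIndependent.matroid ℂ K
  by_cases hinj : Function.Injective x
  · have hind : ¬ M.Indep (Set.range x) := by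
      intro h
      have h1 : AlgebraicIndependent ℂ x := by
        have h2 := AlgebraicIndependent.matroid_indep_iff.1 h
        exact (algebraicIndependent_subtype_range hinj).1 h2
      exact hQ (h1.eq_zero_of_aeval_eq_zero _ hx)
    rw [Matroid.indep_iff_forall_notMem_closure_sdiff] at hind
    push Not at hind
    obtain ⟨e, ⟨i, rfl⟩, he⟩ := hind
    refine ⟨(Finset.univ.image x).erase (x i), ?_, fun j => ?_⟩
    · rw [Finset.card_erase_of_mem (Finset.mem_image_of_mem _ (Finset.mem_univ _)),
        Finset.card_image_of_injective _ hinj]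
      simp
    · by_cases hj : x j = x i
      · rw [← SetLike.mem_coe, coe_algCl, hj]
        convert he using 2
        ext; simp [and_comm]
      · exact subset_algCl (by simp [hj])
  · refine ⟨Finset.univ.image x, ?_, fun j => subset_algCl (by simp)⟩
    have : (Finset.univ.image x).card < n + 1 := by
      refine lt_of_le_of_ne (Finset.card_image_le.trans (by simp)) fun h => hinj ?_
      have h' : (Finset.univ.image x).card = (Finset.univ : Finset (Fin (n + 1))).card := by
          simp [h]
      have := Finset.card_image_iff.1 h'
      simpa using this
    omega

end AlgCl

section Act
variable {B : Type} [CommRing B]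

/-- Coefficients of a septic form from its normalized coefficients. -/
def nrm (v : Fin 8 → B) : Fin 8 → B := fun i => (Nat.choose 7 i : B) * v i

/-- The effect of `x ↦ x + t y` on normalized coefficients. -/
def shiftU (t : B) (v : Fin 8 → B) : Fin 8 → B :=
  ![v 0,
    v 1 + t * v 0,
    v 2 + 2 * t * v 1 + t ^ 2 * v 0,
    v 3 + 3 * t * v 2 + 3 * t ^ 2 * v 1 + t ^ 3 * v 0,
    v 4 + 4 * t * v 3 + 6 * t ^ 2 * v 2 + 4 * t ^ 3 * v 1 + t ^ 4 * v 0,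
    v 5 + 5 * t * v 4 + 10 * t ^ 2 * v 3 + 10 * t ^ 3 * v 2 + 5 * t ^ 4 * v 1 + t ^ 5 * v 0,
    v 6 + 6 * t * v 5 + 15 * t ^ 2 * v 4 + 20 * t ^ 3 * v 3 + 15 * t ^ 4 * v 2 + 6 * t ^ 5 * v 1 +
        t ^ 6 * v 0,
    v 7 + 7 * t * v 6 + 21 * t ^ 2 * v 5 + 35 * t ^ 3 * v 4 + 35 * t ^ 4 * v 3 + 21 * t ^ 5 *
        v 2 + 7 * t ^ 6 * v 1 + t ^ 7 * v 0]

/-- The effect of `y ↦ y + t x` on normalized coefficients. -/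
def shiftL (t : B) (v : Fin 8 → B) : Fin 8 → B :=
  ![v 0 + 7 * t * v 1 + 21 * t ^ 2 * v 2 + 35 * t ^ 3 * v 3 + 35 * t ^ 4 * v 4 + 21 * t ^ 5 *
      v 5 + 7 * t ^ 6 * v 6 + t ^ 7 * v 7,
    v 1 + 6 * t * v 2 + 15 * t ^ 2 * v 3 + 20 * t ^ 3 * v 4 + 15 * t ^ 4 * v 5 + 6 * t ^ 5 * v 6 +
        t ^ 6 * v 7,
    v 2 + 5 * t * v 3 + 10 * t ^ 2 * v 4 + 10 * t ^ 3 * v 5 + 5 * t ^ 4 * v 6 + t ^ 5 * v 7,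
    v 3 + 4 * t * v 4 + 6 * t ^ 2 * v 5 + 4 * t ^ 3 * v 6 + t ^ 4 * v 7,
    v 4 + 3 * t * v 5 + 3 * t ^ 2 * v 6 + t ^ 3 * v 7,
    v 5 + 2 * t * v 6 + t ^ 2 * v 7,
    v 6 + t * v 7,
    v 7]

/-- The effect of `x ↦ y`, `y ↦ -x` on normalized coefficients. -/
def swapXY (v : Fin 8 → B) : Fin 8 → B :=
  ![-v 7, v 6, -v 5, v 4, -v 3, v 2, -v 1, v 0]

theorem shiftU_map {C : Type} [CommRing C] (φ : B →+* C) (t : B) (v : Fin 8 → B) (i : Fin 8) :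
    φ (shiftU t v i) = shiftU (φ t) (fun i => φ (v i)) i := by
  fin_cases i <;> simp [shiftU, map_ofNat φ]

theorem shiftL_map {C : Type} [CommRing C] (φ : B →+* C) (t : B) (v : Fin 8 → B) (i : Fin 8) :
    φ (shiftL t v i) = shiftL (φ t) (fun i => φ (v i)) i := by
  fin_cases i <;> simp [shiftL, map_ofNat φ]

theorem swapXY_map {C : Type} [CommRing C] (φ : B →+* C) (v : Fin 8 → B) (i : Fin 8) :
    φ (swapXY v i) = swapXY (fun i => φ (v i)) i := by
  fin_cases i <;> simp [swapXY]

theorem nrm_map {C : Type} [CommRing C] (φ : B →+* C) (v : Fin 8 → B) (i : Fin 8) :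
    φ (nrm v i) = nrm (fun i => φ (v i)) i := by
  simp [nrm]

end Act

/-- The value of the form with coefficients `a` at `(x, y)`. -/
def formVal (n : ℕ) (a : Fin (n + 1) → ℂ) (x y : ℂ) : ℂ :=
  ∑ i : Fin (n + 1), a i * x ^ (n - (i : ℕ)) * y ^ (i : ℕ)

theorem formVal_injective (n : ℕ) {a b : Fin (n + 1) → ℂ}
    (h : ∀ x y, formVal n a x y = formVal n b x y) : a = b := by
  have key : ∀ c : Fin (n + 1) → ℂ, ∀ y, (∑ i : Fin (n + 1), Polynomial.C (c i) *
      Polynomial.X ^ (i : ℕ)).eval y = formVal n c 1 y := by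
    intro c y; simp [formVal, Polynomial.eval_finsetSum]
  have h1 : (∑ i : Fin (n + 1), Polynomial.C (a i) * Polynomial.X ^ (i : ℕ)) =
      ∑ i : Fin (n + 1), Polynomial.C (b i) * Polynomial.X ^ (i : ℕ) :=
    Polynomial.funext fun y => by rw [key, key, h]
  have hc : ∀ c : Fin (n + 1) → ℂ, ∀ j : Fin (n + 1), (∑ i : Fin (n + 1), Polynomial.C (c i) *
      Polynomial.X ^ (i : ℕ)).coeff j = c j := by
    intro c j
    simp [Polynomial.finsetSum_coeff, Polynomial.coeff_X_pow, Fin.val_inj]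
  funext j
  rw [← hc a, h1, hc]

theorem eval_of_isHomogeneous {n : ℕ} {Q : MvPolynomial (Fin 2) ℂ} (hQ : Q.IsHomogeneous n)
    (x y : ℂ) : eval ![x, y] Q = formVal n (fun i => coeff
      (Finsupp.single 0 (n - (i : ℕ)) + Finsupp.single 1 (i : ℕ)) Q) x y := by
  classical
  set e : Fin (n + 1) → (Fin 2 →₀ ℕ) := fun i =>
    Finsupp.single 0 (n - (i : ℕ)) + Finsupp.single 1 (i : ℕ) with he
  have hinj : Function.Injective e := by
    intro i j hij
    have := DFunLike.congr_fun hij 1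
    simpa [he, Fin.val_inj] using this
  have hsub : Q.support ⊆ Finset.univ.image e := by
    intro m hm
    have hd := hQ (mem_support_iff.1 hm)
    rw [Finsupp.weight_apply, Finsupp.sum_fintype _ _ (by simp)] at hd
    simp only [Fin.sum_univ_two, Pi.one_apply, smul_eq_mul, mul_one] at hd
    refine Finset.mem_image.2 ⟨⟨m 1, by omega⟩, Finset.mem_univ _, ?_⟩
    ext k
    fin_cases k <;> simp [he] <;> omega
  rw [eval_eq', Finset.sum_subset hsub (by
    intro m _ hm
    rw [notMem_support_iff.1 hm, zero_mul]), Finset.sum_image (by intro i _ j _ h; exact hinj h)]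
  refine Finset.sum_congr rfl fun i _ => ?_
  have h0 : e i 0 = n - (i : ℕ) := by
    simp only [he, Finsupp.add_apply, Finsupp.single_eq_same]
    rw [Finsupp.single_eq_of_ne (by decide), add_zero]
  have h1 : e i 1 = (i : ℕ) := by
    simp only [he, Finsupp.add_apply, Finsupp.single_eq_same]
    rw [Finsupp.single_eq_of_ne (by decide), zero_add]
  rw [Fin.prod_univ_two, h0, h1]
  simp only [he, Matrix.cons_val_zero, Matrix.cons_val_one, Matrix.cons_val_fin_one, mul_assoc]

theorem formPoly_isHomogeneous (n : ℕ) (a : Fin (n + 1) → ℂ) :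
    (formPoly n a).IsHomogeneous n := by
  refine IsHomogeneous.sum _ _ _ fun i _ => ?_
  have h := ((isHomogeneous_C (Fin 2) (a i)).mul
    ((isHomogeneous_X ℂ (0 : Fin 2)).pow (n - (i : ℕ)))).mul
    ((isHomogeneous_X ℂ (1 : Fin 2)).pow (i : ℕ))
  convert h using 1
  have := i.2
  omega

theorem formVal_sl2Act (n : ℕ) (g : Matrix.SpecialLinearGroup (Fin 2) ℂ) (a : Fin (n + 1) → ℂ)
    (x y : ℂ) : formVal n (sl2Act n g a) x y =
      formVal n a (g.1 0 0 * x + g.1 0 1 * y) (g.1 1 0 * x + g.1 1 1 * y) := by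
  have hQ : (bind₁ (fun j : Fin 2 => (C (g.1 j 0) * X 0 + C (g.1 j 1) * X 1 :
      MvPolynomial (Fin 2) ℂ)) (formPoly n a)).IsHomogeneous n := by
    have := (formPoly_isHomogeneous n a).aeval (fun j : Fin 2 =>
      (C (g.1 j 0) * X 0 + C (g.1 j 1) * X 1 : MvPolynomial (Fin 2) ℂ)) (n := 1) (fun j => by
        refine IsHomogeneous.add ?_ ?_
        · simpa using (isHomogeneous_C (Fin 2) (g.1 j 0)).mul (isHomogeneous_X ℂ (0 : Fin 2))
        · simpa using (isHomogeneous_C (Fin 2) (g.1 j 1)).mul (isHomogeneous_X ℂ (1 : Fin 2)))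
    simpa using this
  have h := eval_of_isHomogeneous hQ x y
  have hren : bind₁ (fun j : Fin 2 => (C (g.1 j 0) * X 0 + C (g.1 j 1) * X 1 :
      MvPolynomial ℕ ℂ)) (formPoly n a) = rename (fun i : Fin 2 => (i : ℕ))
      (bind₁ (fun j : Fin 2 => (C (g.1 j 0) * X 0 + C (g.1 j 1) * X 1 :
      MvPolynomial (Fin 2) ℂ)) (formPoly n a)) := by
    simp [formPoly]
  have hact : sl2Act n g a = fun i : Fin (n + 1) => coeff
      (Finsupp.single 0 (n - (i : ℕ)) + Finsupp.single 1 (i : ℕ))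
      (bind₁ (fun j : Fin 2 => (C (g.1 j 0) * X 0 + C (g.1 j 1) * X 1 :
      MvPolynomial (Fin 2) ℂ)) (formPoly n a)) := by
    funext i
    rw [sl2Act, hren, ← coeff_rename_mapDomain (fun i : Fin 2 => (i : ℕ)) Fin.val_injective]
    congr 1
    rw [Finsupp.mapDomain_add, Finsupp.mapDomain_single, Finsupp.mapDomain_single]
    rfl
  rw [hact, ← h]
  simp [formPoly, formVal]

theorem sl2Act_eq_of_formVal {n : ℕ} {g : Matrix.SpecialLinearGroup (Fin 2) ℂ}
    {a b : Fin (n + 1) → ℂ} (h : ∀ x y, formVal n b x y =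
      formVal n a (g.1 0 0 * x + g.1 0 1 * y) (g.1 1 0 * x + g.1 1 1 * y)) :
    sl2Act n g a = b :=
  formVal_injective n fun x y => by rw [formVal_sl2Act, h]

theorem sl2Act_mul (n : ℕ) (g h : Matrix.SpecialLinearGroup (Fin 2) ℂ) (a : Fin (n + 1) → ℂ) :
    sl2Act n (g * h) a = sl2Act n h (sl2Act n g a) :=
  sl2Act_eq_of_formVal fun x y => by
    simp only [formVal_sl2Act, Matrix.SpecialLinearGroup.coe_mul, Matrix.mul_apply,
      Fin.sum_univ_two]
    congr 1 <;> ring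

theorem sl2Act_smul (n : ℕ) (g : Matrix.SpecialLinearGroup (Fin 2) ℂ) (c : ℂ)
    (a : Fin (n + 1) → ℂ) : sl2Act n g (c • a) = c • sl2Act n g a := by
  have hs : ∀ (b : Fin (n + 1) → ℂ) x y, formVal n (c • b) x y = c * formVal n b x y := by
    intro b x y; simp [formVal, Finset.mul_sum, mul_assoc]
  exact sl2Act_eq_of_formVal fun x y => by rw [hs, hs, formVal_sl2Act]

/-- The upper unipotent element. -/
def unipU (t : ℂ) : Matrix.SpecialLinearGroup (Fin 2) ℂ :=
  ⟨!![1, t; 0, 1], by simp [Matrix.det_fin_two]⟩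

/-- The lower unipotent element. -/
def unipL (t : ℂ) : Matrix.SpecialLinearGroup (Fin 2) ℂ :=
  ⟨!![1, 0; t, 1], by simp [Matrix.det_fin_two]⟩

/-- The Weyl element. -/
def weylElt : Matrix.SpecialLinearGroup (Fin 2) ℂ :=
  ⟨!![0, 1; -1, 0], by simp [Matrix.det_fin_two]⟩

/-- The torus element. -/
def torusElt (c : ℂ) (hc : c ≠ 0) : Matrix.SpecialLinearGroup (Fin 2) ℂ :=
  ⟨!![c, 0; 0, c⁻¹], by simp [Matrix.det_fin_two, hc]⟩

theorem sl2Act_unipU (t : ℂ) (v : Fin 8 → ℂ) : sl2Act 7 (unipU t) (nrm v) = nrm (shiftU t v) := by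
  refine sl2Act_eq_of_formVal fun x y => ?_
  simp [formVal, Fin.sum_univ_eight, nrm, shiftU, unipU, Nat.choose]
  ring

theorem sl2Act_unipL (t : ℂ) (v : Fin 8 → ℂ) : sl2Act 7 (unipL t) (nrm v) = nrm (shiftL t v) := by
  refine sl2Act_eq_of_formVal fun x y => ?_
  simp [formVal, Fin.sum_univ_eight, nrm, shiftL, unipL, Nat.choose]
  ring

theorem sl2Act_weylElt (v : Fin 8 → ℂ) : sl2Act 7 weylElt (nrm v) = nrm (swapXY v) := by
  refine sl2Act_eq_of_formVal fun x y => ?_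
  simp [formVal, Fin.sum_univ_eight, nrm, swapXY, weylElt, Nat.choose]
  ring

theorem sl2Act_torusElt (c : ℂ) (hc : c ≠ 0) (a : Fin 8 → ℂ) :
    sl2Act 7 (torusElt c hc) a = fun i : Fin 8 => c ^ (7 - 2 * ((i : ℕ) : ℤ)) * a i := by
  refine sl2Act_eq_of_formVal fun x y => ?_
  simp only [formVal, torusElt, Matrix.of_apply, Matrix.cons_val', Matrix.cons_val_zero,
    Matrix.cons_val_one, zero_mul, zero_add, add_zero, Matrix.cons_val_fin_one]
  refine Finset.sum_congr rfl fun i _ => ?_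
  have hi : (i : ℕ) ≤ 7 := by have := i.2; omega
  rw [mul_pow, mul_pow]
  have : c ^ (7 - 2 * ((i : ℕ) : ℤ)) = c ^ (7 - (i : ℕ)) * c⁻¹ ^ (i : ℕ) := by
    rw [inv_pow, ← zpow_natCast, ← zpow_natCast, ← zpow_neg, ← zpow_add₀ hc]
    congr 1
    push_cast [hi]
    ring
  rw [this]
  ring

theorem mem_invariantRing {n : ℕ} {p : MvPolynomial (Fin (n + 1)) ℂ} :
    p ∈ invariantRing n ↔ ∀ g : Matrix.SpecialLinearGroup (Fin 2) ℂ, ∀ a : Fin (n + 1) → ℂ,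
      eval (sl2Act n g a) p = eval a p := Iff.rfl

/-- The raising derivation on the coordinate ring of septics. -/
def derE : Derivation ℂ (MvPolynomial (Fin 8) ℂ) (MvPolynomial (Fin 8) ℂ) :=
  mkDerivation ℂ ![0, 7 * X 0, 6 * X 1, 5 * X 2, 4 * X 3, 3 * X 4, 2 * X 5, X 6]

/-- The lowering derivation on the coordinate ring of septics. -/
def derF : Derivation ℂ (MvPolynomial (Fin 8) ℂ) (MvPolynomial (Fin 8) ℂ) :=
  mkDerivation ℂ ![X 1, 2 * X 2, 3 * X 3, 4 * X 4, 5 * X 5, 6 * X 6, 7 * X 7, 0]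

theorem derivative_eq_of_generators
    (D : Derivation ℂ (MvPolynomial (Fin 8) ℂ) (MvPolynomial (Fin 8) ℂ))
    (φ : MvPolynomial (Fin 8) ℂ →ₐ[ℂ] Polynomial ℂ)
    (h : ∀ i, Polynomial.derivative (φ (X i)) = φ (D (X i))) (p : MvPolynomial (Fin 8) ℂ) :
    Polynomial.derivative (φ p) = φ (D p) := by
  induction p using MvPolynomial.induction_on with
  | C a =>
    rw [← algebraMap_eq, D.map_algebraMap, AlgHom.commutes]
    simp [Polynomial.algebraMap_eq]
  | add p q hp hq => simp [hp, hq]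
  | mul_X p i hp =>
    rw [map_mul, Polynomial.derivative_mul, hp, h, D.leibniz]
    simp [smul_eq_mul]
    ring

theorem derivative_shiftU (v : Fin 8 → ℂ) (p : MvPolynomial (Fin 8) ℂ) :
    Polynomial.derivative (aeval (nrm (shiftU (Polynomial.X : Polynomial ℂ)
      (fun i => Polynomial.C (v i)))) p) =
    aeval (nrm (shiftU (Polynomial.X : Polynomial ℂ) (fun i => Polynomial.C (v i)))) (derE p) := by
  apply derivative_eq_of_generators
  intro i
  rw [derE, mkDerivation_X]
  fin_cases i <;> simp [nrm, shiftU, Nat.choose,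
    map_ofNat (aeval (R := ℂ) _)] <;> ring_nf <;> simp [map_ofNat Polynomial.C] <;> ring

theorem derivative_shiftL (v : Fin 8 → ℂ) (p : MvPolynomial (Fin 8) ℂ) :
    Polynomial.derivative (aeval (nrm (shiftL (Polynomial.X : Polynomial ℂ)
      (fun i => Polynomial.C (v i)))) p) =
    aeval (nrm (shiftL (Polynomial.X : Polynomial ℂ) (fun i => Polynomial.C (v i)))) (derF p) := by
  apply derivative_eq_of_generators
  intro i
  rw [derF, mkDerivation_X]
  fin_cases i <;> simp [nrm, shiftL, Nat.choose,
    map_ofNat (aeval (R := ℂ) _)] <;> ring_nf <;> simp [map_ofNat Polynomial.C] <;> ring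

theorem eval_poly_shiftU (v : Fin 8 → ℂ) (t : ℂ) (p : MvPolynomial (Fin 8) ℂ) :
    (aeval (nrm (shiftU (Polynomial.X : Polynomial ℂ) (fun i => Polynomial.C (v i)))) p).eval t =
      eval (nrm (shiftU t v)) p := by
  rw [← Polynomial.coe_aeval_eq_eval, ← AlgHom.comp_apply, comp_aeval, ← aeval_eq_eval]
  congr 2
  funext i
  rw [← AlgHom.coe_toRingHom, nrm_map]
  simp only [nrm, shiftU_map]
  simp

theorem eval_poly_shiftL (v : Fin 8 → ℂ) (t : ℂ) (p : MvPolynomial (Fin 8) ℂ) :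
    (aeval (nrm (shiftL (Polynomial.X : Polynomial ℂ) (fun i => Polynomial.C (v i)))) p).eval t =
      eval (nrm (shiftL t v)) p := by
  rw [← Polynomial.coe_aeval_eq_eval, ← AlgHom.comp_apply, comp_aeval, ← aeval_eq_eval]
  congr 2
  funext i
  rw [← AlgHom.coe_toRingHom, nrm_map]
  simp only [nrm, shiftL_map]
  simp

theorem nrm_surjective (a : Fin 8 → ℂ) : ∃ v, nrm v = a := by
  refine ⟨fun i => a i / (Nat.choose 7 i : ℂ), ?_⟩
  funext i
  have : (Nat.choose 7 i : ℂ) ≠ 0 := by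
    exact_mod_cast (Nat.choose_pos (by have := i.2; omega)).ne'
  simp [nrm, mul_div_cancel₀ _ this]

theorem shiftU_zero {B : Type} [CommRing B] (v : Fin 8 → B) : shiftU 0 v = v := by
  funext i; fin_cases i <;> simp [shiftU]

theorem shiftL_zero {B : Type} [CommRing B] (v : Fin 8 → B) : shiftL 0 v = v := by
  funext i; fin_cases i <;> simp [shiftL]

theorem derE_eq_zero_iff (p : MvPolynomial (Fin 8) ℂ) :
    derE p = 0 ↔ ∀ t v, eval (nrm (shiftU t v)) p = eval (nrm v) p := by
  constructor
  · intro h t v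
    have h1 := derivative_shiftU v p
    rw [h, map_zero] at h1
    rw [← eval_poly_shiftU, Polynomial.eq_C_of_derivative_eq_zero h1, Polynomial.eval_C,
      Polynomial.coeff_zero_eq_eval_zero, eval_poly_shiftU, shiftU_zero]
  · intro h
    refine MvPolynomial.funext fun a => ?_
    obtain ⟨v, rfl⟩ := nrm_surjective a
    have h1 := derivative_shiftU v p
    have h2 : aeval (nrm (shiftU (Polynomial.X : Polynomial ℂ) (fun i => Polynomial.C (v i)))) p =
        Polynomial.C (eval (nrm v) p) :=
      Polynomial.funext fun t => by rw [eval_poly_shiftU, h, Polynomial.eval_C]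
    rw [h2, Polynomial.derivative_C] at h1
    have h3 := eval_poly_shiftU v 0 (derE p)
    rw [← h1, shiftU_zero, Polynomial.eval_zero] at h3
    rw [← h3, map_zero]

theorem derF_eq_zero_iff (p : MvPolynomial (Fin 8) ℂ) :
    derF p = 0 ↔ ∀ t v, eval (nrm (shiftL t v)) p = eval (nrm v) p := by
  constructor
  · intro h t v
    have h1 := derivative_shiftL v p
    rw [h, map_zero] at h1
    rw [← eval_poly_shiftL, Polynomial.eq_C_of_derivative_eq_zero h1, Polynomial.eval_C,
      Polynomial.coeff_zero_eq_eval_zero, eval_poly_shiftL, shiftL_zero]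
  · intro h
    refine MvPolynomial.funext fun a => ?_
    obtain ⟨v, rfl⟩ := nrm_surjective a
    have h1 := derivative_shiftL v p
    have h2 : aeval (nrm (shiftL (Polynomial.X : Polynomial ℂ) (fun i => Polynomial.C (v i)))) p =
        Polynomial.C (eval (nrm v) p) :=
      Polynomial.funext fun t => by rw [eval_poly_shiftL, h, Polynomial.eval_C]
    rw [h2, Polynomial.derivative_C] at h1
    have h3 := eval_poly_shiftL v 0 (derF p)
    rw [← h1, shiftL_zero, Polynomial.eval_zero] at h3
    rw [← h3, map_zero]

theorem sl2_ext {g h : Matrix.SpecialLinearGroup (Fin 2) ℂ} (h00 : g.1 0 0 = h.1 0 0)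
    (h01 : g.1 0 1 = h.1 0 1) (h10 : g.1 1 0 = h.1 1 0) (h11 : g.1 1 1 = h.1 1 1) : g = h := by
  apply Subtype.ext
  ext i j
  fin_cases i <;> fin_cases j <;> assumption

theorem sl2_mul_apply (g h : Matrix.SpecialLinearGroup (Fin 2) ℂ) (i j : Fin 2) :
    (g * h).1 i j = g.1 i 0 * h.1 0 j + g.1 i 1 * h.1 1 j := by
  change (g.1 * h.1) i j = _
  rw [Matrix.mul_apply, Fin.sum_univ_two]

theorem sl2_eq_of_ne (g : Matrix.SpecialLinearGroup (Fin 2) ℂ) (h : g.1 1 0 ≠ 0) :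
    g = unipU ((g.1 0 0 - 1) / g.1 1 0) * unipL (g.1 1 0) * unipU ((g.1 1 1 - 1) / g.1 1 0) := by
  have hdet := g.2
  rw [Matrix.det_fin_two] at hdet
  apply sl2_ext <;> rw [sl2_mul_apply, sl2_mul_apply, sl2_mul_apply] <;>
    simp [unipU, unipL] <;> field_simp
  · ring
  · linear_combination -hdet
  · ring

theorem sl2_induction {S : Matrix.SpecialLinearGroup (Fin 2) ℂ → Prop}
    (hU : ∀ t, S (unipU t)) (hL : ∀ t, S (unipL t)) (hmul : ∀ g h, S g → S h → S (g * h))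
    (g : Matrix.SpecialLinearGroup (Fin 2) ℂ) : S g := by
  have key : ∀ g : Matrix.SpecialLinearGroup (Fin 2) ℂ, g.1 1 0 ≠ 0 → S g := by
    intro g h
    rw [sl2_eq_of_ne g h]
    exact hmul _ _ (hmul _ _ (hU _) (hL _)) (hU _)
  by_cases h : g.1 1 0 = 0
  · have hdet := g.2
    rw [Matrix.det_fin_two, h] at hdet
    have h2 : S (unipL 1 * g) := by
      apply key
      rw [sl2_mul_apply, h]
      rintro h0
      simp [unipL] at h0
      simp [h0] at hdet
    have h3 : g = unipL (-1) * (unipL 1 * g) := by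
      rw [← mul_assoc]
      have : unipL (-1) * unipL 1 = 1 := by
        apply sl2_ext <;> rw [sl2_mul_apply] <;> simp [unipL]
      rw [this, one_mul]
    rw [h3]
    exact hmul _ _ (hL _) h2
  · exact key g h

theorem mem_invariantRing_iff_der (p : MvPolynomial (Fin 8) ℂ) :
    p ∈ invariantRing 7 ↔ derE p = 0 ∧ derF p = 0 := by
  rw [derE_eq_zero_iff, derF_eq_zero_iff, mem_invariantRing]
  constructor
  · intro h
    exact ⟨fun t v => by rw [← sl2Act_unipU, h], fun t v => by rw [← sl2Act_unipL, h]⟩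
  · rintro ⟨hU, hL⟩ g
    induction g using sl2_induction with
    | hU t =>
      intro a
      obtain ⟨v, rfl⟩ := nrm_surjective a
      rw [sl2Act_unipU, hU]
    | hL t =>
      intro a
      obtain ⟨v, rfl⟩ := nrm_surjective a
      rw [sl2Act_unipL, hL]
    | hmul g h hg hh =>
      intro a
      rw [sl2Act_mul, hh, hg]

theorem homogeneousComponent_mem_invariantRing {p : MvPolynomial (Fin 8) ℂ}
    (hp : p ∈ invariantRing 7) (d : ℕ) : homogeneousComponent d p ∈ invariantRing 7 := by
  intro g a
  have hev : ∀ (b : Fin 8 → ℂ) (c : ℂ), eval (c • b) p =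
      (∑ i ∈ Finset.range (p.totalDegree + 1),
        Polynomial.C (eval b (homogeneousComponent i p)) * Polynomial.X ^ i).eval c := by
    intro b c
    conv_lhs => rw [← sum_homogeneousComponent p]
    rw [map_sum, Polynomial.eval_finsetSum]
    refine Finset.sum_congr rfl fun i _ => ?_
    simp only [Polynomial.eval_mul, Polynomial.eval_C, Polynomial.eval_pow, Polynomial.eval_X]
    rw [eval_eq', eval_eq', Finset.sum_mul]
    refine Finset.sum_congr rfl fun m hm => ?_
    have hd := homogeneousComponent_isHomogeneous i p (mem_support_iff.1 hm)
    rw [Finsupp.weight_apply, Finsupp.sum_fintype _ _ (by simp)] at hd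
    simp only [Pi.one_apply, smul_eq_mul, mul_one] at hd
    simp only [Pi.smul_apply, smul_eq_mul, mul_pow, Finset.prod_mul_distrib,
      Finset.prod_pow_eq_pow_sum, hd]
    ring
  have hpoly : (∑ i ∈ Finset.range (p.totalDegree + 1),
        Polynomial.C (eval (sl2Act 7 g a) (homogeneousComponent i p)) * Polynomial.X ^ i) =
      ∑ i ∈ Finset.range (p.totalDegree + 1),
        Polynomial.C (eval a (homogeneousComponent i p)) * Polynomial.X ^ i :=
    Polynomial.funext fun c => by rw [← hev, ← hev, ← sl2Act_smul, hp]
  by_cases hd : d < p.totalDegree + 1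
  · have := congrArg (fun q => Polynomial.coeff q d) hpoly
    simpa [Polynomial.finsetSum_coeff, Polynomial.coeff_X_pow, hd] using this
  · rw [homogeneousComponent_eq_zero _ _ (by omega), map_zero, map_zero]

theorem weight_eq_zero {p : MvPolynomial (Fin 8) ℂ} (hp : p ∈ invariantRing 7)
    {m : Fin 8 →₀ ℕ} (hm : coeff m p ≠ 0) : ∑ i : Fin 8, (7 - 2 * ((i : ℕ) : ℤ)) * m i = 0 := by
  classical
  set c : Fin 8 → ℂ := fun i => (2 : ℂ) ^ (7 - 2 * ((i : ℕ) : ℤ)) with hc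
  have h1 : bind₁ (fun i => C (c i) * X i) p = p := by
    refine MvPolynomial.funext fun a => ?_
    have := hp (torusElt 2 two_ne_zero) a
    rw [sl2Act_torusElt] at this
    rw [← this, ← aeval_eq_eval, aeval_bind₁]
    simp [hc, aeval_eq_eval]
  have h2 : ∀ q : MvPolynomial (Fin 8) ℂ, coeff m (bind₁ (fun i => C (c i) * X i) q) =
      (∏ i, c i ^ m i) * coeff m q := by
    intro q
    induction q using MvPolynomial.induction_on' with
    | monomial u a =>
      have : bind₁ (fun i => C (c i) * X i) (monomial u a) =
          monomial u ((∏ i, c i ^ u i) * a) := by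
        rw [bind₁_monomial, ← Finset.prod_subset (Finset.subset_univ u.support) (by
          intro i _ hi; rw [Finsupp.notMem_support_iff.1 hi, pow_zero])]
        simp only [mul_pow, Finset.prod_mul_distrib, ← map_pow, ← map_prod]
        rw [monomial_eq (s := u), Finsupp.prod, map_mul]
        ring
      rw [this, coeff_monomial, coeff_monomial]
      split_ifs with h
      · rw [h]
      · simp
    | add p q hp hq => rw [map_add, coeff_add, coeff_add, hp, hq, mul_add]
  have h3 := h2 p
  rw [h1] at h3
  have h4 : ∏ i, c i ^ m i = 1 := mul_right_cancel₀ hm (by rw [← h3, one_mul])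
  have h5 : ∏ i, c i ^ m i = (2 : ℂ) ^ (∑ i : Fin 8, (7 - 2 * ((i : ℕ) : ℤ)) * m i) := by
    rw [Finset.prod_congr rfl (g := fun i : Fin 8 => (2 : ℂ) ^ ((7 - 2 * ((i : ℕ) : ℤ)) * m i)) (by
      intro i _; rw [hc, zpow_mul, zpow_natCast])]
    simp only [Fin.prod_univ_eight, Fin.sum_univ_eight, zpow_add₀ (two_ne_zero' ℂ)]
  rw [h5] at h4
  have h6 : ((2 : ℝ) ^ (∑ i : Fin 8, (7 - 2 * ((i : ℕ) : ℤ)) * m i)) = 1 := by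
    have := congrArg (fun z : ℂ => ‖z‖) h4
    simpa using this
  exact zpow_right_injective₀ (a := (2 : ℝ)) (by norm_num) (by norm_num)
    (by simpa using h6)

section Ev
variable {B : Type} [CommRing B] [Algebra ℂ B]

/-- Evaluation of an invariant at a septic with given normalized coefficients. -/
def ev (v : Fin 8 → B) : invariantRing 7 →ₐ[ℂ] B := (aeval (nrm v)).comp (invariantRing 7).val

theorem ev_apply (v : Fin 8 → B) (p : invariantRing 7) :
    ev v p = aeval (nrm v) (p : MvPolynomial (Fin 8) ℂ) := rfl

theorem map_ev {C : Type} [CommRing C] [Algebra ℂ C] (φ : B →ₐ[ℂ] C) (v : Fin 8 → B)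
    (p : invariantRing 7) : φ (ev v p) = ev (fun i => φ (v i)) p := by
  rw [ev_apply, ev_apply, ← AlgHom.comp_apply, comp_aeval]
  congr 2
  funext i
  exact nrm_map φ.toRingHom v i

theorem ev_shiftU (t : B) (v : Fin 8 → B) (p : invariantRing 7) : ev (shiftU t v) p = ev v p := by
  have h : ev (shiftU (X none : MvPolynomial (Option (Fin 8)) ℂ) (fun i => X (some i))) p =
      ev (fun i => X (some i)) p := by
    refine MvPolynomial.funext fun a => ?_
    rw [← coe_aeval_eq_eval, AlgHom.coe_toRingHom, map_ev, map_ev]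
    simp only [← AlgHom.coe_toRingHom, shiftU_map]
    have := (mem_invariantRing_iff_der _).1 p.2
    simpa [ev_apply, aeval_eq_eval] using
      (derE_eq_zero_iff _).1 this.1 (a none) (fun i => a (some i))
  have h2 := congrArg (aeval (fun o : Option (Fin 8) => o.elim t v)) h
  rw [map_ev, map_ev] at h2
  simp only [← AlgHom.coe_toRingHom, shiftU_map] at h2
  simpa using h2

theorem ev_shiftL (t : B) (v : Fin 8 → B) (p : invariantRing 7) : ev (shiftL t v) p = ev v p := by
  have h : ev (shiftL (X none : MvPolynomial (Option (Fin 8)) ℂ) (fun i => X (some i))) p =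
      ev (fun i => X (some i)) p := by
    refine MvPolynomial.funext fun a => ?_
    rw [← coe_aeval_eq_eval, AlgHom.coe_toRingHom, map_ev, map_ev]
    simp only [← AlgHom.coe_toRingHom, shiftL_map]
    have := (mem_invariantRing_iff_der _).1 p.2
    simpa [ev_apply, aeval_eq_eval] using
      (derF_eq_zero_iff _).1 this.2 (a none) (fun i => a (some i))
  have h2 := congrArg (aeval (fun o : Option (Fin 8) => o.elim t v)) h
  rw [map_ev, map_ev] at h2
  simp only [← AlgHom.coe_toRingHom, shiftL_map] at h2
  simpa using h2

theorem ev_swapXY (v : Fin 8 → B) (p : invariantRing 7) : ev (swapXY v) p = ev v p := by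
  have h : ev (swapXY (fun i => (X i : MvPolynomial (Fin 8) ℂ))) p = ev (fun i => X i) p := by
    refine MvPolynomial.funext fun a => ?_
    rw [← coe_aeval_eq_eval, AlgHom.coe_toRingHom, map_ev, map_ev]
    simp only [← AlgHom.coe_toRingHom, swapXY_map]
    have := p.2 weylElt (nrm a)
    rw [sl2Act_weylElt] at this
    simpa [ev_apply, aeval_eq_eval] using this
  have h2 := congrArg (aeval v) h
  rw [map_ev, map_ev] at h2
  simp only [← AlgHom.coe_toRingHom, swapXY_map] at h2
  simpa using h2

end Ev

theorem ev_torus {K : Type} [Field K] [Algebra ℂ K] {c : K} (hc : c ≠ 0) (v : Fin 8 → K)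
    (p : invariantRing 7) : ev (fun i => c ^ (7 - 2 * ((i : ℕ) : ℤ)) * v i) p = ev v p := by
  rw [ev_apply, ev_apply, aeval_eq_eval₂Hom, aeval_eq_eval₂Hom, coe_eval₂Hom, coe_eval₂Hom,
      eval₂_eq',
    eval₂_eq']
  refine Finset.sum_congr rfl fun m hm => ?_
  have hw := weight_eq_zero p.2 (mem_support_iff.1 hm)
  congr 1
  have h1 : ∀ i : Fin 8, nrm (fun i => c ^ (7 - 2 * ((i : ℕ) : ℤ)) * v i) i ^ m i =
      c ^ ((7 - 2 * ((i : ℕ) : ℤ)) * m i) * nrm v i ^ m i := by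
    intro i
    rw [zpow_mul, zpow_natCast, ← mul_pow, nrm, nrm]
    congr 1
    ring
  have h5 : ∏ i : Fin 8, c ^ ((7 - 2 * ((i : ℕ) : ℤ)) * m i) = 1 := by
    rw [← zpow_zero c, ← hw]
    simp only [Fin.prod_univ_eight, Fin.sum_univ_eight, zpow_add₀ hc]
  rw [Finset.prod_congr rfl fun i _ => h1 i, Finset.prod_mul_distrib, h5, one_mul]

section Fischer
open ComplexConjugate

/-- The weight of a monomial in the Fischer inner product invariant under `SU(2)`. -/
def fischerWeight (m : Fin 8 →₀ ℕ) : ℂ :=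
  ∏ i : Fin 8, ((m i).factorial * (Nat.choose 7 i) ^ (m i) : ℕ)

/-- The Fischer inner product. -/
def fischer (p q : MvPolynomial (Fin 8) ℂ) : ℂ :=
  ∑ m ∈ p.support, coeff m p * conj (coeff m q) * fischerWeight m

theorem fischer_eq_sum {p : MvPolynomial (Fin 8) ℂ} (q : MvPolynomial (Fin 8) ℂ)
    {s : Finset (Fin 8 →₀ ℕ)} (hs : p.support ⊆ s) :
    fischer p q = ∑ m ∈ s, coeff m p * conj (coeff m q) * fischerWeight m := by
  rw [fischer]
  refine Finset.sum_subset hs fun m _ hm => ?_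
  rw [notMem_support_iff.1 hm]
  simp

theorem fischer_add_left (p p' q : MvPolynomial (Fin 8) ℂ) :
    fischer (p + p') q = fischer p q + fischer p' q := by
  classical
  rw [fischer_eq_sum q (support_add.trans (le_refl (p.support ∪ p'.support))),
    fischer_eq_sum q (Finset.subset_union_left (s₂ := p'.support)),
    fischer_eq_sum q (Finset.subset_union_right (s₁ := p.support)), ← Finset.sum_add_distrib]
  refine Finset.sum_congr rfl fun m _ => ?_
  rw [coeff_add]
  ring

theorem fischer_conj (p q : MvPolynomial (Fin 8) ℂ) : conj (fischer p q) = fischer q p := by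
  classical
  rw [fischer_eq_sum q (Finset.subset_union_left (s₂ := q.support)),
    fischer_eq_sum p (Finset.subset_union_right (s₁ := p.support)), map_sum]
  refine Finset.sum_congr rfl fun m _ => ?_
  simp only [map_mul, Complex.conj_conj, fischerWeight, map_prod, map_natCast]
  ring

theorem fischer_add_right (p q q' : MvPolynomial (Fin 8) ℂ) :
    fischer p (q + q') = fischer p q + fischer p q' := by
  rw [← fischer_conj, fischer_add_left, map_add, fischer_conj, fischer_conj]

theorem fischer_smul_left (c : ℂ) (p q : MvPolynomial (Fin 8) ℂ) :
    fischer (C c * p) q = c * fischer p q := by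
  rw [fischer_eq_sum q (s := p.support), fischer_eq_sum q (le_refl p.support), Finset.mul_sum]
  · refine Finset.sum_congr rfl fun m _ => ?_
    rw [coeff_C_mul]
    ring
  · intro m hm
    rw [mem_support_iff, coeff_C_mul] at hm
    exact mem_support_iff.2 (right_ne_zero_of_mul hm)

theorem fischer_smul_right (c : ℂ) (p q : MvPolynomial (Fin 8) ℂ) :
    fischer p (C c * q) = conj c * fischer p q := by
  rw [← fischer_conj, fischer_smul_left, map_mul, fischer_conj]

theorem fischer_self (p : MvPolynomial (Fin 8) ℂ) :
    fischer p p = ((∑ m ∈ p.support, Complex.normSq (coeff m p) *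
      ∏ i : Fin 8, ((m i).factorial * (Nat.choose 7 i) ^ (m i) : ℝ) : ℝ) : ℂ) := by
  rw [fischer]
  push_cast
  refine Finset.sum_congr rfl fun m _ => ?_
  rw [Complex.mul_conj, fischerWeight]
  push_cast
  rfl

theorem fischer_self_eq_zero {p : MvPolynomial (Fin 8) ℂ} (h : fischer p p = 0) : p = 0 := by
  rw [fischer_self, Complex.ofReal_eq_zero] at h
  have hw : ∀ m : Fin 8 →₀ ℕ,
      (0 : ℝ) < ∏ i : Fin 8, ((m i).factorial * (Nat.choose 7 i) ^ (m i) : ℝ) := by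
    intro m
    refine Finset.prod_pos fun i _ => ?_
    have h1 : 0 < Nat.choose 7 i := Nat.choose_pos (by have := i.2; omega)
    have h2 := Nat.factorial_pos (m i)
    positivity
  rw [Finset.sum_eq_zero_iff_of_nonneg fun m _ =>
    mul_nonneg (Complex.normSq_nonneg _) (hw m).le] at h
  by_contra hp
  obtain ⟨m, hm⟩ := Finset.nonempty_of_ne_empty (mt support_eq_empty.1 hp)
  have := h m hm
  rw [mul_eq_zero, or_iff_left (hw m).ne', Complex.normSq_eq_zero] at this
  exact mem_support_iff.1 hm this

theorem fischer_self_re_nonneg (p : MvPolynomial (Fin 8) ℂ) : 0 ≤ (fischer p p).re := by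
  rw [fischer_self, Complex.ofReal_re]
  exact Finset.sum_nonneg fun m _ => mul_nonneg (Complex.normSq_nonneg _)
    (Finset.prod_nonneg fun i _ => by positivity)

theorem fischer_monomial_left (u : Fin 8 →₀ ℕ) (a : ℂ) (q : MvPolynomial (Fin 8) ℂ) :
    fischer (monomial u a) q = a * conj (coeff u q) * fischerWeight u := by
  classical
  rw [fischer_eq_sum q (s := {u}) (support_monomial_subset), Finset.sum_singleton,
    coeff_monomial, if_pos rfl]

theorem fischerWeight_add_single (u : Fin 8 →₀ ℕ) (i : Fin 8) :
    fischerWeight (u + Finsupp.single i 1) =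
      (u i + 1) * (Nat.choose 7 i : ℂ) * fischerWeight u := by
  rw [fischerWeight, fischerWeight, ← Finset.mul_prod_erase _ _ (Finset.mem_univ i),
    ← Finset.mul_prod_erase _ (fun i : Fin 8 => (((u i).factorial *
        (Nat.choose 7 i) ^ (u i) : ℕ) : ℂ))
      (Finset.mem_univ i)]
  have : ∏ x ∈ Finset.univ.erase i, ((((u + Finsupp.single i 1 : Fin 8 →₀ ℕ) x).factorial *
      (Nat.choose 7 x) ^ ((u + Finsupp.single i 1 : Fin 8 →₀ ℕ) x) : ℕ) : ℂ) =
      ∏ x ∈ Finset.univ.erase i, (((u x).factorial * (Nat.choose 7 x) ^ (u x) : ℕ) : ℂ) := by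
    refine Finset.prod_congr rfl fun x hx => ?_
    rw [Finsupp.add_apply, Finsupp.single_eq_of_ne (Finset.ne_of_mem_erase hx), add_zero]
  rw [this, Finsupp.add_apply, Finsupp.single_eq_same, Nat.factorial_succ, pow_succ]
  push_cast
  ring

theorem fischer_X_mul (i : Fin 8) (p q : MvPolynomial (Fin 8) ℂ) :
    fischer (X i * p) q = (Nat.choose 7 i : ℂ) * fischer p (pderiv i q) := by
  induction p using MvPolynomial.induction_on' with
  | add p p' hp hp' => rw [mul_add, fischer_add_left, hp, hp', fischer_add_left, mul_add]
  | monomial u a =>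
    rw [mul_comm, X, monomial_mul, mul_one, fischer_monomial_left, fischer_monomial_left,
      fischerWeight_add_single, coeff_pderiv]
    simp only [map_mul, map_add, map_natCast, map_one]
    ring

theorem fischer_mul_X (i : Fin 8) (p q : MvPolynomial (Fin 8) ℂ) :
    fischer p (X i * q) = (Nat.choose 7 i : ℂ) * fischer (pderiv i p) q := by
  rw [← fischer_conj, fischer_X_mul, map_mul, fischer_conj, map_natCast]

theorem derE_eq (p : MvPolynomial (Fin 8) ℂ) : derE p =
    C 7 * (X 0 * pderiv 1 p) + C 6 * (X 1 * pderiv 2 p) + C 5 * (X 2 * pderiv 3 p) +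
    C 4 * (X 3 * pderiv 4 p) + C 3 * (X 4 * pderiv 5 p) + C 2 * (X 5 * pderiv 6 p) +
    C 1 * (X 6 * pderiv 7 p) := by
  induction p using MvPolynomial.induction_on with
  | C a => simp [derE]
  | add p q hp hq => simp only [map_add, hp, hq]; ring
  | mul_X p i hp =>
    rw [derE.leibniz, hp]
    simp only [Derivation.leibniz, smul_eq_mul, derE, mkDerivation_X, pderiv_X]
    fin_cases i <;> simp [Pi.single_apply, map_ofNat C] <;> ring

theorem derF_eq (p : MvPolynomial (Fin 8) ℂ) : derF p =
    C 1 * (X 1 * pderiv 0 p) + C 2 * (X 2 * pderiv 1 p) + C 3 * (X 3 * pderiv 2 p) +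
    C 4 * (X 4 * pderiv 3 p) + C 5 * (X 5 * pderiv 4 p) + C 6 * (X 6 * pderiv 5 p) +
    C 7 * (X 7 * pderiv 6 p) := by
  induction p using MvPolynomial.induction_on with
  | C a => simp [derF]
  | add p q hp hq => simp only [map_add, hp, hq]; ring
  | mul_X p i hp =>
    rw [derF.leibniz, hp]
    simp only [Derivation.leibniz, smul_eq_mul, derF, mkDerivation_X, pderiv_X]
    fin_cases i <;> simp [Pi.single_apply, map_ofNat C] <;> ring

theorem fischer_derE (p q : MvPolynomial (Fin 8) ℂ) : fischer (derE p) q = fischer p (derF q) := by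
  rw [derE_eq, derF_eq]
  simp only [fischer_add_left, fischer_add_right, fischer_smul_left, fischer_smul_right,
    fischer_X_mul, fischer_mul_X]
  simp [Nat.choose, map_ofNat (starRingEnd ℂ)]
  ring

theorem fischer_derF (p q : MvPolynomial (Fin 8) ℂ) : fischer (derF p) q = fischer p (derE q) := by
  rw [← fischer_conj, ← fischer_derE, fischer_conj]

end Fischer

section FischerAdjoint
open ComplexConjugate

theorem IsHomogeneous.X_mul_pderiv {p : MvPolynomial (Fin 8) ℂ} {d : ℕ} (hp : p.IsHomogeneous d)
    (i j : Fin 8) : (X i * pderiv j p).IsHomogeneous d := by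
  rcases Nat.eq_zero_or_pos d with rfl | hd
  · have : p = C (coeff 0 p) := by
      rw [← totalDegree_eq_zero_iff_eq_C]
      exact Nat.le_zero.1 hp.totalDegree_le
    rw [this, pderiv_C, mul_zero]
    exact isHomogeneous_zero _ _ _
  · have := (isHomogeneous_X ℂ i).mul (hp.pderiv (i := j))
    rwa [Nat.add_sub_cancel' hd] at this

theorem IsHomogeneous.derE {p : MvPolynomial (Fin 8) ℂ} {d : ℕ} (hp : p.IsHomogeneous d) :
    (derE p).IsHomogeneous d := by
  rw [derE_eq]
  have := fun i j => (IsHomogeneous.X_mul_pderiv hp i j)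
  have h : ∀ (c : ℂ) i j, (C c * (X i * pderiv j p)).IsHomogeneous d := fun c i j =>
      (this i j).C_mul c
  exact ((((((h _ _ _).add (h _ _ _)).add (h _ _ _)).add (h _ _ _)).add (h _ _ _)).add
    (h _ _ _)).add (h _ _ _)

theorem IsHomogeneous.derF {p : MvPolynomial (Fin 8) ℂ} {d : ℕ} (hp : p.IsHomogeneous d) :
    (derF p).IsHomogeneous d := by
  rw [derF_eq]
  have := fun i j => (IsHomogeneous.X_mul_pderiv hp i j)
  have h : ∀ (c : ℂ) i j, (C c * (X i * pderiv j p)).IsHomogeneous d := fun c i j =>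
      (this i j).C_mul c
  exact ((((((h _ _ _).add (h _ _ _)).add (h _ _ _)).add (h _ _ _)).add (h _ _ _)).add
    (h _ _ _)).add (h _ _ _)

/-- The operator `EF + FE`, self-adjoint for the Fischer inner product. -/
def casT : MvPolynomial (Fin 8) ℂ →ₗ[ℂ] MvPolynomial (Fin 8) ℂ :=
  derE.toLinearMap ∘ₗ derF.toLinearMap + derF.toLinearMap ∘ₗ derE.toLinearMap

theorem casT_apply (p : MvPolynomial (Fin 8) ℂ) : casT p = derE (derF p) + derF (derE p) := rfl

theorem casT_eq_zero_iff {p : MvPolynomial (Fin 8) ℂ} : casT p = 0 ↔ p ∈ invariantRing 7 := by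
  rw [mem_invariantRing_iff_der]
  constructor
  · intro h
    have h1 : fischer (casT p) p = 0 := by
      rw [h]; simp [fischer]
    rw [casT_apply, fischer_add_left, fischer_derE (derF p), fischer_derF (derE p)] at h1
    have h2 := congrArg Complex.re h1
    rw [Complex.add_re, Complex.zero_re] at h2
    have hE := fischer_self_re_nonneg (derE p)
    have hF := fischer_self_re_nonneg (derF p)
    have him : ∀ q, fischer q q = ((fischer q q).re : ℂ) := by
      intro q; rw [fischer_self, Complex.ofReal_re]
    constructor
    · apply fischer_self_eq_zero
      rw [him, show (fischer (derE p) (derE p)).re = 0 by linarith, Complex.ofReal_zero]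
    · apply fischer_self_eq_zero
      rw [him, show (fischer (derF p) (derF p)).re = 0 by linarith, Complex.ofReal_zero]
  · rintro ⟨hE, hF⟩
    rw [casT_apply, hE, hF, map_zero, map_zero, add_zero]

theorem fischer_casT (p q : MvPolynomial (Fin 8) ℂ) : fischer (casT p) q = fischer p (casT q) := by
  rw [casT_apply, casT_apply, fischer_add_left, fischer_add_right, fischer_derE, fischer_derF,
    fischer_derF, fischer_derE]

theorem casT_ker_range {p : MvPolynomial (Fin 8) ℂ} (h : casT (casT p) = 0) : casT p = 0 := by
  apply fischer_self_eq_zero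
  rw [fischer_casT, h]
  simp [fischer]

theorem casT_mul {r : MvPolynomial (Fin 8) ℂ} (hr : r ∈ invariantRing 7)
    (p : MvPolynomial (Fin 8) ℂ) : casT (r * p) = r * casT p := by
  obtain ⟨hE, hF⟩ := (mem_invariantRing_iff_der r).1 hr
  simp [casT_apply, Derivation.leibniz, hE, hF, mul_add]

instance finite_homogeneousSubmodule (d : ℕ) :
    FiniteDimensional ℂ (homogeneousSubmodule (Fin 8) ℂ d) := by
  have h : homogeneousSubmodule (Fin 8) ℂ d ≤ restrictTotalDegree (Fin 8) ℂ d := by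
    intro p hp
    rw [mem_restrictTotalDegree]
    exact IsHomogeneous.totalDegree_le hp
  exact Submodule.finiteDimensional_of_le h

theorem exists_decomp (p : MvPolynomial (Fin 8) ℂ) :
    ∃ k ∈ invariantRing 7, ∃ q, p = k + casT q := by
  have hom : ∀ d, ∀ p ∈ homogeneousSubmodule (Fin 8) ℂ d,
      ∃ k ∈ invariantRing 7, ∃ q, p = k + casT q := by
    intro d p hp
    set V := homogeneousSubmodule (Fin 8) ℂ d
    let T : V →ₗ[ℂ] V := casT.restrict fun q hq =>
      IsHomogeneous.add (IsHomogeneous.derE (IsHomogeneous.derF hq))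
        (IsHomogeneous.derF (IsHomogeneous.derE hq))
    have hT : ∀ q : V, (T q : MvPolynomial (Fin 8) ℂ) = casT q := fun q => rfl
    have hdisj : Disjoint (LinearMap.ker T) (LinearMap.range T) := by
      rw [Submodule.disjoint_def]
      rintro x hx ⟨y, rfl⟩
      have h1 : casT (casT y) = 0 := congrArg Subtype.val hx
      exact Subtype.ext (casT_ker_range h1)
    have htop := Submodule.eq_top_of_disjoint _ _
      (by rw [add_comm]; exact T.finrank_range_add_finrank_ker.ge) hdisj
    have hpt : (⟨p, hp⟩ : V) ∈ LinearMap.ker T ⊔ LinearMap.range T := htop ▸ Submodule.mem_top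
    obtain ⟨k, hk, _, ⟨q, rfl⟩, hkq⟩ := Submodule.mem_sup.1 hpt
    refine ⟨k, casT_eq_zero_iff.1 (congrArg Subtype.val hk), q, ?_⟩
    have := congrArg Subtype.val hkq
    exact this.symm
  rw [← sum_homogeneousComponent p]
  refine Finset.sum_induction _ (fun p => ∃ k ∈ invariantRing 7, ∃ q, p = k + casT q) ?_ ?_ ?_
  · rintro _ _ ⟨k, hk, q, rfl⟩ ⟨k', hk', q', rfl⟩
    exact ⟨k + k', add_mem hk hk', q + q', by rw [map_add]; ring⟩
  · exact ⟨0, zero_mem _, 0, by simp⟩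
  · intro d _
    exact hom d _ (homogeneousComponent_isHomogeneous d p)

/-- The Reynolds projection. -/
theorem exists_reynolds : ∃ ρ : MvPolynomial (Fin 8) ℂ →ₗ[invariantRing 7] invariantRing 7,
    ∀ r : invariantRing 7, ρ r = r := by
  choose k hk q hq using exists_decomp
  have huniq : ∀ p, ∀ k' ∈ invariantRing 7, ∀ q', p = k' + casT q' → k p = k' := by
    intro p k' hk' q' h
    have h1 : k p - k' = casT (q' - q p) := by
      rw [map_sub]
      linear_combination (hq p).symm.trans h
    have h2 : casT (k p - k') = 0 := casT_eq_zero_iff.2 (sub_mem (hk p) hk')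
    rw [h1] at h2
    have := casT_ker_range h2
    rw [← h1] at this
    exact sub_eq_zero.1 this
  refine ⟨⟨⟨fun p => ⟨k p, hk p⟩, ?_⟩, ?_⟩, ?_⟩
  · intro p p'
    apply Subtype.ext
    refine huniq _ _ (add_mem (hk p) (hk p')) (q p + q p') ?_
    change p + p' = k p + k p' + casT (q p + q p')
    rw [map_add]
    linear_combination hq p + hq p'
  · intro r p
    apply Subtype.ext
    refine huniq _ _ (mul_mem r.2 (hk p)) (r * q p) ?_
    change (r : MvPolynomial (Fin 8) ℂ) * p = r * k p + casT (r * q p)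
    rw [casT_mul r.2]
    linear_combination (r : MvPolynomial (Fin 8) ℂ) * hq p
  · intro r
    apply Subtype.ext
    exact huniq _ _ r.2 0 (by simp)

theorem comap_map_invariantRing (J : Ideal (invariantRing 7)) :
    (J.map (algebraMap (invariantRing 7) (MvPolynomial (Fin 8) ℂ))).comap
      (algebraMap (invariantRing 7) (MvPolynomial (Fin 8) ℂ)) = J := by
  refine le_antisymm ?_ Ideal.le_comap_map
  intro x hx
  obtain ⟨ρ, hρ⟩ := exists_reynolds
  have key : ∀ p ∈ J.map (algebraMap (invariantRing 7) (MvPolynomial (Fin 8) ℂ)), ρ p ∈ J := by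
    intro p hp
    refine Submodule.span_induction (p := fun p _ => ∀ c, ρ (c *
        p) ∈ J) ?_ ?_ ?_ ?_ hp 1 |> fun h => by
      simpa using h
    · rintro _ ⟨j, hj, rfl⟩ c
      have : c * algebraMap (invariantRing 7) (MvPolynomial (Fin 8) ℂ) j = j • c := by
        rw [Algebra.smul_def, mul_comm]
      rw [this, map_smul, smul_eq_mul]
      exact J.mul_mem_right _ hj
    · intro c; simp
    · intro p q _ _ hp hq c
      rw [mul_add, map_add]
      exact add_mem (hp c) (hq c)
    · intro a p _ hp c
      rw [smul_eq_mul, ← mul_assoc]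
      exact hp _
  have := key _ hx
  rwa [show algebraMap (invariantRing 7) (MvPolynomial (Fin 8) ℂ) x = (x : MvPolynomial (Fin 8) ℂ)
    from rfl, hρ] at this

instance invariantRing_isNoetherianRing : IsNoetherianRing (invariantRing 7) := by
  have h : StrictMono (Ideal.map (algebraMap (invariantRing 7) (MvPolynomial (Fin 8) ℂ))) := by
    refine Monotone.strictMono_of_injective (fun _ _ h => Ideal.map_mono h) fun I J h => ?_
    rw [← comap_map_invariantRing I, h, comap_map_invariantRing]
  have := h.wellFoundedGT
  exact isNoetherianRing_iff.2 (isNoetherian_iff'.2 this)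

/-- Every prime of the invariant ring is the vanishing ideal of a septic over some field. -/
theorem exists_point (P : Ideal (invariantRing 7)) [P.IsPrime] :
    ∃ (K : Type) (_ : Field K) (_ : Algebra ℂ K) (_ : IsAlgClosed K) (v : Fin 8 → K),
      ∀ p, p ∈ P ↔ ev v p = 0 := by
  obtain ⟨q, hq, hqP⟩ := (Ideal.comap_map_eq_self_iff_of_isPrime P).1 (comap_map_invariantRing P)
  let φ : MvPolynomial (Fin 8) ℂ →ₐ[ℂ] AlgebraicClosure (FractionRing (MvPolynomial (Fin 8) ℂ ⧸ q)) :=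
    ((IsScalarTower.toAlgHom ℂ (FractionRing (MvPolynomial (Fin 8) ℂ ⧸ q)) _).comp
      (IsScalarTower.toAlgHom ℂ (MvPolynomial (Fin 8) ℂ ⧸ q) _)).comp (Ideal.Quotient.mkₐ ℂ q)
  refine ⟨AlgebraicClosure (FractionRing (MvPolynomial (Fin 8) ℂ ⧸ q)), inferInstance,
      inferInstance,
    inferInstance, fun i => φ (C ((Nat.choose 7 i : ℂ)⁻¹) * X i), fun p => ?_⟩
  have hn : nrm (fun i : Fin 8 => φ (C ((Nat.choose 7 i : ℂ)⁻¹) * X i)) = fun i => φ (X i) := by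
    funext i
    have : (Nat.choose 7 i : ℂ) ≠ 0 := by
      exact_mod_cast (Nat.choose_pos (by have := i.2; omega)).ne'
    rw [nrm, show ((Nat.choose 7 i : ℕ) : AlgebraicClosure (FractionRing
      (MvPolynomial (Fin 8) ℂ ⧸ q))) = φ (C (Nat.choose 7 i : ℂ)) by simp, ← map_mul, ← mul_assoc,
      ← C_mul, mul_inv_cancel₀ this, C_1, one_mul]
  have : ev (fun i => φ (C ((Nat.choose 7 i : ℂ)⁻¹) * X i)) p = φ p := by
    rw [ev_apply, hn]
    exact (DFunLike.congr_fun (aeval_unique φ) _).symm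
  rw [this]
  simp only [φ, AlgHom.comp_apply, IsScalarTower.coe_toAlgHom', Ideal.Quotient.mkₐ_eq_mk]
  rw [FaithfulSMul.algebraMap_eq_zero_iff, FaithfulSMul.algebraMap_eq_zero_iff, 
    Ideal.Quotient.eq_zero_iff_mem, ← hqP, Ideal.mem_comap]
  rfl

end FischerAdjoint

section Selection
variable {R : Type} [CommRing R] [Algebra ℂ R]

theorem exists_mem_avoiding (W : Submodule ℂ R) {T : Set (Ideal R)} (hT : T.Finite)
    (h : ∀ Q ∈ T, ∃ x ∈ W, x ∉ Q) : ∃ x ∈ W, ∀ Q ∈ T, x ∉ Q := by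
  by_contra! hcon
  have := hT.to_subtype
  let p : T → Subspace ℂ W := fun Q => (Submodule.restrictScalars ℂ (Q : Ideal R)).comap W.subtype
  have hcov : ⋃ i, (p i : Set W) = Set.univ := by
    refine Set.eq_univ_of_forall fun x => ?_
    obtain ⟨Q, hQ, hx⟩ := hcon x x.2
    exact Set.mem_iUnion.2 ⟨⟨Q, hQ⟩, hx⟩
  obtain ⟨⟨Q, hQ⟩, htop⟩ := Subspace.exists_eq_top_of_iUnion_eq_univ hcov
  obtain ⟨x, hx, hxQ⟩ := h Q hQ
  have : (⟨x, hx⟩ : W) ∈ p ⟨Q, hQ⟩ := htop ▸ Submodule.mem_top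
  exact hxQ this

/-- Generic elements of the given subspaces cut the dimension down to zero, provided that the
common zero loci of all subfamilies of the subspaces have the expected dimension. -/
theorem exists_selection [IsNoetherianRing R] (m : ℕ) : ∀ (J0 : Set R) (W : Fin m → Submodule ℂ R),
    (∀ (J : Finset (Fin m)) (P : Ideal R), P.IsPrime → J0 ⊆ P → (∀ j ∈ J, ∀ x ∈ W j, x ∈ P) →
      DimLE P (m - J.card)) →
    ∃ p : Fin m → R, (∀ i, p i ∈ W i) ∧
      ∀ P : Ideal R, P.IsPrime → J0 ⊆ P → (∀ i, p i ∈ P) → DimLE P 0 := by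
  classical
  induction m with
  | zero =>
    intro J0 W H
    refine ⟨fun i => i.elim0, fun i => i.elim0, fun P hP hJ _ => ?_⟩
    simpa using H ∅ P hP hJ (by simp)
  | succ m ih =>
    intro J0 W H
    let K : Finset (Fin m) → Set R := fun J => J0 ∪ {x | ∃ j ∈ J, x ∈ W (Fin.succ j)}
    let T : Set (Ideal R) := (⋃ J : Finset (Fin m), (Ideal.span (K J)).minimalPrimes) ∩
      {Q | ∃ x ∈ W 0, x ∉ Q}
    have hT : T.Finite := (Set.finite_iUnion fun J =>
      Ideal.finite_minimalPrimes_of_isNoetherianRing R _).inter_of_left _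
    obtain ⟨x, hxW, hx⟩ := exists_mem_avoiding (W 0) hT fun Q hQ => hQ.2
    obtain ⟨p, hpW, hp⟩ := ih (insert x J0) (fun i => W i.succ) (by
      intro J P hP hJ0 hJ
      have hJ0' : J0 ⊆ P := (Set.subset_insert _ _).trans hJ0
      have hxP : x ∈ P := hJ0 (Set.mem_insert _ _)
      have hKP : Ideal.span (K J) ≤ P := by
        rw [Ideal.span_le]
        rintro y (hy | ⟨j, hj, hy⟩)
        · exact hJ0' hy
        · exact hJ j hj y hy
      obtain ⟨Q, hQmin, hQP⟩ := Ideal.exists_minimalPrimes_le hKP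
      have hQ : Q.IsPrime := hQmin.1.1
      have hKQ : K J ⊆ Q := Ideal.span_le.1 hQmin.1.2
      have hJ0Q : J0 ⊆ Q := fun y hy => hKQ (Or.inl hy)
      have hJQ : ∀ j ∈ J.map (Fin.succEmb m), ∀ y ∈ W j, y ∈ Q := by
        intro j hj y hy
        obtain ⟨i, hi, rfl⟩ := Finset.mem_map.1 hj
        exact hKQ (Or.inr ⟨i, hi, hy⟩)
      have hcard : J.card ≤ m := by simpa using J.card_le_univ
      by_cases h0 : ∃ y ∈ W 0, y ∉ Q
      · have hxQ : x ∉ Q := hx Q ⟨Set.mem_iUnion.2 ⟨J, hQmin⟩, h0⟩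
        have hlt : Q < P := lt_of_le_of_ne hQP (by rintro rfl; exact hxQ hxP)
        refine DimLE.of_lt hlt ?_
        have := H _ Q hQ hJ0Q hJQ
        rw [Finset.card_map] at this
        rwa [show m + 1 - J.card = m - J.card + 1 by omega] at this
      · push Not at h0
        refine DimLE.of_le hQP ?_
        have := H (insert 0 (J.map (Fin.succEmb m))) Q hQ hJ0Q (by
          intro j hj y hy
          rcases Finset.mem_insert.1 hj with rfl | hj
          · exact h0 y hy
          · exact hJQ j hj y hy)
        rw [Finset.card_insert_of_notMem (by simp [Fin.succ_ne_zero]), Finset.card_map] at this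
        rwa [show m + 1 - (J.card + 1) = m - J.card by omega] at this)
    refine ⟨Fin.cons x p, fun i => ?_, fun P hP hJ0 hpP => ?_⟩
    · refine Fin.cases ?_ (fun j => ?_) i
      · simpa using hxW
      · simpa using hpW j
    · refine hp P hP ?_ fun i => by simpa using hpP i.succ
      rintro y (rfl | hy)
      · simpa using hpP 0
      · exact hJ0 hy

theorem DimLE.isAlgebraic {P : Ideal R} [P.IsPrime] (h : DimLE P 0) (x : R) :
    IsAlgebraic ℂ (Ideal.Quotient.mk P x) := by
  have h0 : Algebra.trdeg ℂ (R ⧸ P) = 0 := by simpa [DimLE] using h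
  exact (trdeg_eq_zero_iff.1 h0).isAlgebraic _

end Selection

/-- The homogeneous invariants of degree `d`. -/
def homInv (d : ℕ) : Submodule ℂ (invariantRing 7) :=
  (homogeneousSubmodule (Fin 8) ℂ d).comap (invariantRing 7).val.toLinearMap

theorem mem_homInv {d : ℕ} {x : invariantRing 7} :
    x ∈ homInv d ↔ (x : MvPolynomial (Fin 8) ℂ).IsHomogeneous d := Iff.rfl

theorem homInv_mul {d e : ℕ} {x y : invariantRing 7} (hx : x ∈ homInv d) (hy : y ∈ homInv e) :
    x * y ∈ homInv (d + e) :=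
  IsHomogeneous.mul (mem_homInv.1 hx) (mem_homInv.1 hy)

/-- The homogeneous component of an invariant. -/
def hcInv (d : ℕ) : invariantRing 7 →ₗ[ℂ] invariantRing 7 :=
  ((homogeneousComponent d).comp (invariantRing 7).val.toLinearMap).codRestrict
    (Subalgebra.toSubmodule (invariantRing 7)) fun x =>
      homogeneousComponent_mem_invariantRing x.2 d

theorem coe_hcInv (d : ℕ) (x : invariantRing 7) :
    (hcInv d x : MvPolynomial (Fin 8) ℂ) = homogeneousComponent d (x : MvPolynomial (Fin 8) ℂ) :=
        rfl

theorem hcInv_mem (d : ℕ) (x : invariantRing 7) : hcInv d x ∈ homInv d :=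
  homogeneousComponent_isHomogeneous d _

theorem hcInv_of_mem {d : ℕ} {x : invariantRing 7} (hx : x ∈ homInv d) (e : ℕ) :
    hcInv e x = if e = d then x else 0 := by
  apply Subtype.ext
  have hx' : (x : MvPolynomial (Fin 8) ℂ) ∈ homogeneousSubmodule (Fin 8) ℂ d := hx
  rw [coe_hcInv, homogeneousComponent_of_mem hx']
  split_ifs <;> rfl

theorem sum_hcInv (x : invariantRing 7) :
    ∑ i ∈ Finset.range ((x : MvPolynomial (Fin 8) ℂ).totalDegree + 1), hcInv i x = x := by
  apply Subtype.ext
  rw [AddSubmonoidClass.coe_finsetSum]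
  exact sum_homogeneousComponent _

theorem hcInv_mul {e : ℕ} {g : invariantRing 7} (hg : g ∈ homInv e) (x : invariantRing 7) (d : ℕ) :
    hcInv d (g * x) = if e ≤ d then g * hcInv (d - e) x else 0 := by
  conv_lhs => rw [← sum_hcInv x]
  rw [Finset.mul_sum, map_sum, Finset.sum_congr rfl fun i _ =>
    hcInv_of_mem (homInv_mul hg (hcInv_mem i x)) d]
  split_ifs with h
  · have : ∀ i, (d = e + i) ↔ (d - e = i) := fun i => by omega
    simp only [this, Finset.sum_ite_eq, Finset.mem_range]
    split_ifs with h2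
    · rfl
    · have : hcInv (d - e) x = 0 := Subtype.ext
        (homogeneousComponent_eq_zero (d - e) (x : MvPolynomial (Fin 8) ℂ) (by omega))
      rw [this, mul_zero]
  · exact Finset.sum_eq_zero fun i _ => if_neg (by omega)

theorem ev_homInv_smul {B : Type} [CommRing B] [Algebra ℂ B] {d : ℕ} {x : invariantRing 7}
    (hx : x ∈ homInv d) (c : B) (v : Fin 8 → B) : ev (fun i => c * v i) x = c ^ d * ev v x := by
  rw [ev_apply, ev_apply, aeval_eq_eval₂Hom, aeval_eq_eval₂Hom, coe_eval₂Hom, coe_eval₂Hom,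
    eval₂_eq', eval₂_eq', Finset.mul_sum]
  refine Finset.sum_congr rfl fun m hm => ?_
  have hd := hx (mem_support_iff.1 hm)
  rw [Finsupp.weight_apply, Finsupp.sum_fintype _ _ (by simp)] at hd
  simp only [Pi.one_apply, smul_eq_mul, mul_one] at hd
  have : ∀ i, nrm (fun i => c * v i) i = c * nrm v i := fun i => by rw [nrm, nrm]; ring
  simp only [this, mul_pow, Finset.prod_mul_distrib, Finset.prod_pow_eq_pow_sum]
  rw [hd]
  ring

/-- The ideal generated by homogeneous invariants of positive degree. -/
def irr : Ideal (invariantRing 7) := RingHom.ker (ev (fun _ : Fin 8 => (0 : ℂ)))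

instance irr_isPrime : irr.IsPrime := RingHom.ker_isPrime _

theorem homInv_le_irr {d : ℕ} (hd : 0 < d) {x : invariantRing 7} (hx : x ∈ homInv d) : x ∈ irr := by
  rw [irr, RingHom.mem_ker]
  have := ev_homInv_smul hx (0 : ℂ) (fun _ => 0)
  simpa [hd.ne'] using this

theorem hcInv_zero_eq (x : invariantRing 7) :
    hcInv 0 x = algebraMap ℂ (invariantRing 7) (ev (fun _ : Fin 8 => (0 : ℂ)) x) := by
  apply Subtype.ext
  rw [coe_hcInv, homogeneousComponent_zero, ev_apply]
  have : nrm (fun _ : Fin 8 => (0 : ℂ)) = fun _ => 0 := by funext i; simp [nrm]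
  rw [this, show (fun _ : Fin 8 => (0 : ℂ)) = 0 from rfl, aeval_zero, constantCoeff_eq]
  rfl

theorem irr_le {P : Ideal (invariantRing 7)}
    (h : ∀ d, 0 < d → ∀ x ∈ homInv d, x ∈ P) : irr ≤ P := by
  intro x hx
  rw [← sum_hcInv x]
  refine sum_mem fun i _ => ?_
  rcases Nat.eq_zero_or_pos i with rfl | hi
  · rw [hcInv_zero_eq, RingHom.mem_ker.1 hx, map_zero]
    exact zero_mem _
  · exact h i hi _ (hcInv_mem i x)

/-- If the zero locus of a set of homogeneous invariants is zero-dimensional, it is the origin. -/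
theorem irr_le_of_dimLE_zero {G : Set (invariantRing 7)} (hG : ∀ g ∈ G, ∃ d, g ∈ homInv d)
    (h : ∀ P : Ideal (invariantRing 7), P.IsPrime → G ⊆ P → DimLE P 0)
    (P : Ideal (invariantRing 7)) [hP : P.IsPrime] (hGP : G ⊆ P) : irr ≤ P := by
  obtain ⟨K, _, _, _, v, hv⟩ := exists_point P
  refine irr_le fun d hd x hx => ?_
  let w : Fin 8 → Polynomial K := fun i => Polynomial.X * Polynomial.C (v i)
  have hw : ∀ {e : ℕ} {y : invariantRing 7}, y ∈ homInv e →
      ev w y = Polynomial.X ^ e * Polynomial.C (ev v y) := by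
    intro e y hy
    rw [ev_homInv_smul hy]
    congr 1
    exact (map_ev (IsScalarTower.toAlgHom ℂ K (Polynomial K)) v y).symm
  let Q : Ideal (invariantRing 7) := RingHom.ker (ev w)
  have hQ : Q.IsPrime := RingHom.ker_isPrime _
  have hGQ : G ⊆ Q := by
    intro g hg
    obtain ⟨e, he⟩ := hG g hg
    change ev w g = 0
    rw [hw he, (hv g).1 (hGP hg), Polynomial.C_0, mul_zero]
  obtain ⟨p, hp0, hp⟩ := (h Q hQ hGQ).isAlgebraic x
  have h1 : ev w (Polynomial.aeval x p) = 0 := by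
    have : Ideal.Quotient.mk Q (Polynomial.aeval x p) = 0 := by
      rw [← hp]
      exact (Polynomial.aeval_algHom_apply (Ideal.Quotient.mkₐ ℂ Q) x p).symm
    exact Ideal.Quotient.eq_zero_iff_mem.1 this
  rw [← Polynomial.aeval_algHom_apply, hw hx] at h1
  rw [hv]
  by_contra hne
  have h2 : (p.map (algebraMap ℂ K)).comp (Polynomial.X ^ d * Polynomial.C (ev v x)) = 0 := by
    rw [← h1, Polynomial.comp, Polynomial.eval₂_map, Polynomial.aeval_def]
    rfl
  rcases Polynomial.comp_eq_zero_iff.1 h2 with h3 | ⟨-, h3⟩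
  · exact hp0 ((Polynomial.map_eq_zero _).1 h3)
  · have h4 := congrArg Polynomial.natDegree h3
    rw [Polynomial.natDegree_mul_C hne, Polynomial.natDegree_X_pow, Polynomial.natDegree_C] at h4
    omega

theorem exists_finite_span_sup_irr_pow (k : ℕ) : ∃ T : Set (invariantRing 7), T.Finite ∧
    ∀ x : invariantRing 7, ∃ v ∈ Submodule.span ℂ T, x - v ∈ irr ^ k := by
  induction k with
  | zero => exact ⟨∅, Set.finite_empty, fun x => ⟨0, zero_mem _, by simp⟩⟩
  | succ k ih =>
    obtain ⟨T, hT, hTk⟩ := ih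
    obtain ⟨S, hS⟩ := IsNoetherian.noetherian (irr ^ k)
    refine ⟨T ∪ S, hT.union S.finite_toSet, fun x => ?_⟩
    obtain ⟨v, hv, hxv⟩ := hTk x
    have key : ∀ y ∈ irr ^ k, ∃ w ∈ Submodule.span ℂ (S : Set (invariantRing 7)),
        y - w ∈ irr ^ (k + 1) := by
      intro y hy
      rw [← hS] at hy
      induction hy using Submodule.span_induction with
      | mem t ht => exact ⟨t, Submodule.subset_span ht, by simp⟩
      | zero => exact ⟨0, zero_mem _, by simp⟩
      | add a b _ _ iha ihb =>
        obtain ⟨wa, hwa, ha⟩ := iha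
        obtain ⟨wb, hwb, hb⟩ := ihb
        refine ⟨wa + wb, add_mem hwa hwb, ?_⟩
        rw [add_sub_add_comm]
        exact add_mem ha hb
      | smul r a ha iha =>
        obtain ⟨w, hw, hwa⟩ := iha
        set c : ℂ := ev (fun _ : Fin 8 => (0 : ℂ)) r with hc
        refine ⟨c • w, Submodule.smul_mem _ _ hw, ?_⟩
        have hr : r - algebraMap ℂ _ c ∈ irr := by
          rw [irr, RingHom.mem_ker, map_sub, AlgHom.commutes]
          simp [hc]
        have ha' : a ∈ irr ^ k := by rw [← hS]; exact ha
        have e : r • a - c • w = a * (r - algebraMap ℂ _ c) + algebraMap ℂ _ c * (a - w) := by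
          rw [smul_eq_mul, Algebra.smul_def]; ring
        rw [e]
        refine add_mem ?_ (Ideal.mul_mem_left _ _ hwa)
        rw [pow_succ]
        exact Ideal.mul_mem_mul ha' hr
    obtain ⟨w, hw, hxw⟩ := key _ hxv
    refine ⟨v + w, add_mem (Submodule.span_mono Set.subset_union_left hv)
      (Submodule.span_mono Set.subset_union_right hw), ?_⟩
    rwa [← sub_sub]

/-- Hilbert's finiteness criterion: homogeneous invariants whose common zero locus is the null
cone generate a subalgebra over which the invariant ring is finite. -/
theorem finite_of_irr_le {ι : Type} [Fintype ι] {p : ι → invariantRing 7} {d : ι → ℕ}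
    (hd : ∀ i, 0 < d i) (hp : ∀ i, p i ∈ homInv (d i))
    (h : ∀ P : Ideal (invariantRing 7), P.IsPrime → (∀ i, p i ∈ P) → irr ≤ P) :
    Module.Finite (Algebra.adjoin ℂ (Set.range p)) (invariantRing 7) := by
  set I : Ideal (invariantRing 7) := Ideal.span (Set.range p) with hI
  have hrad : irr ≤ I.radical := by
    rw [Ideal.radical_eq_sInf]
    refine le_sInf fun P hP => h P hP.2 fun i => hP.1 (Ideal.subset_span ⟨i, rfl⟩)
  obtain ⟨k, hk⟩ := Ideal.exists_pow_le_of_le_radical_of_fg hrad (IsNoetherian.noetherian irr)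
  obtain ⟨T, hT, hTk⟩ := exists_finite_span_sup_irr_pow k
  set T' : Set (invariantRing 7) := ⋃ t ∈ T, (fun i => hcInv i t) ''
    (Set.Iic (t : MvPolynomial (Fin 8) ℂ).totalDegree) with hT'
  have hT'fin : T'.Finite := hT.biUnion fun t _ => (Set.finite_Iic _).image _
  have hcT : ∀ v ∈ Submodule.span ℂ T, ∀ e, hcInv e v ∈ Submodule.span ℂ T' := by
    intro v hv e
    induction hv using Submodule.span_induction with
    | mem t ht =>
      by_cases he : e ≤ (t : MvPolynomial (Fin 8) ℂ).totalDegree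
      · exact Submodule.subset_span (Set.mem_biUnion ht ⟨e, he, rfl⟩)
      · have : hcInv e t = 0 := Subtype.ext
          (homogeneousComponent_eq_zero e (t : MvPolynomial (Fin 8) ℂ) (by omega))
        rw [this]
        exact zero_mem _
    | zero => rw [map_zero]; exact zero_mem _
    | add a b _ _ ha hb => rw [map_add]; exact add_mem ha hb
    | smul c a _ ha => rw [map_smul]; exact Submodule.smul_mem _ _ ha
  set A := Algebra.adjoin ℂ (Set.range p)
  have hspan : ∀ v ∈ Submodule.span ℂ T', v ∈ Submodule.span A T' := fun v hv =>
    Submodule.span_le_restrictScalars ℂ A T' hv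
  have hhom : ∀ e, ∀ x ∈ homInv e, x ∈ Submodule.span A T' := by
    intro e
    induction e using Nat.strong_induction_on with
    | _ e ih =>
    intro x hx
    obtain ⟨v, hv, hxv⟩ := hTk x
    have hx1 : x = hcInv e x := by rw [hcInv_of_mem hx, if_pos rfl]
    have h1 : ∀ y ∈ I, hcInv e y ∈ Submodule.span A T' := by
      intro y hy
      rw [hI] at hy
      obtain ⟨c, rfl⟩ := (Ideal.mem_span_range_iff_exists_fun (v := p)).1 hy
      rw [map_sum]
      refine sum_mem fun i _ => ?_
      rw [mul_comm, hcInv_mul (hp i)]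
      split_ifs with hle
      · have := hd i
        exact Submodule.smul_mem _ (⟨p i, Algebra.subset_adjoin ⟨i, rfl⟩⟩ : A)
          (ih (e - d i) (by omega) _ (hcInv_mem _ _))
      · exact zero_mem _
    rw [hx1, ← sub_add_cancel x v, map_add]
    exact add_mem (h1 _ (hk hxv)) (hspan _ (hcT v hv e))
  refine ⟨⟨hT'fin.toFinset, ?_⟩⟩
  rw [Set.Finite.coe_toFinset, eq_top_iff]
  intro x _
  rw [← sum_hcInv x]
  exact sum_mem fun i _ => hhom i _ (hcInv_mem i x)

section
variable {K : Type} [Field K] [Algebra ℂ K]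

theorem DimLE.of_finset {R : Type} [CommRing R] [Algebra ℂ R] {P : Ideal R} (f : R →ₐ[ℂ] K)
    (hP : ∀ x, f x = 0 → x ∈ P) (s : Finset K) {k : ℕ} (hk : s.card ≤ k)
    (h : ∀ x, f x ∈ algCl (s : Set K)) : DimLE P k :=
  DimLE.of_isAlgebraic f hP (algCl (s : Set K)) k
    ((trdeg_algCl_le s).trans (by exact_mod_cast hk)) h

theorem algCl_const (s : Set K) (c : ℂ) : algebraMap ℂ K c ∈ algCl s :=
  (algCl s).algebraMap_mem c

theorem ev_mem_algCl {s : Set K} {v : Fin 8 → K} (h : ∀ i, v i ∈ algCl s)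
    (p : invariantRing 7) : ev v p ∈ algCl s := by
  let w : Fin 8 → algCl s := fun i => ⟨v i, h i⟩
  have := map_ev (algCl s).val w p
  have e : v = fun i => (algCl s).val (w i) := rfl
  rw [e, ← this]
  exact (ev w p).2

theorem DimLE.of_ev {P : Ideal (invariantRing 7)} {v : Fin 8 → K}
    (hv : ∀ p, p ∈ P ↔ ev v p = 0) (s : Finset K) {k : ℕ} (hk : s.card ≤ k)
    (h : ∀ i, v i ∈ algCl (s : Set K)) : DimLE P k :=
  DimLE.of_finset (ev v) (fun x hx => (hv x).2 hx) s hk (ev_mem_algCl h)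

theorem mem_algCl_of_finite {R : Type} [CommRing R] [Algebra ℂ R] {G : Set R}
    (hfin : Module.Finite (Algebra.adjoin ℂ G) R) (f : R →ₐ[ℂ] K) {s : Set K}
    (h : ∀ g ∈ G, f g ∈ algCl s) (x : R) : f x ∈ algCl s := by
  have hA : ∀ a ∈ Algebra.adjoin ℂ G, f a ∈ algCl s := by
    intro a ha
    induction ha using Algebra.adjoin_induction with
    | mem g hg => exact h g hg
    | algebraMap c => rw [AlgHom.commutes]; exact algCl_const s c
    | add a b _ _ ha hb => rw [map_add]; exact add_mem ha hb
    | mul a b _ _ ha hb => rw [map_mul]; exact mul_mem ha hb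
  obtain ⟨q, hq, hqx⟩ := Algebra.IsIntegral.isIntegral (R := Algebra.adjoin ℂ G) x
  let φ : Algebra.adjoin ℂ G →+* K := (f : R →+* K).comp (algebraMap (Algebra.adjoin ℂ G) R)
  refine algCl_of_eval (q.map φ) (fun n => ?_) (hq.map φ).ne_zero ?_
  · rw [Polynomial.coeff_map]
    exact hA _ (q.coeff n).2
  · have := congrArg f hqx
    rw [map_zero] at this
    rw [← this, Polynomial.eval_map]
    exact (Polynomial.hom_eval₂ q _ (f : R →+* K) x).symm

end

section
variable {n : ℕ} {p : Fin n → invariantRing 7}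

theorem DimLE.of_finite_of_mem (hfin :
    Module.Finite (Algebra.adjoin ℂ (Set.range p)) (invariantRing 7))
    (P : Ideal (invariantRing 7)) [P.IsPrime] (J : Finset (Fin n)) (h : ∀ i ∉ J, p i ∈ P) :
    DimLE P J.card := by
  classical
  obtain ⟨K, _, _, _, v, hv⟩ := exists_point P
  refine DimLE.of_finset (ev v) (fun x hx => (hv x).2 hx) (J.image fun i => ev v (p i))
    Finset.card_image_le ?_
  refine mem_algCl_of_finite hfin (ev v) ?_
  rintro _ ⟨i, rfl⟩
  by_cases hi : i ∈ J
  · exact subset_algCl (by exact_mod_cast Finset.mem_image_of_mem _ hi)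
  · rw [(hv _).1 (h i hi)]
    exact zero_mem _

end

theorem algebraicIndependent_of_finite_adjoin {n : ℕ} {p : Fin (n + 1) → invariantRing 7}
    (hfin : Module.Finite (Algebra.adjoin ℂ (Set.range p)) (invariantRing 7))
    (h : ¬ DimLE (⊥ : Ideal (invariantRing 7)) n) : AlgebraicIndependent ℂ p := by
  by_contra hp
  rw [algebraicIndependent_iff] at hp
  push Not at hp
  obtain ⟨Q, hQ, hQ0⟩ := hp
  obtain ⟨K, _, _, _, v, hv⟩ := exists_point (⊥ : Ideal (invariantRing 7))
  obtain ⟨s, hs, hx⟩ := exists_algCl_of_relation (fun i => ev v (p i)) Q hQ0 (by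
    have := congrArg (ev v) hQ
    rwa [map_zero, comp_aeval_apply] at this)
  refine h (DimLE.of_finset (ev v) (fun x hx => (hv x).2 hx) s hs
    (mem_algCl_of_finite hfin (ev v) ?_))
  rintro _ ⟨i, rfl⟩
  exact hx i

section Hilbert
open ComplexConjugate

/-- The bidegree (degree, index sum) of the coefficients. -/
def bideg (i : Fin 8) : ℤ × ℤ := (1, ((i : ℕ) : ℤ))

/-- The polynomials which are homogeneous of degree `d` and isobaric of index sum `w`. -/
def isobaric (d w : ℤ) : Submodule ℂ (MvPolynomial (Fin 8) ℂ) :=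
  weightedHomogeneousSubmodule ℂ bideg (d, w)

theorem isobaric_X_mul_pderiv {d w : ℤ} {p : MvPolynomial (Fin 8) ℂ} (hp : p ∈ isobaric d w)
    (i j : Fin 8) (w' : ℤ) (h : w' + ((j : ℕ) : ℤ) = w + ((i : ℕ) : ℤ)) :
    X i * pderiv j p ∈ isobaric d w' := by
  have h1 : (pderiv j p).IsWeightedHomogeneous bideg (d - 1, w - ((j : ℕ) : ℤ)) :=
    IsWeightedHomogeneous.pderiv hp (by simp [bideg])
  have h2 := (isWeightedHomogeneous_X ℂ bideg i).mul h1
  have e : bideg i + (d - 1, w - ((j : ℕ) : ℤ)) = (d, w') := by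
    ext
    · simp [bideg]
    · simp only [bideg, Prod.snd_add]; omega
  rwa [e] at h2

theorem derF_mem_isobaric {d w : ℤ} {p : MvPolynomial (Fin 8) ℂ} (hp : p ∈ isobaric d w) :
    derF p ∈ isobaric d (w + 1) := by
  rw [derF_eq]
  have h : ∀ (c : ℂ) (i j : Fin 8), (i : ℕ) = j + 1 →
      C c * (X i * pderiv j p) ∈ isobaric d (w + 1) := by
    intro c i j hij
    rw [← smul_eq_C_mul]
    exact Submodule.smul_mem _ _ (isobaric_X_mul_pderiv hp i j _ (by omega))
  exact add_mem (add_mem (add_mem (add_mem (add_mem (add_mem (h _ _ _ rfl) (h _ _ _ rfl))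
    (h _ _ _ rfl)) (h _ _ _ rfl)) (h _ _ _ rfl)) (h _ _ _ rfl)) (h _ _ _ rfl)

theorem derE_derF (p : MvPolynomial (Fin 8) ℂ) : derE (derF p) = derF (derE p) +
    mkDerivation ℂ (fun i : Fin 8 => C (7 - 2 * ((i : ℕ) : ℂ)) * X i) p := by
  have h : ⁅derE, derF⁆ = mkDerivation ℂ (fun i : Fin 8 => C (7 - 2 * ((i : ℕ) : ℂ)) * X i) := by
    refine MvPolynomial.derivation_ext fun i => ?_
    rw [Derivation.commutator_apply, mkDerivation_X]
    have hlit : ∀ (D : Derivation ℂ (MvPolynomial (Fin 8) ℂ) (MvPolynomial (Fin 8) ℂ)) (n : ℕ)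
      [n.AtLeastTwo], D (OfNat.ofNat n) = 0 := fun D n _ => D.map_natCast n
    fin_cases i <;> simp [derE, derF, mkDerivation_X, Derivation.leibniz, map_ofNat, hlit] <;> ring
  rw [← h, Derivation.commutator_apply]
  ring

theorem weightDer_isobaric {d w : ℤ} {p : MvPolynomial (Fin 8) ℂ} (hp : p ∈ isobaric d w) :
    mkDerivation ℂ (fun i : Fin 8 => C (7 - 2 * ((i : ℕ) : ℂ)) * X i) p =
      C (7 * d - 2 * w : ℂ) * p := by
  conv_lhs => rw [p.as_sum]
  conv_rhs => rw [p.as_sum]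
  rw [map_sum, Finset.mul_sum]
  refine Finset.sum_congr rfl fun m hm => ?_
  have hw := hp (mem_support_iff.1 hm)
  rw [Finsupp.weight_apply, Finsupp.sum_fintype _ _ (by simp)] at hw
  have h1 := congrArg Prod.fst hw
  have h2 := congrArg Prod.snd hw
  have hterm : ∀ i : Fin 8, monomial (m - Finsupp.single i 1) ((m i : ℕ) : ℂ) •
      (C (7 - 2 * ((i : ℕ) : ℂ)) * X i) = C (m i * (7 - 2 * ((i : ℕ) : ℂ))) * monomial m 1 := by
    intro i
    have := X_mul_pderiv_monomial (i := i) (m := m) (r := (1 : ℂ))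
    rw [pderiv_monomial, one_mul, nsmul_eq_mul] at this
    rw [smul_eq_mul, mul_comm (C _) (X i), ← mul_assoc, mul_comm _ (X i), this, map_mul,
        map_natCast]
    ring
  rw [mkDerivation_monomial, Finsupp.sum_fintype _ _ (by simp), Finset.sum_congr rfl fun i _ =>
      hterm i,
    ← Finset.sum_mul, ← map_sum, smul_eq_C_mul, ← mul_one (coeff m p), ← C_mul_monomial, mul_one]
  have hs : ∑ i : Fin 8, ((m i : ℂ) * (7 - 2 * ((i : ℕ) : ℂ))) = 7 * d - 2 * w := by
    simp only [Prod.fst_sum, Prod.snd_sum, bideg, Prod.smul_mk, nsmul_eq_mul, mul_one] at h1 h2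
    rw [← h1, ← h2]
    push_cast
    rw [Finset.mul_sum, Finset.mul_sum, ← Finset.sum_sub_distrib]
    exact Finset.sum_congr rfl fun i _ => by ring
  rw [hs]
  ring

theorem derF_injOn_isobaric {d w : ℤ} (h : 2 * w < 7 * d) {p : MvPolynomial (Fin 8) ℂ}
    (hp : p ∈ isobaric d w) (h0 : derF p = 0) : p = 0 := by
  have h1 : fischer (derE (derF p)) p = 0 := by rw [h0, map_zero]; simp [fischer]
  rw [derE_derF, weightDer_isobaric hp, fischer_add_left, fischer_derF, fischer_smul_left] at h1
  have h2 := congrArg Complex.re h1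
  have hE := fischer_self_re_nonneg (derE p)
  have hF := fischer_self_re_nonneg p
  have e : (7 * d - 2 * w : ℂ) = ((7 * d - 2 * w : ℤ) : ℝ) := by push_cast; ring
  rw [e, Complex.add_re, Complex.re_ofReal_mul, Complex.zero_re] at h2
  have hpos : (0 : ℝ) < ((7 * d - 2 * w : ℤ) : ℝ) := by exact_mod_cast (by omega)
  apply fischer_self_eq_zero
  have h3 : (fischer p p).re = 0 := by nlinarith
  rw [fischer_self, Complex.ofReal_re] at h3
  rw [fischer_self, h3, Complex.ofReal_zero]

/-- The number of monomials of degree `d` and index sum `w` in `k` variables. -/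
def monCount : ℕ → ℕ → ℕ → ℕ
  | 0, d, w => if d = 0 ∧ w = 0 then 1 else 0
  | k + 1, d, w => ∑ e : Fin (min d w + 1), monCount k e (w - e)

theorem card_monCount (k d w : ℕ) :
    Finite {m : Fin k → ℕ // ∑ i, m i = d ∧ ∑ i : Fin k, (i : ℕ) * m i = w} ∧
    Nat.card {m : Fin k → ℕ // ∑ i, m i = d ∧ ∑ i : Fin k, (i : ℕ) * m i = w} = monCount k d w := by
  induction k generalizing d w with
  | zero =>
    refine ⟨inferInstance, ?_⟩
    simp only [Finset.univ_eq_empty, Finset.sum_empty, monCount, eq_comm (a := 0)]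
    split_ifs with h
    · have : Unique {m : Fin 0 → ℕ // d = 0 ∧ w = 0} :=
        ⟨⟨⟨Fin.elim0, h⟩⟩, fun x => Subtype.ext (Subsingleton.elim _ _)⟩
      exact Nat.card_unique
    · have : IsEmpty {m : Fin 0 → ℕ // d = 0 ∧ w = 0} := ⟨fun x => h x.2⟩
      exact Nat.card_of_isEmpty
  | succ k ih =>
    let φ : {m : Fin (k + 1) → ℕ // ∑ i, m i = d ∧ ∑ i : Fin (k + 1), (i : ℕ) * m i = w} ≃
        Σ e : Fin (min d w + 1), {m : Fin k → ℕ // ∑ i, m i = (e : ℕ) ∧ ∑ i : Fin k, (i : ℕ) *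
            m i = w - e} :=
      { toFun := fun m => ⟨⟨∑ i : Fin k, m.1 i.succ, by
            obtain ⟨m, h1, h2⟩ := m
            rw [Fin.sum_univ_succ] at h1 h2
            simp only [Fin.val_succ, add_mul, one_mul, Finset.sum_add_distrib] at h2
            simp only; omega⟩, ⟨fun i => m.1 i.succ, rfl, by
            obtain ⟨m, h1, h2⟩ := m
            rw [Fin.sum_univ_succ] at h2
            simp only [Fin.val_succ, add_mul, one_mul, Finset.sum_add_distrib, Fin.val_zero,
              zero_mul, zero_add] at h2
            simp only; omega⟩⟩
        invFun := fun x => ⟨Fin.cons (d - x.1) x.2.1, by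
          obtain ⟨⟨e, he⟩, m, h1, h2⟩ := x
          simp only at h1 h2
          simp only [Fin.sum_univ_succ, Fin.cons_zero, Fin.cons_succ, Fin.val_succ, add_mul,
              one_mul,
            Finset.sum_add_distrib, Fin.val_zero, zero_mul, zero_add, h1, h2]
          omega⟩
        left_inv := by
          rintro ⟨m, h1, h2⟩
          apply Subtype.ext
          funext i
          refine Fin.cases ?_ (fun j => ?_) i
          · rw [Fin.sum_univ_succ] at h1
            simp only [Fin.cons_zero]; omega
          · simp
        right_inv := by
          rintro ⟨⟨e, he⟩, m, h1, h2⟩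
          simp only at h1
          subst h1
          simp only [Fin.cons_succ]
          rfl }
    have := fun e : Fin (min d w + 1) => (ih e (w - e)).1
    refine ⟨Finite.of_equiv _ φ.symm, ?_⟩
    rw [Nat.card_congr φ, Nat.card_sigma, monCount]
    exact Finset.sum_congr rfl fun e _ => (ih e (w - e)).2

theorem isobaric_basis_card (d w : ℕ) :
    Finite {m : Fin 8 →₀ ℕ | Finsupp.weight bideg m = (((d : ℕ) : ℤ), ((w : ℕ) : ℤ))} ∧
    Nat.card {m : Fin 8 →₀ ℕ | Finsupp.weight bideg m = (((d : ℕ) : ℤ), ((w : ℕ) : ℤ))} =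
      monCount 8 d w := by
  have φ : {m : Fin 8 →₀ ℕ | Finsupp.weight bideg m = (((d : ℕ) : ℤ), ((w : ℕ) : ℤ))} ≃
      {m : Fin 8 → ℕ // ∑ i, m i = d ∧ ∑ i : Fin 8, (i : ℕ) * m i = w} := by
    refine Finsupp.equivFunOnFinite.subtypeEquiv fun m => ?_
    rw [Set.mem_ofPred_eq, Finsupp.weight_apply, Finsupp.sum_fintype _ _ (by simp), Prod.ext_iff,
      Prod.fst_sum, Prod.snd_sum]
    simp only [bideg, Prod.smul_mk, nsmul_eq_mul, mul_one, Finsupp.equivFunOnFinite_apply]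
    norm_cast
    simp only [mul_comm]
  have h := card_monCount 8 d w
  have := h.1
  exact ⟨Finite.of_equiv _ φ.symm, (Nat.card_congr φ).trans h.2⟩

theorem finrank_isobaric (d w : ℕ) :
    Module.Finite ℂ (isobaric d w) ∧ Module.finrank ℂ (isobaric d w) = monCount 8 d w := by
  have h := isobaric_basis_card d w
  have := h.1
  rw [isobaric, weightedHomogeneousSubmodule_eq_finsupp_supported]
  exact ⟨Module.Finite.of_basis (basisRestrictSupport ℂ _),
    (Module.finrank_eq_nat_card_basis (basisRestrictSupport ℂ _)).trans h.2⟩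

theorem homInv_isobaric {d w : ℕ} (h : 7 * d = 2 * w) {r : invariantRing 7} (hr : r ∈ homInv d) :
    (r : MvPolynomial (Fin 8) ℂ) ∈ isobaric d w := by
  intro m hm
  have h1 := hr hm
  have h2 := weight_eq_zero r.2 hm
  rw [Finsupp.weight_apply, Finsupp.sum_fintype _ _ (by simp)] at h1 ⊢
  simp only [Pi.one_apply, smul_eq_mul, mul_one] at h1
  rw [Prod.ext_iff, Prod.fst_sum, Prod.snd_sum]
  simp only [bideg, Prod.smul_mk, nsmul_eq_mul, mul_one]
  simp only [sub_mul, Finset.sum_sub_distrib, mul_assoc, ← Finset.mul_sum] at h2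
  have h3 : ∑ i, (m i : ℤ) = d := by exact_mod_cast h1
  refine ⟨h3, ?_⟩
  rw [h3] at h2
  simp only [mul_comm (m _ : ℤ)]
  omega

/-- The homogeneous invariants of degree `d`, as a space of polynomials. -/
def invSpace (d : ℕ) : Submodule ℂ (MvPolynomial (Fin 8) ℂ) :=
  homogeneousSubmodule (Fin 8) ℂ d ⊓ Subalgebra.toSubmodule (invariantRing 7)

instance finite_invSpace (d : ℕ) : Module.Finite ℂ (invSpace d) :=
  Submodule.finiteDimensional_of_le (inf_le_left (b := Subalgebra.toSubmodule (invariantRing 7)))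

theorem coe_mem_invSpace {d : ℕ} {r : invariantRing 7} (hr : r ∈ homInv d) :
    (r : MvPolynomial (Fin 8) ℂ) ∈ invSpace d := ⟨hr, r.2⟩

/-- The Cayley–Sylvester bound. -/
theorem finrank_invSpace_add_le {d w : ℕ} (h : 7 * d = 2 * (w + 1)) :
    Module.finrank ℂ (invSpace d) + monCount 8 d w ≤ monCount 8 d (w + 1) := by
  obtain ⟨hf1, hr1⟩ := finrank_isobaric d w
  obtain ⟨hf2, hr2⟩ := finrank_isobaric d (w + 1)
  let f : invSpace d →ₗ[ℂ] isobaric d ((w + 1 : ℕ) : ℤ) :=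
    (invSpace d).subtype.codRestrict _ fun r => homInv_isobaric (r := ⟨r, r.2.2⟩) h r.2.1
  let g : isobaric d w →ₗ[ℂ] isobaric d ((w + 1 : ℕ) : ℤ) :=
    (derF.toLinearMap ∘ₗ (isobaric d w).subtype).codRestrict _
      fun p => by exact_mod_cast derF_mem_isobaric p.2
  have hinj : Function.Injective (f.coprod g) := by
    refine LinearMap.ker_eq_bot.1 (LinearMap.ker_eq_bot'.2 ?_)
    rintro ⟨r, q⟩ hrq
    have h1 : (r : MvPolynomial (Fin 8) ℂ) + derF q = 0 := congrArg Subtype.val hrq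
    have h2 : fischer (r : MvPolynomial (Fin 8) ℂ) (r + derF q) = 0 := by rw [h1]; simp [fischer]
    rw [fischer_add_right, ← fischer_derE,
      ((mem_invariantRing_iff_der _).1 r.2.2).1] at h2
    have h3 : fischer (r : MvPolynomial (Fin 8) ℂ) r = 0 := by simpa [fischer] using h2
    have h4 := fischer_self_eq_zero h3
    rw [h4, zero_add] at h1
    have h5 := derF_injOn_isobaric (by omega) q.2 h1
    exact Prod.ext (Subtype.ext h4) (Subtype.ext h5)
  have := LinearMap.finrank_le_finrank_of_injective hinj
  rwa [Module.finrank_prod, hr1, hr2] at this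

theorem homInv_eq_zero {d w : ℕ} (h : 7 * d = 2 * (w + 1))
    (hc : monCount 8 d (w + 1) = monCount 8 d w) {r : invariantRing 7} (hr : r ∈ homInv d) :
    r = 0 := by
  have := finrank_invSpace_add_le h
  have h0 : Module.finrank ℂ (invSpace d) = 0 := by omega
  have := (Module.finrank_zero_iff (R := ℂ)).1 h0
  have h1 : (⟨r, coe_mem_invSpace hr⟩ : invSpace d) = 0 := Subsingleton.elim _ _
  exact Subtype.ext (congrArg Subtype.val h1 :)

theorem homInv_two {r : invariantRing 7} (hr : r ∈ homInv 2) : r = 0 :=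
  homInv_eq_zero (w := 6) rfl (by decide +kernel) hr

theorem homInv_six {r : invariantRing 7} (hr : r ∈ homInv 6) : r = 0 :=
  homInv_eq_zero (w := 20) rfl (by decide +kernel) hr

theorem homInv_ten {r : invariantRing 7} (hr : r ∈ homInv 10) : r = 0 :=
  homInv_eq_zero (w := 34) rfl (by decide +kernel) hr

theorem homInv_four {r t : invariantRing 7} (hr : r ∈ homInv 4) (ht : t ∈ homInv 4)
    (hr0 : r ≠ 0) : ∃ c : ℂ, t = c • r := by
  have := finrank_invSpace_add_le (d := 4) (w := 13) rfl
  have h : monCount 8 4 (13 + 1) = monCount 8 4 13 + 1 := by decide +kernel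
  have h1 : Module.finrank ℂ (invSpace 4) ≤ 1 := by omega
  obtain ⟨v, hv⟩ := finrank_le_one_iff.1 h1
  obtain ⟨a, ha⟩ := hv ⟨r, coe_mem_invSpace hr⟩
  obtain ⟨b, hb⟩ := hv ⟨t, coe_mem_invSpace ht⟩
  have ha' : a • (v : MvPolynomial (Fin 8) ℂ) = r := congrArg Subtype.val ha
  have hb' : b • (v : MvPolynomial (Fin 8) ℂ) = t := congrArg Subtype.val hb
  have ha0 : a ≠ 0 := by
    rintro rfl
    exact hr0 (Subtype.ext (by rw [← ha', zero_smul]; rfl))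
  refine ⟨b / a, Subtype.ext ?_⟩
  change (t : MvPolynomial (Fin 8) ℂ) = (b / a) • (r : MvPolynomial (Fin 8) ℂ)
  rw [← ha', ← hb', smul_smul, div_mul_cancel₀ _ ha0]

theorem homInv_odd {d : ℕ} (hd : ¬ 2 ∣ d) {r : invariantRing 7} (hr : r ∈ homInv d) : r = 0 := by
  apply Subtype.ext
  by_contra hne
  obtain ⟨m, hm⟩ := ne_zero_iff.1 hne
  have h1 := hr hm
  have h2 := weight_eq_zero r.2 hm
  rw [Finsupp.weight_apply, Finsupp.sum_fintype _ _ (by simp)] at h1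
  simp only [Pi.one_apply, smul_eq_mul, mul_one] at h1
  simp only [sub_mul, Finset.sum_sub_distrib, mul_assoc, ← Finset.mul_sum] at h2
  have h3 : ∑ i, (m i : ℤ) = d := by exact_mod_cast h1
  rw [h3] at h2
  omega

end Hilbert

/-- The generic septimic with binomially normalised coefficients. -/
def gv (i : Fin 8) : MvPolynomial (Fin 8) ℂ := C ((Nat.choose 7 i : ℂ)⁻¹) * X i

theorem nrm_gv (i : Fin 8) : nrm gv i = X i := by
  rw [nrm, gv, ← mul_assoc]
  have h : (Nat.choose 7 i : ℂ) ≠ 0 := by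
    have := Nat.choose_pos (show (i : ℕ) ≤ 7 by omega)
    exact_mod_cast this.ne'
  rw [← map_natCast (C : ℂ →+* MvPolynomial (Fin 8) ℂ), ← map_mul, mul_inv_cancel₀ h, C_1, one_mul]

theorem gv_homogeneous (i : Fin 8) : (gv i).IsHomogeneous 1 :=
  (isHomogeneous_X ℂ i).C_mul _

theorem derE_gv : derE (gv 0) = 0 ∧ derE (gv 1) = gv 0 ∧ derE (gv 2) = 2 * gv 1 ∧
    derE (gv 3) = 3 * gv 2 ∧ derE (gv 4) = 4 * gv 3 ∧ derE (gv 5) = 5 * gv 4 ∧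
    derE (gv 6) = 6 * gv 5 ∧ derE (gv 7) = 7 * gv 6 := by
  have h : ∀ (i j : Fin 8) (a b : ℂ), derE (X i) = C a * X j →
      (Nat.choose 7 i : ℂ)⁻¹ * a = b * (Nat.choose 7 j : ℂ)⁻¹ → derE (gv i) = C b * gv j := by
    intro i j a b h1 h2
    rw [gv, gv, Derivation.leibniz, derivation_C, smul_zero, add_zero, h1, smul_eq_mul, ← mul_assoc,
      ← mul_assoc, ← map_mul, ← map_mul, h2]
  refine ⟨?_, ?_, ?_, ?_, ?_, ?_, ?_, ?_⟩
  · simp [gv, Derivation.leibniz, derE, mkDerivation_X]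
  · refine (h 1 0 7 1 ?_ ?_).trans ?_ <;> simp [derE, mkDerivation_X, map_ofNat, Nat.choose]
  · refine (h 2 1 6 2 ?_ ?_).trans ?_ <;> simp [derE, mkDerivation_X, map_ofNat,
      Nat.choose]; try norm_num
  · refine (h 3 2 5 3 ?_ ?_).trans ?_ <;> simp [derE, mkDerivation_X, map_ofNat,
      Nat.choose]; try norm_num
  · refine (h 4 3 4 4 ?_ ?_).trans ?_ <;> simp [derE, mkDerivation_X, map_ofNat,
      Nat.choose]; try norm_num
  · refine (h 5 4 3 5 ?_ ?_).trans ?_ <;> simp [derE, mkDerivation_X, map_ofNat,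
      Nat.choose]; try norm_num
  · refine (h 6 5 2 6 ?_ ?_).trans ?_ <;> simp [derE, mkDerivation_X, map_ofNat,
      Nat.choose]; try norm_num
  · refine (h 7 6 1 7 ?_ ?_).trans ?_ <;> simp [derE, mkDerivation_X, map_ofNat, Nat.choose]

theorem derF_gv : derF (gv 0) = 7 * gv 1 ∧ derF (gv 1) = 6 * gv 2 ∧ derF (gv 2) = 5 * gv 3 ∧
    derF (gv 3) = 4 * gv 4 ∧ derF (gv 4) = 3 * gv 5 ∧ derF (gv 5) = 2 * gv 6 ∧
    derF (gv 6) = gv 7 ∧ derF (gv 7) = 0 := by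
  have h : ∀ (i j : Fin 8) (a b : ℂ), derF (X i) = C a * X j →
      (Nat.choose 7 i : ℂ)⁻¹ * a = b * (Nat.choose 7 j : ℂ)⁻¹ → derF (gv i) = C b * gv j := by
    intro i j a b h1 h2
    rw [gv, gv, Derivation.leibniz, derivation_C, smul_zero, add_zero, h1, smul_eq_mul, ← mul_assoc,
      ← mul_assoc, ← map_mul, ← map_mul, h2]
  refine ⟨?_, ?_, ?_, ?_, ?_, ?_, ?_, ?_⟩
  · refine (h 0 1 1 7 ?_ ?_).trans ?_ <;> simp [derF, mkDerivation_X, map_ofNat, Nat.choose]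
  · refine (h 1 2 2 6 ?_ ?_).trans ?_ <;> simp [derF, mkDerivation_X, map_ofNat,
      Nat.choose]; try norm_num
  · refine (h 2 3 3 5 ?_ ?_).trans ?_ <;> simp [derF, mkDerivation_X, map_ofNat,
      Nat.choose]; try norm_num
  · refine (h 3 4 4 4 ?_ ?_).trans ?_ <;> simp [derF, mkDerivation_X, map_ofNat,
      Nat.choose]; try norm_num
  · refine (h 4 5 5 3 ?_ ?_).trans ?_ <;> simp [derF, mkDerivation_X, map_ofNat,
      Nat.choose]; try norm_num
  · refine (h 5 6 6 2 ?_ ?_).trans ?_ <;> simp [derF, mkDerivation_X, map_ofNat,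
      Nat.choose]; try norm_num
  · refine (h 6 7 7 1 ?_ ?_).trans ?_ <;> simp [derF, mkDerivation_X, map_ofNat, Nat.choose]
  · simp [gv, Derivation.leibniz, derF, mkDerivation_X]

section Tuples
variable {B : Type} [CommRing B]

/-- The transvectant `(f, f)₆`, up to a scalar. -/
def psiT (v : Fin 8 → B) : ℕ → B
  | 0 => 2 * (v 0 * v 6) - 12 * (v 1 * v 5) + 30 * (v 2 * v 4) - 20 * (v 3 * v 3)
  | 1 => (v 0 * v 7) - 5 * (v 1 * v 6) + 9 * (v 2 * v 5) - 5 * (v 3 * v 4)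
  | 2 => 2 * (v 1 * v 7) - 12 * (v 2 * v 6) + 30 * (v 3 * v 5) - 20 * (v 4 * v 4)
  | _ => 0

/-- The transvectant `(f, f)₄`, up to a scalar. -/
def kT (v : Fin 8 → B) : ℕ → B
  | 0 => 20 * (v 0 * v 4) - 80 * (v 1 * v 3) + 60 * (v 2 * v 2)
  | 1 => 10 * (v 0 * v 5) - 30 * (v 1 * v 4) + 20 * (v 2 * v 3)
  | 2 => 4 * (v 0 * v 6) - 4 * (v 1 * v 5) - 20 * (v 2 * v 4) + 20 * (v 3 * v 3)
  | 3 => (v 0 * v 7) + 5 * (v 1 * v 6) - 21 * (v 2 * v 5) + 15 * (v 3 * v 4)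
  | 4 => 4 * (v 1 * v 7) - 4 * (v 2 * v 6) - 20 * (v 3 * v 5) + 20 * (v 4 * v 4)
  | 5 => 10 * (v 2 * v 7) - 30 * (v 3 * v 6) + 20 * (v 4 * v 5)
  | 6 => 20 * (v 3 * v 7) - 80 * (v 4 * v 6) + 60 * (v 5 * v 5)
  | _ => 0

/-- The transvectant `(f, f)₂`, up to a scalar. -/
def hT (v : Fin 8 → B) : ℕ → B
  | 0 => 252 * (v 0 * v 2) - 252 * (v 1 * v 1)
  | 1 => 126 * (v 0 * v 3) - 126 * (v 1 * v 2)
  | 2 => 56 * (v 0 * v 4) + 28 * (v 1 * v 3) - 84 * (v 2 * v 2)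
  | 3 => 21 * (v 0 * v 5) + 63 * (v 1 * v 4) - 84 * (v 2 * v 3)
  | 4 => 6 * (v 0 * v 6) + 48 * (v 1 * v 5) + 6 * (v 2 * v 4) - 60 * (v 3 * v 3)
  | 5 => (v 0 * v 7) + 23 * (v 1 * v 6) + 51 * (v 2 * v 5) - 75 * (v 3 * v 4)
  | 6 => 6 * (v 1 * v 7) + 48 * (v 2 * v 6) + 6 * (v 3 * v 5) - 60 * (v 4 * v 4)
  | 7 => 21 * (v 2 * v 7) + 63 * (v 3 * v 6) - 84 * (v 4 * v 5)
  | 8 => 56 * (v 3 * v 7) + 28 * (v 4 * v 6) - 84 * (v 5 * v 5)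
  | 9 => 126 * (v 4 * v 7) - 126 * (v 5 * v 6)
  | 10 => 252 * (v 5 * v 7) - 252 * (v 6 * v 6)
  | _ => 0

/-- The fourth transvectant of a binary sextic with itself, up to a scalar. -/
def sextic4 (k : ℕ → B) : ℕ → B
  | 0 => 6 * (k 0 * k 4) - 24 * (k 1 * k 3) + 18 * (k 2 * k 2)
  | 1 => 3 * (k 0 * k 5) - 9 * (k 1 * k 4) + 6 * (k 2 * k 3)
  | 2 => (k 0 * k 6) - 9 * (k 2 * k 4) + 8 * (k 3 * k 3)
  | 3 => 3 * (k 1 * k 6) - 9 * (k 2 * k 5) + 6 * (k 3 * k 4)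
  | 4 => 6 * (k 2 * k 6) - 24 * (k 3 * k 5) + 18 * (k 4 * k 4)
  | _ => 0

end Tuples

/-- A joint covariant of the septimic of orders `m`, `n` and degree `d`. -/
structure Cov (m n d : ℕ) where
  val : ∀ {B : Type} [CommRing B] [Algebra ℂ B], (Fin 8 → B) → ℕ → ℕ → B
  map_val : ∀ {B D : Type} [CommRing B] [Algebra ℂ B] [CommRing D] [Algebra ℂ D] (φ : B →ₐ[ℂ] D)
    (v : Fin 8 → B) (i j : ℕ), φ (val v i j) = val (fun i => φ (v i)) i j
  hom : ∀ i j, (val gv i j).IsHomogeneous d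
  derE_val : ∀ i j, i ≤ m → j ≤ n →
    derE (val gv i j) = i * val gv (i - 1) j + j * val gv i (j - 1)
  derF_val : ∀ i j, i ≤ m → j ≤ n →
    derF (val gv i j) = (m - i : ℕ) * val gv (i + 1) j + (n - j : ℕ) * val gv i (j + 1)

namespace Cov

/-- The invariant given by a covariant of order zero. -/
def toInv {d : ℕ} (c : Cov 0 0 d) : invariantRing 7 :=
  ⟨c.val gv 0 0, (mem_invariantRing_iff_der _).2
    ⟨by simpa using c.derE_val 0 0 le_rfl le_rfl, by simpa using c.derF_val 0 0 le_rfl le_rfl⟩⟩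

theorem toInv_mem {d : ℕ} (c : Cov 0 0 d) : c.toInv ∈ homInv d := c.hom 0 0

theorem ev_toInv {d : ℕ} (c : Cov 0 0 d) {B : Type} [CommRing B] [Algebra ℂ B] (v : Fin 8 → B) :
    ev v c.toInv = c.val v 0 0 := by
  rw [ev_apply, toInv, c.map_val]
  congr 1
  funext i
  have := congrArg (aeval (nrm v)) (nrm_gv i)
  rw [aeval_X, nrm, nrm, map_mul, map_natCast] at this
  have h0 : ((Nat.choose 7 i : ℂ)) ≠ 0 := by
    have := Nat.choose_pos (show (i : ℕ) ≤ 7 by omega)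
    exact_mod_cast this.ne'
  have hu : IsUnit (Nat.choose 7 i : B) := by
    rw [← map_natCast (algebraMap ℂ B)]
    exact (IsUnit.mk0 _ h0).map _
  exact hu.mul_left_cancel this

def mul {m n d e : ℕ} (b : Cov m 0 d) (c : Cov n 0 e) : Cov m n (d + e) where
  val v i j := b.val v i 0 * c.val v j 0
  map_val φ v i j := by rw [map_mul, b.map_val, c.map_val]
  hom i j := (b.hom i 0).mul (c.hom j 0)
  derE_val i j hi hj := by
    rw [Derivation.leibniz, b.derE_val i 0 hi le_rfl, c.derE_val j 0 hj le_rfl]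
    simp only [smul_eq_mul, Nat.cast_zero]
    ring
  derF_val i j hi hj := by
    rw [Derivation.leibniz, b.derF_val i 0 hi le_rfl, c.derF_val j 0 hj le_rfl]
    simp only [smul_eq_mul, Nat.cast_zero, Nat.sub_zero]
    ring

/-- Cayley's omega process. -/
def om {m n d : ℕ} (b : Cov (m + 1) (n + 1) d) : Cov m n d where
  val v i j := b.val v (i + 1) j - b.val v i (j + 1)
  map_val φ v i j := by rw [map_sub, b.map_val, b.map_val]
  hom i j := (b.hom _ _).sub (b.hom _ _)
  derE_val i j hi hj := by
    rw [map_sub, b.derE_val (i + 1) j (by omega) (by omega), b.derE_val i (j +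
        1) (by omega) (by omega)]
    rcases i with _ | i <;> rcases j with _ | j <;> simp <;> ring
  derF_val i j hi hj := by
    rw [map_sub, b.derF_val (i + 1) j (by omega) (by omega), b.derF_val i (j +
        1) (by omega) (by omega)]
    obtain ⟨p, rfl⟩ := Nat.exists_eq_add_of_le hi
    obtain ⟨q, rfl⟩ := Nat.exists_eq_add_of_le hj
    simp only [show i + p + 1 - (i + 1) = p by omega, show i + p + 1 - i = p + 1 by omega,
      show j + q + 1 - (j + 1) = q by omega, show j + q + 1 - j = q + 1 by omega,
      show i + p - i = p by omega, show j + q - j = q by omega]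
    push_cast
    ring

/-- Contraction of the first slot with a quadratic covariant. -/
def c1 {m n d e : ℕ} (p : Cov 2 0 e) (b : Cov (m + 2) n d) : Cov m n (d + e) where
  val v i j := b.val v i j * p.val v 2 0 - 2 * (b.val v (i + 1) j * p.val v 1 0) +
    b.val v (i + 2) j * p.val v 0 0
  map_val φ v i j := by simp only [map_sub, map_add, map_mul, b.map_val, p.map_val, map_ofNat]
  hom i j := by
    refine (((b.hom _ _).mul (p.hom _ _)).sub ?_).add ((b.hom _ _).mul (p.hom _ _))
    rw [← map_ofNat (C : ℂ →+* MvPolynomial (Fin 8) ℂ)]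
    exact ((b.hom _ _).mul (p.hom _ _)).C_mul _
  derE_val i j hi hj := by
    have hlit : derE 2 = 0 := derE.map_natCast 2
    simp only [map_sub, map_add, Derivation.leibniz, smul_eq_mul, hlit,
      b.derE_val i j (by omega) hj, b.derE_val (i + 1) j (by omega) hj,
      b.derE_val (i + 2) j (by omega) hj, p.derE_val 2 0 le_rfl le_rfl,
      p.derE_val 1 0 (by omega) le_rfl, p.derE_val 0 0 (by omega) le_rfl]
    rcases i with _ | i <;> simp <;> ring
  derF_val i j hi hj := by
    have hlit : derF 2 = 0 := derF.map_natCast 2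
    simp only [map_sub, map_add, Derivation.leibniz, smul_eq_mul, hlit,
      b.derF_val i j (by omega) hj, b.derF_val (i + 1) j (by omega) hj,
      b.derF_val (i + 2) j (by omega) hj, p.derF_val 2 0 le_rfl le_rfl,
      p.derF_val 1 0 (by omega) le_rfl, p.derF_val 0 0 (by omega) le_rfl]
    obtain ⟨q, rfl⟩ := Nat.exists_eq_add_of_le hi
    simp only [show i + q + 2 - (i + 1) = q + 1 by omega, show i + q + 2 - i = q + 2 by omega,
      show i + q + 2 - (i + 2) = q by omega, show i + q - i = q by omega]
    push_cast
    ring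

/-- Exchange of the two slots. -/
def swap {m n d : ℕ} (b : Cov m n d) : Cov n m d where
  val v i j := b.val v j i
  map_val φ v i j := b.map_val φ v j i
  hom i j := b.hom j i
  derE_val i j hi hj := by rw [b.derE_val j i hj hi, add_comm]
  derF_val i j hi hj := by rw [b.derF_val j i hj hi, add_comm]

/-- Contraction of the second slot with a quadratic covariant. -/
def c2 {m n d e : ℕ} (p : Cov 2 0 e) (b : Cov m (n + 2) d) : Cov m n (d + e) :=
  (c1 p b.swap).swap

/-- Contraction of both slots with a quadratic covariant. -/
def c12 {m n d e : ℕ} (p : Cov 2 0 e) (b : Cov (m + 1) (n + 1) d) : Cov m n (d + e) where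
  val v i j := b.val v i j * p.val v 2 0 - (b.val v (i + 1) j + b.val v i (j + 1)) * p.val v 1 0 +
    b.val v (i + 1) (j + 1) * p.val v 0 0
  map_val φ v i j := by simp only [map_sub, map_add, map_mul, b.map_val, p.map_val]
  hom i j := (((b.hom _ _).mul (p.hom _ _)).sub (((b.hom _ _).add (b.hom _ _)).mul (p.hom _ _))).add
    ((b.hom _ _).mul (p.hom _ _))
  derE_val i j hi hj := by
    simp only [map_sub, map_add, Derivation.leibniz, smul_eq_mul,
      b.derE_val i j (by omega) (by omega), b.derE_val (i + 1) j (by omega) (by omega),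
      b.derE_val i (j + 1) (by omega) (by omega), b.derE_val (i + 1) (j + 1) (by omega) (by omega),
      p.derE_val 2 0 le_rfl le_rfl,
      p.derE_val 1 0 (by omega) le_rfl, p.derE_val 0 0 (by omega) le_rfl]
    rcases i with _ | i <;> rcases j with _ | j <;> simp <;> ring
  derF_val i j hi hj := by
    simp only [map_sub, map_add, Derivation.leibniz, smul_eq_mul,
      b.derF_val i j (by omega) (by omega), b.derF_val (i + 1) j (by omega) (by omega),
      b.derF_val i (j + 1) (by omega) (by omega), b.derF_val (i + 1) (j + 1) (by omega) (by omega),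
      p.derF_val 2 0 le_rfl le_rfl,
      p.derF_val 1 0 (by omega) le_rfl, p.derF_val 0 0 (by omega) le_rfl]
    obtain ⟨p, rfl⟩ := Nat.exists_eq_add_of_le hi
    obtain ⟨q, rfl⟩ := Nat.exists_eq_add_of_le hj
    simp only [show i + p + 1 - (i + 1) = p by omega, show i + p + 1 - i = p + 1 by omega,
      show j + q + 1 - (j + 1) = q by omega, show j + q + 1 - j = q + 1 by omega,
      show i + p - i = p by omega, show j + q - j = q by omega]
    push_cast
    ring

end Cov

theorem IsHomogeneous.ofNat_mul {d : ℕ} (n : ℕ) [n.AtLeastTwo] {p : MvPolynomial (Fin 8) ℂ}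
    (hp : p.IsHomogeneous d) : (OfNat.ofNat n * p).IsHomogeneous d := by
  rw [← map_ofNat (C : ℂ →+* MvPolynomial (Fin 8) ℂ)]
  exact hp.C_mul _

theorem derivation_ofNat {A : Type} [CommRing A] [Algebra ℂ A] (D : Derivation ℂ A A)
    (n : ℕ) [n.AtLeastTwo] : D (OfNat.ofNat n) = 0 := D.map_natCast n

theorem derivation_mul {A : Type} [CommRing A] [Algebra ℂ A] (D : Derivation ℂ A A) (a b : A) :
    D (a * b) = a * D b + b * D a := D.leibniz a b

theorem psiT_isHomogeneous {g : Fin 8 → MvPolynomial (Fin 8) ℂ} (hg : ∀ i, (g i).IsHomogeneous 1)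
    (i : ℕ) : (psiT g i).IsHomogeneous 2 := by
  have h : ∀ i j, (g i * g j).IsHomogeneous 2 := fun i j => (hg i).mul (hg j)
  rcases i with _ | _ | _ | i
  · exact ((((IsHomogeneous.ofNat_mul 2 (h 0 6)).sub (IsHomogeneous.ofNat_mul 12 (h 1 5))).add (IsHomogeneous.ofNat_mul 30 (h 2 4))).sub (IsHomogeneous.ofNat_mul 20 (h 3 3)))
  · exact ((((h 0 7).sub (IsHomogeneous.ofNat_mul 5 (h 1 6))).add (IsHomogeneous.ofNat_mul 9 (h 2 5))).sub (IsHomogeneous.ofNat_mul 5 (h 3 4)))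
  · exact ((((IsHomogeneous.ofNat_mul 2 (h 1 7)).sub (IsHomogeneous.ofNat_mul 12 (h 2 6))).add (IsHomogeneous.ofNat_mul 30 (h 3 5))).sub (IsHomogeneous.ofNat_mul 20 (h 4 4)))
  · exact isHomogeneous_zero _ _ _

theorem derivation_psiT_raise {A : Type} [CommRing A] [Algebra ℂ A] (D : Derivation ℂ A A) {g :
    Fin 8 → A}
    (h0 : D (g 0) = 0) (h1 : D (g 1) = g 0) (h2 : D (g 2) = 2 * g 1) (h3 : D (g 3) = 3 *
        g 2) (h4 : D (g 4) = 4 * g 3) (h5 : D (g 5) = 5 * g 4) (h6 : D (g 6) = 6 *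
        g 5) (h7 : D (g 7) = 7 * g 6)
    (i : ℕ) (hi : i ≤ 2) : 
    D (psiT g i) = (i : A) * psiT g (i - 1) := by
  interval_cases i <;> simp only [psiT, map_add, map_sub, derivation_ofNat D 2,
      derivation_ofNat D 5, derivation_ofNat D 9, derivation_ofNat D 12, derivation_ofNat D 20,
      derivation_ofNat D 30, derivation_mul,
    h0, h1, h2, h3, h4, h5, h6, h7] <;> norm_num <;> ring

theorem derivation_psiT_lower {A : Type} [CommRing A] [Algebra ℂ A] (D : Derivation ℂ A A) {g :
    Fin 8 → A}
    (h0 : D (g 0) = 7 * g 1) (h1 : D (g 1) = 6 * g 2) (h2 : D (g 2) = 5 * g 3) (h3 : D (g 3) = 4 *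
        g 4) (h4 : D (g 4) = 3 * g 5) (h5 : D (g 5) = 2 * g 6) (h6 : D (g 6) =
        g 7) (h7 : D (g 7) = 0)
    (i : ℕ) (hi : i ≤ 2) : 
    D (psiT g i) = ((2 - i : ℕ) : A) * psiT g (i + 1) := by
  interval_cases i <;> simp only [psiT, map_add, map_sub, derivation_ofNat D 2,
      derivation_ofNat D 5, derivation_ofNat D 9, derivation_ofNat D 12, derivation_ofNat D 20,
      derivation_ofNat D 30, derivation_mul,
    h0, h1, h2, h3, h4, h5, h6, h7] <;> norm_num <;> ring

theorem kT_isHomogeneous {g : Fin 8 → MvPolynomial (Fin 8) ℂ} (hg : ∀ i, (g i).IsHomogeneous 1)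
    (i : ℕ) : (kT g i).IsHomogeneous 2 := by
  have h : ∀ i j, (g i * g j).IsHomogeneous 2 := fun i j => (hg i).mul (hg j)
  rcases i with _ | _ | _ | _ | _ | _ | _ | i
  · exact (((IsHomogeneous.ofNat_mul 20 (h 0 4)).sub (IsHomogeneous.ofNat_mul 80 (h 1 3))).add (IsHomogeneous.ofNat_mul 60 (h 2 2)))
  · exact (((IsHomogeneous.ofNat_mul 10 (h 0 5)).sub (IsHomogeneous.ofNat_mul 30 (h 1 4))).add (IsHomogeneous.ofNat_mul 20 (h 2 3)))
  · exact ((((IsHomogeneous.ofNat_mul 4 (h 0 6)).sub (IsHomogeneous.ofNat_mul 4 (h 1 5))).sub (IsHomogeneous.ofNat_mul 20 (h 2 4))).add (IsHomogeneous.ofNat_mul 20 (h 3 3)))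
  · exact ((((h 0 7).add (IsHomogeneous.ofNat_mul 5 (h 1 6))).sub (IsHomogeneous.ofNat_mul 21 (h 2 5))).add (IsHomogeneous.ofNat_mul 15 (h 3 4)))
  · exact ((((IsHomogeneous.ofNat_mul 4 (h 1 7)).sub (IsHomogeneous.ofNat_mul 4 (h 2 6))).sub (IsHomogeneous.ofNat_mul 20 (h 3 5))).add (IsHomogeneous.ofNat_mul 20 (h 4 4)))
  · exact (((IsHomogeneous.ofNat_mul 10 (h 2 7)).sub (IsHomogeneous.ofNat_mul 30 (h 3 6))).add (IsHomogeneous.ofNat_mul 20 (h 4 5)))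
  · exact (((IsHomogeneous.ofNat_mul 20 (h 3 7)).sub (IsHomogeneous.ofNat_mul 80 (h 4 6))).add (IsHomogeneous.ofNat_mul 60 (h 5 5)))
  · exact isHomogeneous_zero _ _ _

theorem derivation_kT_raise {A : Type} [CommRing A] [Algebra ℂ A] (D : Derivation ℂ A A) {g :
    Fin 8 → A}
    (h0 : D (g 0) = 0) (h1 : D (g 1) = g 0) (h2 : D (g 2) = 2 * g 1) (h3 : D (g 3) = 3 *
        g 2) (h4 : D (g 4) = 4 * g 3) (h5 : D (g 5) = 5 * g 4) (h6 : D (g 6) = 6 *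
        g 5) (h7 : D (g 7) = 7 * g 6)
    (i : ℕ) (hi : i ≤ 6) : 
    D (kT g i) = (i : A) * kT g (i - 1) := by
  interval_cases i <;> simp only [kT, map_add, map_sub, derivation_ofNat D 4, derivation_ofNat D 5,
      derivation_ofNat D 10, derivation_ofNat D 15, derivation_ofNat D 20, derivation_ofNat D 21,
      derivation_ofNat D 30, derivation_ofNat D 60, derivation_ofNat D 80, derivation_mul,
    h0, h1, h2, h3, h4, h5, h6, h7] <;> norm_num <;> ring

theorem derivation_kT_lower {A : Type} [CommRing A] [Algebra ℂ A] (D : Derivation ℂ A A) {g :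
    Fin 8 → A}
    (h0 : D (g 0) = 7 * g 1) (h1 : D (g 1) = 6 * g 2) (h2 : D (g 2) = 5 * g 3) (h3 : D (g 3) = 4 *
        g 4) (h4 : D (g 4) = 3 * g 5) (h5 : D (g 5) = 2 * g 6) (h6 : D (g 6) =
        g 7) (h7 : D (g 7) = 0)
    (i : ℕ) (hi : i ≤ 6) : 
    D (kT g i) = ((6 - i : ℕ) : A) * kT g (i + 1) := by
  interval_cases i <;> simp only [kT, map_add, map_sub, derivation_ofNat D 4, derivation_ofNat D 5,
      derivation_ofNat D 10, derivation_ofNat D 15, derivation_ofNat D 20, derivation_ofNat D 21,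
      derivation_ofNat D 30, derivation_ofNat D 60, derivation_ofNat D 80, derivation_mul,
    h0, h1, h2, h3, h4, h5, h6, h7] <;> norm_num <;> ring

theorem hT_isHomogeneous {g : Fin 8 → MvPolynomial (Fin 8) ℂ} (hg : ∀ i, (g i).IsHomogeneous 1)
    (i : ℕ) : (hT g i).IsHomogeneous 2 := by
  have h : ∀ i j, (g i * g j).IsHomogeneous 2 := fun i j => (hg i).mul (hg j)
  rcases i with _ | _ | _ | _ | _ | _ | _ | _ | _ | _ | _ | i
  · exact ((IsHomogeneous.ofNat_mul 252 (h 0 2)).sub (IsHomogeneous.ofNat_mul 252 (h 1 1)))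
  · exact ((IsHomogeneous.ofNat_mul 126 (h 0 3)).sub (IsHomogeneous.ofNat_mul 126 (h 1 2)))
  · exact (((IsHomogeneous.ofNat_mul 56 (h 0 4)).add (IsHomogeneous.ofNat_mul 28 (h 1 3))).sub (IsHomogeneous.ofNat_mul 84 (h 2 2)))
  · exact (((IsHomogeneous.ofNat_mul 21 (h 0 5)).add (IsHomogeneous.ofNat_mul 63 (h 1 4))).sub (IsHomogeneous.ofNat_mul 84 (h 2 3)))
  · exact ((((IsHomogeneous.ofNat_mul 6 (h 0 6)).add (IsHomogeneous.ofNat_mul 48 (h 1 5))).add (IsHomogeneous.ofNat_mul 6 (h 2 4))).sub (IsHomogeneous.ofNat_mul 60 (h 3 3)))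
  · exact ((((h 0 7).add (IsHomogeneous.ofNat_mul 23 (h 1 6))).add (IsHomogeneous.ofNat_mul 51 (h 2 5))).sub (IsHomogeneous.ofNat_mul 75 (h 3 4)))
  · exact ((((IsHomogeneous.ofNat_mul 6 (h 1 7)).add (IsHomogeneous.ofNat_mul 48 (h 2 6))).add (IsHomogeneous.ofNat_mul 6 (h 3 5))).sub (IsHomogeneous.ofNat_mul 60 (h 4 4)))
  · exact (((IsHomogeneous.ofNat_mul 21 (h 2 7)).add (IsHomogeneous.ofNat_mul 63 (h 3 6))).sub (IsHomogeneous.ofNat_mul 84 (h 4 5)))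
  · exact (((IsHomogeneous.ofNat_mul 56 (h 3 7)).add (IsHomogeneous.ofNat_mul 28 (h 4 6))).sub (IsHomogeneous.ofNat_mul 84 (h 5 5)))
  · exact ((IsHomogeneous.ofNat_mul 126 (h 4 7)).sub (IsHomogeneous.ofNat_mul 126 (h 5 6)))
  · exact ((IsHomogeneous.ofNat_mul 252 (h 5 7)).sub (IsHomogeneous.ofNat_mul 252 (h 6 6)))
  · exact isHomogeneous_zero _ _ _

theorem derivation_hT_raise {A : Type} [CommRing A] [Algebra ℂ A] (D : Derivation ℂ A A) {g :
    Fin 8 → A}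
    (h0 : D (g 0) = 0) (h1 : D (g 1) = g 0) (h2 : D (g 2) = 2 * g 1) (h3 : D (g 3) = 3 *
        g 2) (h4 : D (g 4) = 4 * g 3) (h5 : D (g 5) = 5 * g 4) (h6 : D (g 6) = 6 *
        g 5) (h7 : D (g 7) = 7 * g 6)
    (i : ℕ) (hi : i ≤ 10) : 
    D (hT g i) = (i : A) * hT g (i - 1) := by
  interval_cases i <;> simp only [hT, map_add, map_sub, derivation_ofNat D 6,
      derivation_ofNat D 21, derivation_ofNat D 23, derivation_ofNat D 28, derivation_ofNat D 48,
      derivation_ofNat D 51, derivation_ofNat D 56, derivation_ofNat D 60, derivation_ofNat D 63,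
      derivation_ofNat D 75, derivation_ofNat D 84, derivation_ofNat D 126, derivation_ofNat D 252,
      derivation_mul,
    h0, h1, h2, h3, h4, h5, h6, h7] <;> norm_num <;> ring

theorem derivation_hT_lower {A : Type} [CommRing A] [Algebra ℂ A] (D : Derivation ℂ A A) {g :
    Fin 8 → A}
    (h0 : D (g 0) = 7 * g 1) (h1 : D (g 1) = 6 * g 2) (h2 : D (g 2) = 5 * g 3) (h3 : D (g 3) = 4 *
        g 4) (h4 : D (g 4) = 3 * g 5) (h5 : D (g 5) = 2 * g 6) (h6 : D (g 6) =
        g 7) (h7 : D (g 7) = 0)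
    (i : ℕ) (hi : i ≤ 10) : 
    D (hT g i) = ((10 - i : ℕ) : A) * hT g (i + 1) := by
  interval_cases i <;> simp only [hT, map_add, map_sub, derivation_ofNat D 6,
      derivation_ofNat D 21, derivation_ofNat D 23, derivation_ofNat D 28, derivation_ofNat D 48,
      derivation_ofNat D 51, derivation_ofNat D 56, derivation_ofNat D 60, derivation_ofNat D 63,
      derivation_ofNat D 75, derivation_ofNat D 84, derivation_ofNat D 126, derivation_ofNat D 252,
      derivation_mul,
    h0, h1, h2, h3, h4, h5, h6, h7] <;> norm_num <;> ring

theorem sextic4_isHomogeneous {g : ℕ → MvPolynomial (Fin 8) ℂ} (hg : ∀ i, (g i).IsHomogeneous 2)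
    (i : ℕ) : (sextic4 g i).IsHomogeneous 4 := by
  have h : ∀ i j, (g i * g j).IsHomogeneous 4 := fun i j => (hg i).mul (hg j)
  rcases i with _ | _ | _ | _ | _ | i
  · exact (((IsHomogeneous.ofNat_mul 6 (h 0 4)).sub (IsHomogeneous.ofNat_mul 24 (h 1 3))).add (IsHomogeneous.ofNat_mul 18 (h 2 2)))
  · exact (((IsHomogeneous.ofNat_mul 3 (h 0 5)).sub (IsHomogeneous.ofNat_mul 9 (h 1 4))).add (IsHomogeneous.ofNat_mul 6 (h 2 3)))
  · exact (((h 0 6).sub (IsHomogeneous.ofNat_mul 9 (h 2 4))).add (IsHomogeneous.ofNat_mul 8 (h 3 3)))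
  · exact (((IsHomogeneous.ofNat_mul 3 (h 1 6)).sub (IsHomogeneous.ofNat_mul 9 (h 2 5))).add (IsHomogeneous.ofNat_mul 6 (h 3 4)))
  · exact (((IsHomogeneous.ofNat_mul 6 (h 2 6)).sub (IsHomogeneous.ofNat_mul 24 (h 3 5))).add (IsHomogeneous.ofNat_mul 18 (h 4 4)))
  · exact isHomogeneous_zero _ _ _

theorem derivation_sextic4_raise {A : Type} [CommRing A] [Algebra ℂ A] (D :
    Derivation ℂ A A) {g : ℕ → A}
    (h : ∀ i, i ≤ 6 → D (g i) = (i : A) * g (i - 1))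
    (i : ℕ) (hi : i ≤ 4) : 
    D (sextic4 g i) = (i : A) * sextic4 g (i - 1) := by
  have h0 : D (g 0) = 0 := by simpa using h 0 (by omega)
  have h1 : D (g 1) = 1 * g 0 := by simpa using h 1 (by omega)
  have h2 : D (g 2) = 2 * g 1 := by simpa using h 2 (by omega)
  have h3 : D (g 3) = 3 * g 2 := by simpa using h 3 (by omega)
  have h4 : D (g 4) = 4 * g 3 := by simpa using h 4 (by omega)
  have h5 : D (g 5) = 5 * g 4 := by simpa using h 5 (by omega)
  have h6 : D (g 6) = 6 * g 5 := by simpa using h 6 (by omega)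
  interval_cases i <;> simp only [sextic4, map_add, map_sub, derivation_ofNat D 3,
      derivation_ofNat D 6, derivation_ofNat D 8, derivation_ofNat D 9, derivation_ofNat D 18,
      derivation_ofNat D 24, derivation_mul,
    h0, h1, h2, h3, h4, h5, h6] <;> norm_num <;> ring

theorem derivation_sextic4_lower {A : Type} [CommRing A] [Algebra ℂ A] (D :
    Derivation ℂ A A) {g : ℕ → A}
    (h : ∀ i, i ≤ 6 → D (g i) = ((6 - i : ℕ) : A) * g (i + 1))
    (i : ℕ) (hi : i ≤ 4) : 
    D (sextic4 g i) = ((4 - i : ℕ) : A) * sextic4 g (i + 1) := by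
  have h0 : D (g 0) = 6 * g 1 := by simpa using h 0 (by omega)
  have h1 : D (g 1) = 5 * g 2 := by simpa using h 1 (by omega)
  have h2 : D (g 2) = 4 * g 3 := by simpa using h 2 (by omega)
  have h3 : D (g 3) = 3 * g 4 := by simpa using h 3 (by omega)
  have h4 : D (g 4) = 2 * g 5 := by simpa using h 4 (by omega)
  have h5 : D (g 5) = 1 * g 6 := by simpa using h 5 (by omega)
  have h6 : D (g 6) = 0 := by simpa using h 6 (by omega)
  interval_cases i <;> simp only [sextic4, map_add, map_sub, derivation_ofNat D 3,
      derivation_ofNat D 6, derivation_ofNat D 8, derivation_ofNat D 9, derivation_ofNat D 18,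
      derivation_ofNat D 24, derivation_mul,
    h0, h1, h2, h3, h4, h5, h6] <;> norm_num <;> ring

def psiCov : Cov 2 0 2 where
  val v i _ := psiT v i
  map_val φ v i _ := by
    rcases i with _ | _ | _ | i <;> simp [psiT, map_ofNat]
  hom i _ := psiT_isHomogeneous gv_homogeneous i
  derE_val i j hi hj := by
    obtain ⟨e0, e1, e2, e3, e4, e5, e6, e7⟩ := derE_gv
    obtain rfl := Nat.le_zero.1 hj
    rw [derivation_psiT_raise derE e0 e1 e2 e3 e4 e5 e6 e7 i hi, Nat.cast_zero, zero_mul, add_zero]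
  derF_val i j hi hj := by
    obtain ⟨e0, e1, e2, e3, e4, e5, e6, e7⟩ := derF_gv
    obtain rfl := Nat.le_zero.1 hj
    rw [derivation_psiT_lower derF e0 e1 e2 e3 e4 e5 e6 e7 i hi, Nat.sub_zero, Nat.cast_zero,
      zero_mul, add_zero]

def kCov : Cov 6 0 2 where
  val v i _ := kT v i
  map_val φ v i _ := by
    rcases i with _ | _ | _ | _ | _ | _ | _ | i <;> simp [kT, map_ofNat]
  hom i _ := kT_isHomogeneous gv_homogeneous i
  derE_val i j hi hj := by
    obtain ⟨e0, e1, e2, e3, e4, e5, e6, e7⟩ := derE_gv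
    obtain rfl := Nat.le_zero.1 hj
    rw [derivation_kT_raise derE e0 e1 e2 e3 e4 e5 e6 e7 i hi, Nat.cast_zero, zero_mul, add_zero]
  derF_val i j hi hj := by
    obtain ⟨e0, e1, e2, e3, e4, e5, e6, e7⟩ := derF_gv
    obtain rfl := Nat.le_zero.1 hj
    rw [derivation_kT_lower derF e0 e1 e2 e3 e4 e5 e6 e7 i hi, Nat.sub_zero, Nat.cast_zero,
      zero_mul, add_zero]

def hCov : Cov 10 0 2 where
  val v i _ := hT v i
  map_val φ v i _ := by
    rcases i with _ | _ | _ | _ | _ | _ | _ | _ | _ | _ | _ | i <;> simp [hT, map_ofNat]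
  hom i _ := hT_isHomogeneous gv_homogeneous i
  derE_val i j hi hj := by
    obtain ⟨e0, e1, e2, e3, e4, e5, e6, e7⟩ := derE_gv
    obtain rfl := Nat.le_zero.1 hj
    rw [derivation_hT_raise derE e0 e1 e2 e3 e4 e5 e6 e7 i hi, Nat.cast_zero, zero_mul, add_zero]
  derF_val i j hi hj := by
    obtain ⟨e0, e1, e2, e3, e4, e5, e6, e7⟩ := derF_gv
    obtain rfl := Nat.le_zero.1 hj
    rw [derivation_hT_lower derF e0 e1 e2 e3 e4 e5 e6 e7 i hi, Nat.sub_zero, Nat.cast_zero,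
      zero_mul, add_zero]

def iCov : Cov 4 0 4 where
  val v i _ := sextic4 (kT v) i
  map_val φ v i _ := by
    have h : ∀ i, φ (kT v i) = kT (fun i => φ (v i)) i := fun i => kCov.map_val φ v i 0
    rcases i with _ | _ | _ | _ | _ | i <;> simp [sextic4, map_ofNat, h]
  hom i _ := sextic4_isHomogeneous (fun i => kCov.hom i 0) i
  derE_val i j hi hj := by
    obtain rfl := Nat.le_zero.1 hj
    rw [Nat.cast_zero, zero_mul, add_zero]
    exact derivation_sextic4_raise derE (fun i hi => by
        simpa [kCov] using kCov.derE_val i 0 hi le_rfl) i hi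
  derF_val i j hi hj := by
    obtain rfl := Nat.le_zero.1 hj
    rw [Nat.sub_zero, Nat.cast_zero, zero_mul, add_zero]
    exact derivation_sextic4_lower derF (fun i hi => by
        simpa [kCov] using kCov.derF_val i 0 hi le_rfl) i hi

section BasicInvariants

namespace Cov

/-- The catalecticant of a quartic covariant. -/
def cat {d : ℕ} (q : Cov 4 0 d) : Cov 0 0 (d + d + d) where
  val v _ _ := q.val v 0 0 * q.val v 2 0 * q.val v 4 0 + q.val v 1 0 * q.val v 2 0 * q.val v 3 0 +
    q.val v 1 0 * q.val v 2 0 * q.val v 3 0 - q.val v 2 0 * q.val v 2 0 * q.val v 2 0 -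
    q.val v 0 0 * q.val v 3 0 * q.val v 3 0 - q.val v 1 0 * q.val v 1 0 * q.val v 4 0
  map_val φ v i j := by simp only [map_sub, map_add, map_mul, q.map_val]
  hom i j := by
    have h : ∀ a b c, (q.val gv a 0 * q.val gv b 0 * q.val gv c 0).IsHomogeneous (d + d + d) :=
      fun a b c => ((q.hom a 0).mul (q.hom b 0)).mul (q.hom c 0)
    exact (((((h 0 2 4).add (h 1 2 3)).add (h 1 2 3)).sub (h 2 2 2)).sub (h 0 3 3)).sub (h 1 1 4)
  derE_val i j hi hj := by
    have h : ∀ i, i ≤ 4 → derE (q.val gv i 0) = i * q.val gv (i - 1) 0 := fun i hi => by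
      simpa using q.derE_val i 0 hi le_rfl
    have h0 : derE (q.val gv 0 0) = 0 := by simpa using h 0 (by omega)
    obtain rfl := Nat.le_zero.1 hi
    obtain rfl := Nat.le_zero.1 hj
    simp only [map_sub, map_add, derivation_mul, h0, h 1 (by omega), h 2 (by omega), h 3 (by omega),
      h 4 (by omega)]
    push_cast
    ring
  derF_val i j hi hj := by
    have h : ∀ i, i ≤ 4 → derF (q.val gv i 0) = (4 - i : ℕ) * q.val gv (i + 1) 0 := fun i hi => by
      simpa using q.derF_val i 0 hi le_rfl
    have h4 : derF (q.val gv 4 0) = 0 := by simpa using h 4 (by omega)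
    obtain rfl := Nat.le_zero.1 hi
    obtain rfl := Nat.le_zero.1 hj
    simp only [map_sub, map_add, derivation_mul, h4, h 1 (by omega), h 2 (by omega), h 3 (by omega),
      h 0 (by omega)]
    push_cast
    ring

end Cov

open Cov

def lCov : Cov 2 0 6 := om (om (om (om (kCov.mul iCov))))
def mCov : Cov 2 0 10 := c1 lCov iCov
def nCov : Cov 2 0 14 := c1 mCov iCov

def inv4 : Cov 0 0 4 := c1 psiCov psiCov
def inv8 : Cov 0 0 8 := c1 psiCov (c1 psiCov (c1 psiCov kCov))
def inv8i : Cov 0 0 8 := c1 psiCov (c1 psiCov iCov)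
def inv12 : Cov 0 0 12 := c1 psiCov (c1 psiCov (c1 psiCov (c1 psiCov (c1 psiCov hCov))))
def inv12kk : Cov 0 0 12 :=
  c1 psiCov (c1 psiCov (c2 psiCov (c2 psiCov (om (om (kCov.mul kCov))))))
def inv12ki : Cov 0 0 12 := c1 psiCov (c1 psiCov (c2 psiCov (om (om (kCov.mul iCov)))))
def inv12ii : Cov 0 0 12 := c1 psiCov (c2 psiCov (om (om (iCov.mul iCov))))
def inv12c : Cov 0 0 12 := cat iCov
def inv14hk : Cov 0 0 14 :=
  c1 psiCov (c1 psiCov (c1 psiCov (c2 psiCov (c12 psiCov (om (om (om (hCov.mul kCov))))))))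
def inv14ki : Cov 0 0 14 :=
  c1 psiCov (c1 psiCov (c2 psiCov (c12 psiCov (om (kCov.mul iCov)))))
def inv18hk : Cov 0 0 18 :=
  c1 psiCov (c1 psiCov (c1 psiCov (c1 psiCov (c2 psiCov (c2 psiCov (c12 psiCov
    (om (hCov.mul kCov))))))))
def inv18hi : Cov 0 0 18 :=
  c1 psiCov (c1 psiCov (c1 psiCov (c1 psiCov (c2 psiCov (c12 psiCov (om (hCov.mul iCov)))))))
def inv20 : Cov 0 0 20 := c1 lCov nCov
def inv30 : Cov 0 0 30 := c12 nCov (om (lCov.mul mCov))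

section Values
variable {B : Type} [CommRing B] [Algebra ℂ B]

/-- The covariant `(f, f)₄` transvected with itself four times. -/
def iT (v : Fin 8 → B) : ℕ → B := sextic4 (kT v)

def lT (v : Fin 8 → B) (r : ℕ) : B := kT v r * iT v 4 - 4 * kT v (r + 1) * iT v 3 +
  6 * kT v (r + 2) * iT v 2 - 4 * kT v (r + 3) * iT v 1 + kT v (r + 4) * iT v 0

def mT (v : Fin 8 → B) (r : ℕ) : B :=
  iT v r * lT v 2 - 2 * (iT v (r + 1) * lT v 1) + iT v (r + 2) * lT v 0

def nT (v : Fin 8 → B) (r : ℕ) : B :=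
  iT v r * mT v 2 - 2 * (iT v (r + 1) * mT v 1) + iT v (r + 2) * mT v 0

theorem lCov_val (v : Fin 8 → B) (r : ℕ) : lCov.val v r 0 = lT v r := by
  simp only [lCov, om, mul, kCov, iCov, lT, iT]
  ring

theorem mCov_val (v : Fin 8 → B) (r : ℕ) : mCov.val v r 0 = mT v r := by
  simp only [mCov, c1, lCov_val]
  rfl

theorem nCov_val (v : Fin 8 → B) (r : ℕ) : nCov.val v r 0 = nT v r := by
  simp only [nCov, c1, mCov_val]
  rfl

theorem ev_inv4 (v : Fin 8 → B) : ev v inv4.toInv =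
    2 * (psiT v 0 * psiT v 2 - psiT v 1 ^ 2) := by
  rw [ev_toInv]
  simp only [inv4, c1, psiCov]
  ring

theorem ev_inv12c (v : Fin 8 → B) : ev v inv12c.toInv = iT v 0 * iT v 2 * iT v 4 +
    2 * (iT v 1 * iT v 2 * iT v 3) - iT v 2 ^ 3 - iT v 0 * iT v 3 ^ 2 - iT v 1 ^ 2 * iT v 4 := by
  rw [ev_toInv]
  simp only [inv12c, cat, iCov, iT]
  ring

theorem ev_inv20 (v : Fin 8 → B) : ev v inv20.toInv =
    nT v 0 * lT v 2 - 2 * (nT v 1 * lT v 1) + nT v 2 * lT v 0 := by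
  rw [ev_toInv]
  simp only [inv20, c1, lCov_val, nCov_val]

theorem ev_inv30 (v : Fin 8 → B) : ev v inv30.toInv = (lT v 1 * mT v 0 - lT v 0 * mT v 1) * nT v 2 -
    (lT v 2 * mT v 0 - lT v 0 * mT v 2) * nT v 1 + (lT v 2 * mT v 1 - lT v 1 * mT v 2) *
        nT v 0 := by
  rw [ev_toInv]
  simp only [inv30, c12, om, mul, lCov_val, mCov_val, nCov_val]
  ring

theorem ev_inv8 {v : Fin 8 → B} (h1 : psiT v 1 = 0) (h2 : psiT v 2 = 0) :
    ev v inv8.toInv = psiT v 0 ^ 3 * kT v 6 := by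
  rw [ev_toInv]
  simp only [inv8, c1, c2, c12, swap, om, mul, psiCov, kCov, hCov, iCov, iT, h1, h2]
  ring

theorem ev_inv8i {v : Fin 8 → B} (h1 : psiT v 1 = 0) (h2 : psiT v 2 = 0) :
    ev v inv8i.toInv = psiT v 0 ^ 2 * iT v 4 := by
  rw [ev_toInv]
  simp only [inv8i, c1, c2, c12, swap, om, mul, psiCov, kCov, hCov, iCov, iT, h1, h2]
  ring

theorem ev_inv12 {v : Fin 8 → B} (h1 : psiT v 1 = 0) (h2 : psiT v 2 = 0) :
    ev v inv12.toInv = psiT v 0 ^ 5 * hT v 10 := by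
  rw [ev_toInv]
  simp only [inv12, c1, c2, c12, swap, om, mul, psiCov, kCov, hCov, iCov, iT, h1, h2]
  ring

theorem ev_inv12kk {v : Fin 8 → B} (h1 : psiT v 1 = 0) (h2 : psiT v 2 = 0) :
    ev v inv12kk.toInv = psiT v 0 ^ 4 * (2 * (kT v 6 * kT v 4 - kT v 5 ^ 2)) := by
  rw [ev_toInv]
  simp only [inv12kk, c1, c2, c12, swap, om, mul, psiCov, kCov, hCov, iCov, iT, h1, h2]
  ring

theorem ev_inv12ki {v : Fin 8 → B} (h1 : psiT v 1 = 0) (h2 : psiT v 2 = 0) :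
    ev v inv12ki.toInv = psiT v 0 ^ 3 * (kT v 6 * iT v 2 - 2 * kT v 5 * iT v 3 + kT v 4 *
        iT v 4) := by
  rw [ev_toInv]
  simp only [inv12ki, c1, c2, c12, swap, om, mul, psiCov, kCov, hCov, iCov, iT, h1, h2]
  ring

theorem ev_inv12ii {v : Fin 8 → B} (h1 : psiT v 1 = 0) (h2 : psiT v 2 = 0) :
    ev v inv12ii.toInv = psiT v 0 ^ 2 * (2 * (iT v 4 * iT v 2 - iT v 3 ^ 2)) := by
  rw [ev_toInv]
  simp only [inv12ii, c1, c2, c12, swap, om, mul, psiCov, kCov, hCov, iCov, iT, h1, h2]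
  ring

theorem ev_inv14hk {v : Fin 8 → B} (h1 : psiT v 1 = 0) (h2 : psiT v 2 = 0) :
    ev v inv14hk.toInv = psiT v 0 ^ 5 *
    (hT v 10 * kT v 3 - 3 * hT v 9 * kT v 4 + 3 * hT v 8 * kT v 5 - hT v 7 * kT v 6) := by
  rw [ev_toInv]
  simp only [inv14hk, c1, c2, c12, swap, om, mul, psiCov, kCov, hCov, iCov, iT, h1, h2]
  ring

theorem ev_inv14ki {v : Fin 8 → B} (h1 : psiT v 1 = 0) (h2 : psiT v 2 = 0) :
    ev v inv14ki.toInv = psiT v 0 ^ 4 * (kT v 6 * iT v 3 - kT v 5 * iT v 4) := by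
  rw [ev_toInv]
  simp only [inv14ki, c1, c2, c12, swap, om, mul, psiCov, kCov, hCov, iCov, iT, h1, h2]
  ring

theorem ev_inv18hk {v : Fin 8 → B} (h1 : psiT v 1 = 0) (h2 : psiT v 2 = 0) :
    ev v inv18hk.toInv = psiT v 0 ^ 7 * (hT v 10 * kT v 5 - hT v 9 * kT v 6) := by
  rw [ev_toInv]
  simp only [inv18hk, c1, c2, c12, swap, om, mul, psiCov, kCov, hCov, iCov, iT, h1, h2]
  ring

theorem ev_inv18hi {v : Fin 8 → B} (h1 : psiT v 1 = 0) (h2 : psiT v 2 = 0) :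
    ev v inv18hi.toInv = psiT v 0 ^ 6 * (hT v 10 * iT v 3 - hT v 9 * iT v 4) := by
  rw [ev_toInv]
  simp only [inv18hi, c1, c2, c12, swap, om, mul, psiCov, kCov, hCov, iCov, iT, h1, h2]
  ring

end Values

end BasicInvariants

section ZeroCatalecticant

section PsiTransform
variable {B : Type} [CommRing B]

theorem psiT_shiftL_zero (t : B) (v : Fin 8 → B) :
    psiT (shiftL t v) 0 = psiT v 0 + 2 * t * psiT v 1 + t ^ 2 * psiT v 2 := by
  simp [psiT, shiftL]; ring

theorem psiT_shiftL_one (t : B) (v : Fin 8 → B) :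
    psiT (shiftL t v) 1 = psiT v 1 + t * psiT v 2 := by
  simp [psiT, shiftL]; ring

theorem psiT_shiftL_two (t : B) (v : Fin 8 → B) : psiT (shiftL t v) 2 = psiT v 2 := by
  simp [psiT, shiftL]; ring

theorem psiT_shiftU_zero (t : B) (v : Fin 8 → B) : psiT (shiftU t v) 0 = psiT v 0 := by
  simp [psiT, shiftU]; ring

theorem psiT_shiftU_one (t : B) (v : Fin 8 → B) :
    psiT (shiftU t v) 1 = psiT v 1 + t * psiT v 0 := by
  simp [psiT, shiftU]; ring

theorem psiT_shiftU_two (t : B) (v : Fin 8 → B) :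
    psiT (shiftU t v) 2 = psiT v 2 + 2 * t * psiT v 1 + t ^ 2 * psiT v 0 := by
  simp [psiT, shiftU]; ring

theorem psiT_swapXY_zero (v : Fin 8 → B) : psiT (swapXY v) 0 = psiT v 2 := by
  simp [psiT, swapXY]; ring

theorem psiT_swapXY_one (v : Fin 8 → B) : psiT (swapXY v) 1 = -psiT v 1 := by
  simp [psiT, swapXY]; ring

theorem psiT_swapXY_two (v : Fin 8 → B) : psiT (swapXY v) 2 = psiT v 0 := by
  simp [psiT, swapXY]; ring

end PsiTransform

section Torus
variable {K : Type} [Field K]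

/-- The action of the diagonal torus on coefficients. -/
def torusT (c : K) (v : Fin 8 → K) : Fin 8 → K := fun i => c ^ (7 - 2 * ((i : ℕ) : ℤ)) * v i

theorem torusT_apply {c : K} (v : Fin 8 → K) : torusT c v 0 = c ^ 7 * v 0 ∧
    torusT c v 1 = c ^ 5 * v 1 ∧ torusT c v 2 = c ^ 3 * v 2 ∧ torusT c v 3 = c * v 3 ∧
    torusT c v 4 = c⁻¹ * v 4 ∧ torusT c v 5 = (c ^ 3)⁻¹ * v 5 ∧ torusT c v 6 = (c ^ 5)⁻¹ * v 6 ∧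
    torusT c v 7 = (c ^ 7)⁻¹ * v 7 := by
  have h : ∀ n : ℕ, (c ^ n)⁻¹ = c ^ (-(n : ℤ)) := fun n => by simp
  have h' : ∀ n : ℕ, c ^ n = c ^ (n : ℤ) := fun n => by simp
  refine ⟨?_, ?_, ?_, ?_, ?_, ?_, ?_, ?_⟩ <;> simp only [torusT, h]
  · rw [h']; congr 2
  · rw [h']; congr 2
  · rw [h']; congr 2
  · nth_rewrite 2 [← pow_one c]; rw [h']; congr 2
  · rw [← zpow_neg_one]; congr 2
  · congr 2
  · congr 2
  · congr 2

theorem torusT_eq_zero {c : K} {v : Fin 8 → K} {i : Fin 8} (h : v i = 0) : torusT c v i = 0 := by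
  rw [torusT, h, mul_zero]

theorem psiT_torusT_zero {c : K} (hc : c ≠ 0) (v : Fin 8 → K) :
    psiT (torusT c v) 0 = c ^ 2 * psiT v 0 := by
  obtain ⟨h0, h1, h2, h3, h4, h5, h6, h7⟩ := torusT_apply (c := c) v
  simp only [psiT, h0, h1, h2, h3, h4, h5, h6]
  field_simp

theorem psiT_torusT_one {c : K} (hc : c ≠ 0) (v : Fin 8 → K) :
    psiT (torusT c v) 1 = psiT v 1 := by
  obtain ⟨h0, h1, h2, h3, h4, h5, h6, h7⟩ := torusT_apply (c := c) v
  simp only [psiT, h0, h1, h2, h3, h4, h5, h6, h7]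
  field_simp

theorem psiT_torusT_two {c : K} (hc : c ≠ 0) (v : Fin 8 → K) :
    psiT (torusT c v) 2 = (c ^ 2)⁻¹ * psiT v 2 := by
  obtain ⟨h0, h1, h2, h3, h4, h5, h6, h7⟩ := torusT_apply (c := c) v
  simp only [psiT, h1, h2, h3, h4, h5, h6, h7]
  field_simp

end Torus

variable {K : Type} [Field K] [Algebra ℂ K]

/-- The prime `P` is the vanishing ideal of the septimic `v`. -/
def IsPt (P : Ideal (invariantRing 7)) (v : Fin 8 → K) : Prop := ∀ p, p ∈ P ↔ ev v p = 0

theorem charZero_of_algebra_complex (K : Type) [Field K] [Algebra ℂ K] : CharZero K :=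
  charZero_of_injective_algebraMap (algebraMap ℂ K).injective

namespace IsPt
variable {P : Ideal (invariantRing 7)} {v : Fin 8 → K}

theorem shiftL (h : IsPt P v) (t : K) : IsPt P (shiftL t v) := fun p => by rw [ev_shiftL, h p]

theorem shiftU (h : IsPt P v) (t : K) : IsPt P (shiftU t v) := fun p => by rw [ev_shiftU, h p]

theorem swapXY (h : IsPt P v) : IsPt P (swapXY v) := fun p => by rw [ev_swapXY, h p]

theorem torusT (h : IsPt P v) {c : K} (hc : c ≠ 0) : IsPt P (torusT c v) := fun p => by
  rw [show ev (_root_.torusT c v) p = ev v p from ev_torus hc v p, h p]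

omit [Algebra ℂ K] in
theorem exists_torusT [IsAlgClosed K] (v : Fin 8 → K) {i : Fin 8} (hi : v i ≠ 0) :
    ∃ c : K, c ≠ 0 ∧ _root_.torusT c v i = 1 := by
  have key : ∀ n : ℕ, 0 < n → ∀ a : K, a ≠ 0 → ∃ c : K, c ≠ 0 ∧ c ^ n = a := by
    intro n hn a ha
    obtain ⟨c, hc⟩ := IsAlgClosed.exists_pow_nat_eq a hn
    exact ⟨c, fun h0 => ha (by rw [← hc, h0, zero_pow hn.ne']), hc⟩
  rcases lt_or_ge (i : ℕ) 4 with h4 | h4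
  · obtain ⟨c, hc, e⟩ := key (7 - 2 * (i : ℕ)) (by omega) _ (inv_ne_zero hi)
    refine ⟨c, hc, ?_⟩
    rw [_root_.torusT, show (7 - 2 * ((i : ℕ) : ℤ)) = ((7 - 2 * (i : ℕ) : ℕ) : ℤ) by omega,
      zpow_natCast, e, inv_mul_cancel₀ hi]
  · obtain ⟨c, hc, e⟩ := key (2 * (i : ℕ) - 7) (by omega) _ hi
    refine ⟨c, hc, ?_⟩
    rw [_root_.torusT, show (7 - 2 * ((i : ℕ) : ℤ)) = -((2 * (i : ℕ) - 7 : ℕ) : ℤ) by omega,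
      zpow_neg, zpow_natCast, e, inv_mul_cancel₀ hi]

theorem irr_le_of_upper (h : IsPt P v) (hv : ∀ i : Fin 8, 4 ≤ (i : ℕ) → v i = 0) : irr ≤ P := by
  refine irr_le fun d hd x hx => (h x).2 ?_
  rw [ev_apply, aeval_eq_eval₂Hom, coe_eval₂Hom, eval₂_eq']
  refine Finset.sum_eq_zero fun m hm => ?_
  rw [mem_support_iff] at hm
  have hw := weight_eq_zero x.2 hm
  by_cases hz : ∃ i : Fin 8, 4 ≤ (i : ℕ) ∧ m i ≠ 0
  · obtain ⟨i, hi, hmi⟩ := hz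
    rw [Finset.prod_eq_zero (Finset.mem_univ i), mul_zero]
    rw [nrm, hv i hi, mul_zero, zero_pow hmi]
  · push Not at hz
    exfalso
    have hdeg := (mem_homInv.1 hx) hm
    rw [Finsupp.weight_apply, Finsupp.sum_fintype _ _ (by simp)] at hdeg
    have z4 := hz 4 (by decide)
    have z5 := hz 5 (by decide)
    have z6 := hz 6 (by decide)
    have z7 := hz 7 (by decide)
    rw [Fin.sum_univ_eight] at hw hdeg
    simp [z4, z5, z6, z7] at hw hdeg
    omega

theorem irr_le_of_lower (h : IsPt P v) (hv : ∀ i : Fin 8, (i : ℕ) < 4 → v i = 0) : irr ≤ P := by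
  refine h.swapXY.irr_le_of_upper ?_
  have h0 := hv 0 (by decide)
  have h1 := hv 1 (by decide)
  have h2 := hv 2 (by decide)
  have h3 := hv 3 (by decide)
  intro i hi
  fin_cases i <;> simp at hi <;> simp [_root_.swapXY, h0, h1, h2, h3]

theorem dimLE_zero_of_irr_le (hP : irr ≤ P) : DimLE P 0 := by
  refine DimLE.of_le hP (DimLE.of_ev (K := ℂ) (v := 0) (fun p => ?_) ∅ le_rfl fun i => ?_)
  · exact RingHom.mem_ker
  · exact zero_mem _

/-- A septimic whose covariant `ψ` is a square can be moved so that `ψ = c x²`. -/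
theorem exists_psi (h : IsPt P v) (h4 : inv4.toInv ∈ P) :
    ∃ w : Fin 8 → K, IsPt P w ∧ psiT w 1 = 0 ∧ psiT w 2 = 0 := by
  have := charZero_of_algebra_complex K
  have hd : psiT v 0 * psiT v 2 - psiT v 1 ^ 2 = 0 := by
    have := (h _).1 h4
    rw [ev_inv4] at this
    simpa using this
  by_cases h2 : psiT v 2 = 0
  · refine ⟨v, h, ?_, h2⟩
    rw [h2] at hd
    simpa using hd
  · refine ⟨_, (h.shiftL (-(psiT v 1 / psiT v 2))).swapXY, ?_, ?_⟩
    · rw [psiT_swapXY_one, psiT_shiftL_one]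
      field_simp
      ring
    · rw [psiT_swapXY_two, psiT_shiftL_zero]
      field_simp
      linear_combination hd

theorem exists_normal [IsAlgClosed K] (h : IsPt P v) (h1 : psiT v 1 = 0) (h2 : psiT v 2 = 0)
    (h0 : psiT v 0 ≠ 0) : irr ≤ P ∨ ∃ w : Fin 8 → K, IsPt P w ∧ psiT w 1 = 0 ∧ psiT w 2 = 0 ∧
      psiT w 0 ≠ 0 ∧ ((w 7 = 1 ∧ w 6 = 0) ∨ (w 7 = 0 ∧ w 6 = 1 ∧ w 5 = 0) ∨
        (w 7 = 0 ∧ w 6 = 0 ∧ w 5 = 1 ∧ w 4 = 0)) := by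
  have := charZero_of_algebra_complex K
  have step : ∀ i : Fin 8, v i ≠ 0 → ∃ u : Fin 8 → K, IsPt P u ∧ psiT u 1 = 0 ∧ psiT u 2 = 0 ∧
      psiT u 0 ≠ 0 ∧ u i = 1 ∧ ∀ j, v j = 0 → u j = 0 := by
    intro i hi
    obtain ⟨c, hc, e⟩ := exists_torusT v hi
    refine ⟨_, h.torusT hc, ?_, ?_, ?_, e, fun j => torusT_eq_zero⟩
    · rw [psiT_torusT_one hc, h1]
    · rw [psiT_torusT_two hc, h2, mul_zero]
    · rw [psiT_torusT_zero hc]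
      exact mul_ne_zero (pow_ne_zero _ hc) h0
  have move : ∀ (u : Fin 8 → K) (t : K), IsPt P u → psiT u 1 = 0 → psiT u 2 = 0 → psiT u 0 ≠ 0 →
      IsPt P (_root_.shiftL t u) ∧ psiT (_root_.shiftL t u) 1 = 0 ∧
        psiT (_root_.shiftL t u) 2 = 0 ∧ psiT (_root_.shiftL t u) 0 ≠ 0 := by
    intro u t hu h1 h2 h0
    refine ⟨hu.shiftL t, ?_, ?_, ?_⟩
    · rw [psiT_shiftL_one, h1, h2]; ring
    · rw [psiT_shiftL_two, h2]
    · rw [psiT_shiftL_zero, h1, h2]; simpa using h0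
  by_cases h7 : v 7 = 0
  · by_cases h6 : v 6 = 0
    · by_cases h5 : v 5 = 0
      · left
        refine h.irr_le_of_upper fun i hi => ?_
        have h4 : v 4 = 0 := by
          have := h2
          simpa [psiT, h7, h6, h5] using this
        fin_cases i <;> simp at hi <;> assumption
      · right
        obtain ⟨u, hu, u1, u2, u0, e, hz⟩ := step 5 h5
        obtain ⟨a, b, c, d⟩ := move u (-(u 4 / 3)) hu u1 u2 u0
        refine ⟨_, a, b, c, d, Or.inr (Or.inr ⟨?_, ?_, ?_, ?_⟩)⟩
        · simp [_root_.shiftL, hz 7 h7]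
        · simp [_root_.shiftL, hz 7 h7, hz 6 h6]
        · simp [_root_.shiftL, hz 7 h7, hz 6 h6, e]
        · simp [_root_.shiftL, hz 7 h7, hz 6 h6, e]
          ring
    · right
      obtain ⟨u, hu, u1, u2, u0, e, hz⟩ := step 6 h6
      obtain ⟨a, b, c, d⟩ := move u (-(u 5 / 2)) hu u1 u2 u0
      refine ⟨_, a, b, c, d, Or.inr (Or.inl ⟨?_, ?_, ?_⟩)⟩
      · simp [_root_.shiftL, hz 7 h7]
      · simp [_root_.shiftL, hz 7 h7, e]
      · simp [_root_.shiftL, hz 7 h7, e]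
        ring
  · right
    obtain ⟨u, hu, u1, u2, u0, e, hz⟩ := step 7 h7
    obtain ⟨a, b, c, d⟩ := move u (-u 6) hu u1 u2 u0
    refine ⟨_, a, b, c, d, Or.inl ⟨?_, ?_⟩⟩
    · simp [_root_.shiftL, e]
    · simp [_root_.shiftL, e]

theorem exists_root [IsAlgClosed K] (h : IsPt P v) : ∃ (t : K) (u : Fin 8 → K),
    (u = v ∨ u = _root_.swapXY v) ∧ IsPt P (_root_.shiftL t u) ∧ _root_.shiftL t u 0 = 0 := by
  have := charZero_of_algebra_complex K
  by_cases h7 : v 7 = 0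
  · refine ⟨0, _, Or.inr rfl, h.swapXY.shiftL 0, ?_⟩
    simp [_root_.shiftL, _root_.swapXY, h7]
  · obtain ⟨t, ht⟩ := IsAlgClosed.exists_root (k := K)
      (Polynomial.C (v 7) * Polynomial.X ^ 7 + Polynomial.C (7 * v 6) * Polynomial.X ^ 6 +
        Polynomial.C (21 * v 5) * Polynomial.X ^ 5 + Polynomial.C (35 * v 4) * Polynomial.X ^ 4 +
        Polynomial.C (35 * v 3) * Polynomial.X ^ 3 + Polynomial.C (21 * v 2) * Polynomial.X ^ 2 +
        Polynomial.C (7 * v 1) * Polynomial.X + Polynomial.C (v 0)) (by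
          have : Polynomial.degree (Polynomial.C (v 7) * Polynomial.X ^ 7 +
            Polynomial.C (7 * v 6) * Polynomial.X ^ 6 +
            Polynomial.C (21 * v 5) * Polynomial.X ^ 5 + Polynomial.C (35 * v 4) *
                Polynomial.X ^ 4 +
            Polynomial.C (35 * v 3) * Polynomial.X ^ 3 + Polynomial.C (21 * v 2) *
                Polynomial.X ^ 2 +
            Polynomial.C (7 * v 1) * Polynomial.X + Polynomial.C (v 0)) = 7 := by
              compute_degree!
          rw [this]
          decide)
    refine ⟨t, _, Or.inl rfl, h.shiftL t, ?_⟩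
    simp only [Polynomial.IsRoot, Polynomial.eval_add, Polynomial.eval_mul, Polynomial.eval_C,
      Polynomial.eval_pow, Polynomial.eval_X] at ht
    simp only [_root_.shiftL, Matrix.cons_val_zero]
    linear_combination ht

theorem dimLE_five [IsAlgClosed K] (h : IsPt P v) : DimLE P 5 := by
  classical
  have := charZero_of_algebra_complex K
  have key : ∀ w : Fin 8 → K, IsPt P w → (∀ i : Fin 8, 5 ≤ (i : ℕ) → w i = 0 ∨ w i = 1) →
      DimLE P 5 := by
    intro w hw hz
    refine DimLE.of_ev hw {w 0, w 1, w 2, w 3, w 4} Finset.card_le_five fun i => ?_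
    by_cases hi : 5 ≤ (i : ℕ)
    · rcases hz i hi with h | h
      · rw [h]; exact zero_mem _
      · rw [h]; exact one_mem _
    · refine subset_algCl ?_
      fin_cases i <;> simp at hi ⊢
  have step : ∃ w : Fin 8 → K, IsPt P w ∧ w 7 = 0 := by
    obtain ⟨t, u, -, hu, hu0⟩ := h.exists_root
    exact ⟨_, hu.swapXY, by simp [_root_.swapXY, hu0]⟩
  obtain ⟨w, hw, w7⟩ := step
  by_cases w6 : w 6 = 0
  · by_cases w5 : w 5 = 0
    · refine key w hw fun i hi => ?_
      fin_cases i <;> simp at hi <;> simp [w5, w6, w7]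
    · obtain ⟨c, hc, e⟩ := exists_torusT w w5
      refine key _ (hw.torusT hc) fun i hi => ?_
      have e6 := torusT_eq_zero (c := c) w6
      have e7 := torusT_eq_zero (c := c) w7
      fin_cases i <;> simp at hi <;> simp [e, e6, e7]
  · obtain ⟨c, hc, e⟩ := exists_torusT w w6
    have e7 := torusT_eq_zero (c := c) w7
    refine key _ ((hw.torusT hc).shiftL (-(_root_.torusT c w 5 / 2))) fun i hi => ?_
    fin_cases i <;> simp at hi <;> simp [_root_.shiftL, e, e7]
    exact Or.inl (by ring)

/-- Normal forms of septimics with `ψ = 0`. -/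
theorem exists_normal_zero [IsAlgClosed K] (h : IsPt P v) (h1 : psiT v 1 = 0) (h2 : psiT v 2 = 0)
    (h0 : psiT v 0 = 0) : irr ≤ P ∨ ∃ w : Fin 8 → K, IsPt P w ∧ psiT w 1 = 0 ∧ psiT w 2 = 0 ∧
      psiT w 0 = 0 ∧ w 0 = 0 ∧ ((w 1 = 1 ∧ w 2 = 0) ∨ (w 1 = 0 ∧ w 2 = 1 ∧ w 3 = 0)) := by
  have := charZero_of_algebra_complex K
  obtain ⟨w, hw, w1, w2, w0, e0⟩ : ∃ w : Fin 8 → K, IsPt P w ∧ psiT w 1 = 0 ∧ psiT w 2 = 0 ∧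
      psiT w 0 = 0 ∧ w 0 = 0 := by
    obtain ⟨t, u, hu, hu', hu0⟩ := h.exists_root
    have hu : psiT u 0 = 0 ∧ psiT u 1 = 0 ∧ psiT u 2 = 0 := by
      rcases hu with rfl | rfl
      · exact ⟨h0, h1, h2⟩
      · exact ⟨by rw [psiT_swapXY_zero, h2], by rw [psiT_swapXY_one, h1, neg_zero],
          by rw [psiT_swapXY_two, h0]⟩
    refine ⟨_, hu', ?_, ?_, ?_, hu0⟩
    · rw [psiT_shiftL_one, hu.2.1, hu.2.2]; ring
    · rw [psiT_shiftL_two, hu.2.2]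
    · rw [psiT_shiftL_zero, hu.1, hu.2.1, hu.2.2]; ring
  have step : ∀ i : Fin 8, w i ≠ 0 → ∃ u : Fin 8 → K, IsPt P u ∧ psiT u 1 = 0 ∧ psiT u 2 = 0 ∧
      psiT u 0 = 0 ∧ u i = 1 ∧ ∀ j, w j = 0 → u j = 0 := by
    intro i hi
    obtain ⟨c, hc, e⟩ := exists_torusT w hi
    refine ⟨_, hw.torusT hc, ?_, ?_, ?_, e, fun j => torusT_eq_zero⟩
    · rw [psiT_torusT_one hc, w1]
    · rw [psiT_torusT_two hc, w2, mul_zero]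
    · rw [psiT_torusT_zero hc, w0, mul_zero]
  have move : ∀ (u : Fin 8 → K) (t : K), IsPt P u → psiT u 1 = 0 → psiT u 2 = 0 → psiT u 0 = 0 →
      IsPt P (_root_.shiftU t u) ∧ psiT (_root_.shiftU t u) 1 = 0 ∧
        psiT (_root_.shiftU t u) 2 = 0 ∧ psiT (_root_.shiftU t u) 0 = 0 := by
    intro u t hu h1 h2 h0
    refine ⟨hu.shiftU t, ?_, ?_, ?_⟩
    · rw [psiT_shiftU_one, h1, h0]; ring
    · rw [psiT_shiftU_two, h2, h1, h0]; ring
    · rw [psiT_shiftU_zero, h0]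
  by_cases z1 : w 1 = 0
  · by_cases z2 : w 2 = 0
    · left
      have z3 : w 3 = 0 := by simpa [psiT, e0, z1, z2] using w0
      refine hw.irr_le_of_lower fun i hi => ?_
      fin_cases i <;> simp at hi <;> assumption
    · right
      obtain ⟨u, hu, u1, u2, u0, e, hz⟩ := step 2 z2
      obtain ⟨a, b, c, d⟩ := move u (-(u 3 / 3)) hu u1 u2 u0
      refine ⟨_, a, b, c, d, ?_, Or.inr ⟨?_, ?_, ?_⟩⟩
      · simp [_root_.shiftU, hz 0 e0]
      · simp [_root_.shiftU, hz 0 e0, hz 1 z1]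
      · simp [_root_.shiftU, hz 0 e0, hz 1 z1, e]
      · simp [_root_.shiftU, hz 0 e0, hz 1 z1, e]
        ring
  · right
    obtain ⟨u, hu, u1, u2, u0, e, hz⟩ := step 1 z1
    obtain ⟨a, b, c, d⟩ := move u (-(u 2 / 2)) hu u1 u2 u0
    refine ⟨_, a, b, c, d, ?_, Or.inl ⟨?_, ?_⟩⟩
    · simp [_root_.shiftU, hz 0 e0]
    · simp [_root_.shiftU, hz 0 e0, e]
    · simp [_root_.shiftU, hz 0 e0, e]
      ring

end IsPt

end ZeroCatalecticant

section Points

variable {K : Type} [Field K] [Algebra ℂ K]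

theorem exists_algCl_of_eval_ne {n : ℕ} (x : Fin (n + 1) → K) (Q : MvPolynomial (Fin (n + 1)) ℂ)
    (a : Fin (n + 1) → ℂ) (ha : eval a Q ≠ 0) (h : aeval x Q = 0) :
    ∃ s : Finset K, s.card ≤ n ∧ ∀ i, x i ∈ algCl (s : Set K) :=
  exists_algCl_of_relation x Q (fun h0 => ha (by rw [h0, map_zero])) h

/-- The normal form of a septimic with `ψ = 0` and a simple root. -/
def zForm {B : Type} [CommRing B] (s t : B) : Fin 8 → B :=
  ![0, 1, 0, 3 * s, t, -15 * s ^ 2, -3 * s * t, 10 * t ^ 2 + 675 * s ^ 3]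

section ZValues
variable {B : Type} [CommRing B] (s t : B)

theorem kT_zForm : kT (zForm s t) 0 = -240 * s ∧ kT (zForm s t) 1 = -30 * t ∧
    kT (zForm s t) 2 = 240 * s ^ 2 ∧ kT (zForm s t) 3 = 30 * s * t ∧
    kT (zForm s t) 4 = 3600 * s ^ 3 + 60 * t ^ 2 ∧ kT (zForm s t) 5 = -30 * s ^ 2 * t ∧
    kT (zForm s t) 6 = 54000 * s ^ 4 + 840 * s * t ^ 2 := by
  refine ⟨?_, ?_, ?_, ?_, ?_, ?_, ?_⟩ <;> simp [kT, zForm] <;> ring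

theorem iT_zForm : iT (zForm s t) 0 = 16200 * (64 * s ^ 3 + t ^ 2) * (-4 * s) ∧
    iT (zForm s t) 1 = 16200 * (64 * s ^ 3 + t ^ 2) * t ∧
    iT (zForm s t) 2 = 16200 * (64 * s ^ 3 + t ^ 2) * (-20 * s ^ 2) ∧
    iT (zForm s t) 3 = 16200 * (64 * s ^ 3 + t ^ 2) * (-4 * s * t) ∧
    iT (zForm s t) 4 = 16200 * (64 * s ^ 3 + t ^ 2) * (4 * (75 * s ^ 3 + t ^ 2)) := by
  obtain ⟨h0, h1, h2, h3, h4, h5, h6⟩ := kT_zForm s t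
  refine ⟨?_, ?_, ?_, ?_, ?_⟩ <;> simp only [iT, sextic4, h0, h1, h2, h3, h4, h5, h6] <;> ring

theorem lT_zForm : lT (zForm s t) 0 = 5832000 * (64 * s ^ 3 + t ^ 2) ^ 2 * (-5 * s) ∧
    lT (zForm s t) 1 = 5832000 * (64 * s ^ 3 + t ^ 2) ^ 2 * (-t) ∧
    lT (zForm s t) 2 = 5832000 * (64 * s ^ 3 + t ^ 2) ^ 2 * (-25 * s ^ 2) := by
  obtain ⟨h0, h1, h2, h3, h4, h5, h6⟩ := kT_zForm s t
  obtain ⟨i0, i1, i2, i3, i4⟩ := iT_zForm s t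
  refine ⟨?_, ?_, ?_⟩ <;>
    simp only [lT, Nat.reduceAdd, h0, h1, h2, h3, h4, h5, h6, i0, i1, i2, i3, i4] <;> ring

theorem mT_zForm :
    mT (zForm s t) 0 = 94478400000 * (64 * s ^ 3 + t ^ 2) ^ 3 * (200 * s ^ 3 + 2 * t ^ 2) ∧
    mT (zForm s t) 1 = 94478400000 * (64 * s ^ 3 + t ^ 2) ^ 3 * (-45 * s ^ 2 * t) ∧
    mT (zForm s t) 2 =
      94478400000 * (64 * s ^ 3 + t ^ 2) ^ 3 * (-1000 * s ^ 4 - 28 * s * t ^ 2) := by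
  obtain ⟨i0, i1, i2, i3, i4⟩ := iT_zForm s t
  obtain ⟨l0, l1, l2⟩ := lT_zForm s t
  refine ⟨?_, ?_, ?_⟩ <;>
    simp only [mT, Nat.reduceAdd, l0, l1, l2, i0, i1, i2, i3, i4] <;> ring

theorem nT_zForm :
    nT (zForm s t) 0 = 1530550080000000 * (64 * s ^ 3 + t ^ 2) ^ 4 * (162 * s ^ 2 * t ^ 2) ∧
    nT (zForm s t) 1 =
      1530550080000000 * (64 * s ^ 3 + t ^ 2) ^ 4 * (-3600 * s ^ 4 * t - 36 * s * t ^ 3) ∧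
    nT (zForm s t) 2 = 1530550080000000 * (64 * s ^ 3 + t ^ 2) ^ 4 *
      (80000 * s ^ 6 + 1600 * s ^ 3 * t ^ 2 + 8 * t ^ 4) := by
  obtain ⟨i0, i1, i2, i3, i4⟩ := iT_zForm s t
  obtain ⟨l0, l1, l2⟩ := mT_zForm s t
  refine ⟨?_, ?_, ?_⟩ <;>
    simp only [nT, Nat.reduceAdd, l0, l1, l2, i0, i1, i2, i3, i4] <;> ring

variable [Algebra ℂ B]

theorem ev_inv12c_zForm : ev (zForm s t) inv12c.toInv =
    (4 * 16200 ^ 3) * ((64 * s ^ 3 + t ^ 2) ^ 4 * (125 * s ^ 3 - t ^ 2)) := by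
  obtain ⟨i0, i1, i2, i3, i4⟩ := iT_zForm s t
  rw [ev_inv12c, i0, i1, i2, i3, i4]
  ring

theorem ev_inv20_zForm : ev (zForm s t) inv20.toInv = (2 * 94478400000 ^ 2) *
    ((64 * s ^ 3 + t ^ 2) ^ 6 * (-(s * (200000 * s ^ 6 + 9625 * s ^ 3 * t ^ 2 + 56 * t ^ 4)))) := by
  obtain ⟨l0, l1, l2⟩ := lT_zForm s t
  obtain ⟨n0, n1, n2⟩ := nT_zForm s t
  rw [ev_inv20, l0, l1, l2, n0, n1, n2]
  ring

theorem ev_inv30_zForm : ev (zForm s t) inv30.toInv = (2 * 94478400000 ^ 3) *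
    ((64 * s ^ 3 + t ^ 2) ^ 9 * (-(t * (35000000 * s ^ 9 + 931875 * s ^ 6 * t ^ 2 +
      8988 * s ^ 3 * t ^ 4 + 8 * t ^ 6)))) := by
  obtain ⟨l0, l1, l2⟩ := lT_zForm s t
  obtain ⟨m0, m1, m2⟩ := mT_zForm s t
  obtain ⟨n0, n1, n2⟩ := nT_zForm s t
  rw [ev_inv30, l0, l1, l2, m0, m1, m2, n0, n1, n2]
  ring

end ZValues

/-- The septimics `21 x⁵ y² + w y⁷`. -/
def twoForm {B : Type} [CommRing B] (w : B) : Fin 8 → B := ![0, 0, 1, 0, 0, 0, 0, w]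

end Points

section TwoValues
variable {B : Type} [CommRing B] (w : B)

theorem kT_twoForm : kT (twoForm w) 0 = 60 ∧ kT (twoForm w) 1 = 0 ∧ kT (twoForm w) 2 = 0 ∧
    kT (twoForm w) 3 = 0 ∧ kT (twoForm w) 4 = 0 ∧ kT (twoForm w) 5 = 10 * w ∧
    kT (twoForm w) 6 = 0 := by
  refine ⟨?_, ?_, ?_, ?_, ?_, ?_, ?_⟩ <;> simp [kT, twoForm]

theorem iT_twoForm : iT (twoForm w) 0 = 0 ∧ iT (twoForm w) 1 = 1800 * w ∧
    iT (twoForm w) 2 = 0 ∧ iT (twoForm w) 3 = 0 ∧ iT (twoForm w) 4 = 0 := by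
  obtain ⟨h0, h1, h2, h3, h4, h5, h6⟩ := kT_twoForm w
  refine ⟨?_, ?_, ?_, ?_, ?_⟩ <;> simp only [iT, sextic4, h0, h1, h2, h3, h4, h5, h6] <;> ring

theorem lT_twoForm : lT (twoForm w) 0 = 0 ∧ lT (twoForm w) 1 = 0 ∧
    lT (twoForm w) 2 = -72000 * w ^ 2 := by
  obtain ⟨h0, h1, h2, h3, h4, h5, h6⟩ := kT_twoForm w
  obtain ⟨i0, i1, i2, i3, i4⟩ := iT_twoForm w
  refine ⟨?_, ?_, ?_⟩ <;>
    simp only [lT, Nat.reduceAdd, h0, h1, h2, h3, h4, h5, h6, i0, i1, i2, i3, i4] <;> ring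

theorem mT_twoForm : mT (twoForm w) 0 = 0 ∧ mT (twoForm w) 1 = -129600000 * w ^ 3 ∧
    mT (twoForm w) 2 = 0 := by
  obtain ⟨i0, i1, i2, i3, i4⟩ := iT_twoForm w
  obtain ⟨l0, l1, l2⟩ := lT_twoForm w
  refine ⟨?_, ?_, ?_⟩ <;>
    simp only [mT, Nat.reduceAdd, l0, l1, l2, i0, i1, i2, i3, i4] <;> ring

theorem nT_twoForm : nT (twoForm w) 0 = 466560000000 * w ^ 4 ∧ nT (twoForm w) 1 = 0 ∧
    nT (twoForm w) 2 = 0 := by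
  obtain ⟨i0, i1, i2, i3, i4⟩ := iT_twoForm w
  obtain ⟨l0, l1, l2⟩ := mT_twoForm w
  refine ⟨?_, ?_, ?_⟩ <;>
    simp only [nT, Nat.reduceAdd, l0, l1, l2, i0, i1, i2, i3, i4] <;> ring

variable [Algebra ℂ B]

theorem ev_inv20_twoForm : ev (twoForm w) inv20.toInv = -33592320000000000 * w ^ 6 := by
  obtain ⟨l0, l1, l2⟩ := lT_twoForm w
  obtain ⟨n0, n1, n2⟩ := nT_twoForm w
  rw [ev_inv20, l0, l1, l2, n0, n1, n2]
  ring

theorem ev_inv30_twoForm : ev (twoForm w) inv30.toInv = 4353564672000000000000000 * w ^ 9 := by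
  obtain ⟨l0, l1, l2⟩ := lT_twoForm w
  obtain ⟨m0, m1, m2⟩ := mT_twoForm w
  obtain ⟨n0, n1, n2⟩ := nT_twoForm w
  rw [ev_inv30, l0, l1, l2, m0, m1, m2, n0, n1, n2]
  ring

end TwoValues

namespace IsPt
variable {K : Type} [Field K] [Algebra ℂ K] {P : Ideal (invariantRing 7)} {v : Fin 8 → K}

theorem exists_zForm [IsAlgClosed K] (h : IsPt P v) (h1 : psiT v 1 = 0) (h2 : psiT v 2 = 0)
    (h0 : psiT v 0 = 0) : irr ≤ P ∨ (∃ s t : K, IsPt P (zForm s t) ∧ 64 * s ^ 3 + t ^ 2 ≠ 0) ∨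
      ∃ w : K, w ≠ 0 ∧ IsPt P (twoForm w) := by
  have := charZero_of_algebra_complex K
  rcases h.exists_normal_zero h1 h2 h0 with hP | ⟨w, hw, w1, w2, w0, e0, ⟨e1, e2⟩ | ⟨e1, e2, e3⟩⟩
  · exact Or.inl hP
  · obtain ⟨s, hs⟩ : ∃ s, w 3 = 3 * s := ⟨w 3 / 3, by ring⟩
    have e5 : w 5 = -15 * s ^ 2 := by
      simp only [psiT, e0, e1, e2, hs] at w0
      linear_combination (-1 / 12 : K) * w0
    have e6 : w 6 = -3 * s * w 4 := by
      simp only [psiT, e0, e1, e2, hs] at w1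
      linear_combination (-1 / 5 : K) * w1
    have e7 : w 7 = 10 * w 4 ^ 2 + 675 * s ^ 3 := by
      simp only [psiT, e0, e1, e2, hs, e5] at w2
      linear_combination (1 / 2 : K) * w2
    have hwz : w = zForm s (w 4) := by
      funext i
      fin_cases i <;> simp [zForm, e0, e1, e2, hs, e5, e6, e7]
    rw [hwz] at hw
    by_cases hW : 64 * s ^ 3 + w 4 ^ 2 = 0
    · left
      obtain ⟨l, hl, ht⟩ : ∃ l : K, s = -l ^ 2 ∧ w 4 = -8 * l ^ 3 := by
        by_cases hs0 : s = 0
        · refine ⟨0, by simp [hs0], ?_⟩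
          rw [hs0] at hW
          have : w 4 = 0 := by simpa using hW
          rw [this]; ring
        · refine ⟨w 4 / (8 * s), ?_, ?_⟩
          · field_simp
            linear_combination hW
          · field_simp
            linear_combination w 4 * hW
      rw [ht, hl] at hw
      refine (hw.shiftU (-l)).irr_le_of_upper fun i hi => ?_
      fin_cases i <;> simp at hi <;> simp [_root_.shiftU, zForm] <;> ring
    · exact Or.inr (Or.inl ⟨s, w 4, hw, hW⟩)
  · have e4 : w 4 = 0 := by simpa [psiT, e0, e1, e2, e3] using w0
    have e5 : w 5 = 0 := by simpa [psiT, e0, e1, e2, e3] using w1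
    have e6 : w 6 = 0 := by simpa [psiT, e0, e1, e2, e3, e4] using w2
    have hwz : w = twoForm (w 7) := by
      funext i
      fin_cases i <;> simp [twoForm, e0, e1, e2, e3, e4, e5, e6]
    by_cases e7 : w 7 = 0
    · left
      refine hw.irr_le_of_upper fun i hi => ?_
      fin_cases i <;> simp at hi <;> assumption
    · rw [hwz] at hw
      exact Or.inr (Or.inr ⟨_, e7, hw⟩)

theorem zForm_mem_algCl {S : Set K} {s t : K} (hs : s ∈ algCl S) (ht : t ∈ algCl S) (i : Fin 8) :
    zForm s t i ∈ algCl S := by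
  fin_cases i <;> simp only [zForm, Fin.zero_eta, Fin.mk_one, Fin.reduceFinMk, Matrix.cons_val] <;>
  repeat' first
    | exact hs | exact ht | apply add_mem | apply mul_mem | apply neg_mem | apply pow_mem
    | exact ofNat_mem _ _ | exact zero_mem _ | exact one_mem _

theorem twoForm_dimLE_one {w : K} (h : IsPt P (twoForm w)) : DimLE P 1 := by
  refine DimLE.of_ev h {w} (by simp) fun i => ?_
  have hw : w ∈ algCl ((({w} : Finset K) : Set K)) := subset_algCl (by simp)
  fin_cases i <;> simp only [twoForm, Fin.zero_eta, Fin.mk_one, Fin.reduceFinMk, Matrix.cons_val]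
  all_goals first | exact hw | exact zero_mem _ | exact one_mem _

theorem zForm_dimLE_one {s t : K} (h : IsPt P (zForm s t)) (Q : MvPolynomial (Fin 2) ℂ)
    (hQ : eval ![1, 1] Q ≠ 0) (e : aeval ![s, t] Q = 0) : DimLE P 1 := by
  obtain ⟨S, hS, hx⟩ := exists_algCl_of_eval_ne ![s, t] Q _ hQ e
  exact DimLE.of_ev h S hS fun i => zForm_mem_algCl (hx 0) (hx 1) i

theorem dimLE_of_irr_le (hP : irr ≤ P) {k : ℕ} : DimLE P k :=
  (dimLE_zero_of_irr_le hP).mono (Nat.zero_le _)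

variable [IsAlgClosed K] (h : IsPt P v) (h1 : psiT v 1 = 0) (h2 : psiT v 2 = 0) (h0 : psiT v 0 = 0)
include h h1 h2 h0

theorem zero_dimLE_two : DimLE P 2 := by
  classical
  rcases h.exists_zForm h1 h2 h0 with hP | ⟨s, t, hw, -⟩ | ⟨w, -, hw⟩
  · exact dimLE_of_irr_le hP
  · exact DimLE.of_ev hw {s, t} Finset.card_le_two fun i =>
      zForm_mem_algCl (subset_algCl (by simp)) (subset_algCl (by simp)) i
  · exact hw.twoForm_dimLE_one.mono (by norm_num)

theorem zero_dimLE_one_of_inv12c (hp : inv12c.toInv ∈ P) : DimLE P 1 := by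
  have := charZero_of_algebra_complex K
  rcases h.exists_zForm h1 h2 h0 with hP | ⟨s, t, hw, hW⟩ | ⟨w, -, hw⟩
  · exact dimLE_of_irr_le hP
  · have e := (hw _).1 hp
    rw [ev_inv12c_zForm] at e
    have e' : 125 * s ^ 3 - t ^ 2 = 0 := by
      simpa [hW] using e
    refine hw.zForm_dimLE_one (125 * X 0 ^ 3 - X 1 ^ 2) ?_ ?_
    · simp; norm_num
    · simpa using e'
  · exact hw.twoForm_dimLE_one

theorem zero_dimLE_one_of_inv20 (hp : inv20.toInv ∈ P) : DimLE P 1 := by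
  have := charZero_of_algebra_complex K
  rcases h.exists_zForm h1 h2 h0 with hP | ⟨s, t, hw, hW⟩ | ⟨w, -, hw⟩
  · exact dimLE_of_irr_le hP
  · have e := (hw _).1 hp
    rw [ev_inv20_zForm] at e
    have e' : s * (200000 * s ^ 6 + 9625 * s ^ 3 * t ^ 2 + 56 * t ^ 4) = 0 := by
      simpa [hW] using e
    refine hw.zForm_dimLE_one
      (X 0 * (200000 * X 0 ^ 6 + 9625 * X 0 ^ 3 * X 1 ^ 2 + 56 * X 1 ^ 4)) ?_ ?_
    · simp; norm_num
    · simpa using e'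
  · exact hw.twoForm_dimLE_one

theorem zero_dimLE_one_of_inv30 (hp : inv30.toInv ∈ P) : DimLE P 1 := by
  have := charZero_of_algebra_complex K
  rcases h.exists_zForm h1 h2 h0 with hP | ⟨s, t, hw, hW⟩ | ⟨w, -, hw⟩
  · exact dimLE_of_irr_le hP
  · have e := (hw _).1 hp
    rw [ev_inv30_zForm] at e
    have e' : t * (35000000 * s ^ 9 + 931875 * s ^ 6 * t ^ 2 +
      8988 * s ^ 3 * t ^ 4 + 8 * t ^ 6) = 0 := by
      simpa [hW] using e
    refine hw.zForm_dimLE_one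
      (X 1 * (35000000 * X 0 ^ 9 + 931875 * X 0 ^ 6 * X 1 ^ 2 +
      8988 * X 0 ^ 3 * X 1 ^ 4 + 8 * X 1 ^ 6)) ?_ ?_
    · simp; norm_num
    · simpa using e'
  · exact hw.twoForm_dimLE_one

theorem zero_irr_le (hp : inv12c.toInv ∈ P) (hq : inv20.toInv ∈ P ∨ inv30.toInv ∈ P) :
    irr ≤ P := by
  have := charZero_of_algebra_complex K
  rcases h.exists_zForm h1 h2 h0 with hP | ⟨s, t, hw, hW⟩ | ⟨w, hw0, hw⟩
  · exact hP
  · exfalso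
    have e := (hw _).1 hp
    rw [ev_inv12c_zForm] at e
    have e' : t ^ 2 = 125 * s ^ 3 := by
      have : 125 * s ^ 3 - t ^ 2 = 0 := by simpa [hW] using e
      linear_combination - this
    have hs : s ≠ 0 := by
      rintro rfl
      exact hW (by rw [e']; ring)
    rcases hq with hq | hq
    · have e := (hw _).1 hq
      rw [ev_inv20_zForm] at e
      have e2 : s * (200000 * s ^ 6 + 9625 * s ^ 3 * t ^ 2 + 56 * t ^ 4) = 0 := by
        simpa [hW] using e
      have : 2278125 * s ^ 7 = 0 := by
        linear_combination e2 - s * (9625 * s ^ 3 + 56 * (t ^ 2 + 125 * s ^ 3)) * e'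
      simp [hs] at this
    · have e := (hw _).1 hq
      rw [ev_inv30_zForm] at e
      have ht : t ≠ 0 := by
        rintro rfl
        apply hs
        simpa using e'.symm
      have e2 : 35000000 * s ^ 9 + 931875 * s ^ 6 * t ^ 2 +
          8988 * s ^ 3 * t ^ 4 + 8 * t ^ 6 = 0 := by
        simpa [hW, ht] using e
      have : 307546875 * s ^ 9 = 0 := by
        linear_combination e2 - (931875 * s ^ 6 + 8988 * s ^ 3 * (t ^ 2 + 125 * s ^ 3) +
          8 * (t ^ 4 + t ^ 2 * (125 * s ^ 3) + (125 * s ^ 3) ^ 2)) * e'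
      simp [hs] at this
  · exfalso
    rcases hq with hq | hq
    · have e := (hw _).1 hq
      rw [ev_inv20_twoForm] at e
      simp [hw0] at e
    · have e := (hw _).1 hq
      rw [ev_inv30_twoForm] at e
      simp [hw0] at e

end IsPt

/-- The normal form of a septimic with `ψ = ψ₀ x²` and `v 7 ≠ 0`. -/
def yForm {B : Type} [CommRing B] (a b c d : B) : Fin 8 → B :=
  ![5 * b * c - 9 * a * d, 10 * c ^ 2 - 15 * b * d, a, b, c, d, 0, 1]

/-- A coefficient of the quartic covariant on `yForm`, up to a scalar. -/
def yQuarticThree {B : Type} [CommRing B] (a b c d : B) : B :=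
  3 * a ^ 2 * c - a * b ^ 2 + 12 * a * b * d ^ 2 - 6 * a * c ^ 2 * d - 27 * a * d ^ 4 +
    28 * b ^ 2 * c * d - 18 * b * c ^ 3 + 132 * b * c * d ^ 3 - 78 * c ^ 3 * d ^ 2

/-- The last coefficient of the quartic covariant on `yForm`, up to a scalar. -/
def yQuarticFour {B : Type} [CommRing B] (a b c d : B) : B :=
  3 * a ^ 2 * d - 3 * a * b * c + 3 * a * c * d ^ 2 + b ^ 3 + 54 * b ^ 2 * d ^ 2 -
    78 * b * c ^ 2 * d + 9 * b * d ^ 4 + 27 * c ^ 4 - 6 * c ^ 2 * d ^ 3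

section YValues
variable {B : Type} [CommRing B] (a b c d : B)

theorem psiT_yForm : psiT (yForm a b c d) 0 =
      10 * (3 * a * c - 2 * b ^ 2 + 18 * b * d ^ 2 - 12 * c ^ 2 * d) ∧
    psiT (yForm a b c d) 1 = 0 ∧ psiT (yForm a b c d) 2 = 0 := by
  refine ⟨?_, ?_, ?_⟩ <;> simp [psiT, yForm] <;> ring

theorem kT_yForm : kT (yForm a b c d) 3 = 10 * (-3 * a * d + 2 * b * c) ∧
    kT (yForm a b c d) 4 = 20 * (-4 * b * d + 3 * c ^ 2) ∧
    kT (yForm a b c d) 5 = 10 * (a + 2 * c * d) ∧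
    kT (yForm a b c d) 6 = 20 * (b + 3 * d ^ 2) := by
  refine ⟨?_, ?_, ?_, ?_⟩ <;> simp [kT, yForm] <;> ring

theorem hT_yForm : hT (yForm a b c d) 7 = 21 * (a - 4 * c * d) ∧
    hT (yForm a b c d) 8 = 28 * (2 * b - 3 * d ^ 2) ∧
    hT (yForm a b c d) 9 = 126 * c ∧ hT (yForm a b c d) 10 = 252 * d := by
  refine ⟨?_, ?_, ?_, ?_⟩ <;> simp [hT, yForm] <;> ring

theorem iT_yForm : iT (yForm a b c d) 3 = 600 * yQuarticThree a b c d ∧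
    iT (yForm a b c d) 4 = 2400 * yQuarticFour a b c d := by
  refine ⟨?_, ?_⟩ <;> simp [iT, sextic4, kT, yForm, yQuarticThree, yQuarticFour] <;> ring

theorem iT_yForm_two : iT (yForm a b c 0) 2 =
    1200 * (a ^ 2 * b + 9 * a * c ^ 3 - 18 * b ^ 2 * c ^ 2) := by
  simp [iT, sextic4, kT, yForm]
  ring

end YValues

namespace IsPt
variable {K : Type} [Field K] [Algebra ℂ K] {P : Ideal (invariantRing 7)} {a b c d : K}

theorem yForm_mem_algCl {S : Set K} (ha : a ∈ algCl S) (hb : b ∈ algCl S) (hc : c ∈ algCl S)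
    (hd : d ∈ algCl S) (i : Fin 8) : yForm a b c d i ∈ algCl S := by
  fin_cases i <;> simp only [yForm, Fin.zero_eta, Fin.mk_one, Fin.reduceFinMk, Matrix.cons_val] <;>
  repeat' first
    | exact ha | exact hb | exact hc | exact hd
    | apply add_mem | apply sub_mem | apply mul_mem | apply neg_mem | apply pow_mem
    | exact ofNat_mem _ _ | exact zero_mem _ | exact one_mem _

variable (h : IsPt P (yForm a b c d)) (h0 : psiT (yForm a b c d) 0 ≠ 0)
include h

theorem yForm_dimLE {k : ℕ} (S : Finset K) (hS : S.card ≤ k) (ha : a ∈ algCl (S : Set K))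
    (hb : b ∈ algCl (S : Set K)) (hc : c ∈ algCl (S : Set K)) (hd : d ∈ algCl (S : Set K)) :
    DimLE P k :=
  DimLE.of_ev h S hS fun i => yForm_mem_algCl ha hb hc hd i

include h0

theorem yForm_of_inv8 (h8 : inv8.toInv ∈ P) : b = -3 * d ^ 2 := by
  have := charZero_of_algebra_complex K
  obtain ⟨-, p1, p2⟩ := psiT_yForm a b c d
  have e := (h _).1 h8
  rw [ev_inv8 p1 p2, (kT_yForm a b c d).2.2.2] at e
  have : b + 3 * d ^ 2 = 0 := by simpa [h0] using e
  linear_combination this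

theorem yForm_of_inv8i (h8 : inv8i.toInv ∈ P) : yQuarticFour a b c d = 0 := by
  have := charZero_of_algebra_complex K
  obtain ⟨-, p1, p2⟩ := psiT_yForm a b c d
  have e := (h _).1 h8
  rw [ev_inv8i p1 p2, (iT_yForm a b c d).2] at e
  simpa [h0] using e

theorem yForm_of_inv12 (h12 : inv12.toInv ∈ P) : d = 0 := by
  have := charZero_of_algebra_complex K
  obtain ⟨-, p1, p2⟩ := psiT_yForm a b c d
  have e := (h _).1 h12
  rw [ev_inv12 p1 p2, (hT_yForm a b c d).2.2.2] at e
  simpa [h0] using e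

theorem yForm_of_inv18hk (h18 : inv18hk.toInv ∈ P) : a * d - b * c - c * d ^ 2 = 0 := by
  have := charZero_of_algebra_complex K
  obtain ⟨-, p1, p2⟩ := psiT_yForm a b c d
  have e := (h _).1 h18
  obtain ⟨k3, k4, k5, k6⟩ := kT_yForm a b c d
  obtain ⟨h7, h8, h9, h10⟩ := hT_yForm a b c d
  rw [ev_inv18hk p1 p2, k5, k6, h9, h10] at e
  have e := (mul_eq_zero.1 e).resolve_left (pow_ne_zero _ h0)
  linear_combination e / 2520

theorem yForm_of_inv18hi (h18 : inv18hi.toInv ∈ P) :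
    d * yQuarticThree a b c d - 2 * c * yQuarticFour a b c d = 0 := by
  have := charZero_of_algebra_complex K
  obtain ⟨-, p1, p2⟩ := psiT_yForm a b c d
  have e := (h _).1 h18
  obtain ⟨i3, i4⟩ := iT_yForm a b c d
  obtain ⟨h7, h8, h9, h10⟩ := hT_yForm a b c d
  rw [ev_inv18hi p1 p2, i3, i4, h9, h10] at e
  have e := (mul_eq_zero.1 e).resolve_left (pow_ne_zero _ h0)
  linear_combination e / 151200

theorem yForm_of_inv14ki (h14 : inv14ki.toInv ∈ P) :
    (b + 3 * d ^ 2) * yQuarticThree a b c d - 2 * (a + 2 * c * d) * yQuarticFour a b c d = 0 := by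
  have := charZero_of_algebra_complex K
  obtain ⟨-, p1, p2⟩ := psiT_yForm a b c d
  have e := (h _).1 h14
  obtain ⟨i3, i4⟩ := iT_yForm a b c d
  obtain ⟨k3, k4, k5, k6⟩ := kT_yForm a b c d
  rw [ev_inv14ki p1 p2, i3, i4, k5, k6] at e
  have e := (mul_eq_zero.1 e).resolve_left (pow_ne_zero _ h0)
  linear_combination e / 12000

theorem yForm_of_inv14hk (h14 : inv14hk.toInv ∈ P) :
    a * (b - 9 * d ^ 2) + 32 * b * c * d - 18 * c ^ 3 = 0 := by
  have := charZero_of_algebra_complex K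
  obtain ⟨-, p1, p2⟩ := psiT_yForm a b c d
  have e := (h _).1 h14
  obtain ⟨k3, k4, k5, k6⟩ := kT_yForm a b c d
  obtain ⟨h7, h8, h9, h10⟩ := hT_yForm a b c d
  rw [ev_inv14hk p1 p2, k3, k4, k5, k6, h7, h8, h9, h10] at e
  have e := (mul_eq_zero.1 e).resolve_left (pow_ne_zero _ h0)
  linear_combination e / 1260

theorem yForm_dimLE_two_of_eight (h8 : inv8.toInv ∈ P) (h8i : inv8i.toInv ∈ P) : DimLE P 2 := by
  have hb := h.yForm_of_inv8 h0 h8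
  have hi := h.yForm_of_inv8i h0 h8i
  obtain ⟨S, hS, hx⟩ := exists_algCl_of_eval_ne ![a, c, d]
    (yQuarticFour (X 0) (-3 * X 2 ^ 2) (X 1) (X 2)) ![0, 1, 0]
    (by simp [yQuarticFour]) (by rw [hb] at hi; simpa [yQuarticFour] using hi)
  have hd : d ∈ algCl (S : Set K) := hx 2
  refine h.yForm_dimLE S hS (hx 0) ?_ (hx 1) hd
  rw [hb]
  exact mul_mem (neg_mem (ofNat_mem _ _)) (pow_mem hd _)

theorem yForm_false_of_zero (h8 : inv8.toInv ∈ P) (h8i : inv8i.toInv ∈ P) (hd : d = 0) : False := by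
  have := charZero_of_algebra_complex K
  have hb := h.yForm_of_inv8 h0 h8
  have hi := h.yForm_of_inv8i h0 h8i
  apply h0
  subst hd
  have hb' : b = 0 := by simpa using hb
  subst hb'
  have hc : c = 0 := by simpa [yQuarticFour] using hi
  rw [(psiT_yForm _ _ _ _).1, hc]
  ring

theorem yForm_dimLE_one_of_eight (h8 : inv8.toInv ∈ P) (h8i : inv8i.toInv ∈ P)
    (h18 : inv18hk.toInv ∈ P) : DimLE P 1 := by
  have hd0 : d ≠ 0 := h.yForm_false_of_zero h0 h8 h8i
  have hb := h.yForm_of_inv8 h0 h8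
  have hi := h.yForm_of_inv8i h0 h8i
  have e := h.yForm_of_inv18hk h0 h18
  have ha : a = -2 * c * d := by
    refine mul_right_cancel₀ hd0 ?_
    rw [hb] at e
    linear_combination e
  obtain ⟨S, hS, hx⟩ := exists_algCl_of_eval_ne ![c, d]
    (yQuarticFour (-2 * X 0 * X 1) (-3 * X 1 ^ 2) (X 0) (X 1)) ![1, 0]
    (by simp [yQuarticFour]) (by rw [hb, ha] at hi; simpa [yQuarticFour] using hi)
  have hc : c ∈ algCl (S : Set K) := hx 0
  have hd : d ∈ algCl (S : Set K) := hx 1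
  refine h.yForm_dimLE S hS ?_ ?_ hc hd
  · rw [ha]
    exact mul_mem (mul_mem (neg_mem (ofNat_mem _ _)) hc) hd
  · rw [hb]
    exact mul_mem (neg_mem (ofNat_mem _ _)) (pow_mem hd _)

theorem yForm_dimLE_one_of_twelve (h12 : inv12.toInv ∈ P) (hkk : inv12kk.toInv ∈ P)
    (hki : inv12ki.toInv ∈ P) : DimLE P 1 := by
  classical
  have := charZero_of_algebra_complex K
  have hd := h.yForm_of_inv12 h0 h12
  subst hd
  obtain ⟨-, p1, p2⟩ := psiT_yForm a b c 0
  obtain ⟨k3, k4, k5, k6⟩ := kT_yForm a b c 0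
  obtain ⟨i3, i4⟩ := iT_yForm a b c 0
  have e := (h _).1 hkk
  rw [ev_inv12kk p1 p2, k4, k5, k6] at e
  have e := (mul_eq_zero.1 e).resolve_left (pow_ne_zero _ h0)
  have e1 : a ^ 2 = 12 * b * c ^ 2 := by linear_combination (-1 / 200 : K) * e
  have e' := (h _).1 hki
  rw [ev_inv12ki p1 p2, k4, k5, k6, i3, i4, iT_yForm_two] at e'
  have e' := (mul_eq_zero.1 e').resolve_left (pow_ne_zero _ h0)
  simp only [yQuarticThree, yQuarticFour] at e'
  by_cases hc : c = 0
  · have ha : a = 0 := by simpa [hc] using e1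
    refine h.yForm_dimLE {b} (by simp) ?_ (subset_algCl (by simp)) ?_ (zero_mem _)
    · rw [ha]; exact zero_mem _
    · rw [hc]; exact zero_mem _
  · have hb : b = a ^ 2 / (12 * c ^ 2) := by
      field_simp
      linear_combination - e1
    have e2 : a ^ 3 - 216 * c ^ 5 = 0 := by
      have : (a ^ 3 - 216 * c ^ 5) ^ 2 = 0 := by
        linear_combination (432 / 36000 : K) * c ^ 4 * e' + (a ^ 4 + a ^ 2 * (12 * b * c ^ 2) +
          (12 * b * c ^ 2) ^ 2 - 432 * b ^ 2 * c ^ 4) * e1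
      simpa using this
    obtain ⟨S, hS, hx⟩ := exists_algCl_of_eval_ne ![a, c] (X 0 ^ 3 - 216 * X 1 ^ 5) ![1, 0]
      (by simp) (by simpa using e2)
    have ha : a ∈ algCl (S : Set K) := hx 0
    have hc : c ∈ algCl (S : Set K) := hx 1
    refine h.yForm_dimLE S hS ha ?_ hc (zero_mem _)
    rw [hb]
    exact div_mem (pow_mem ha _) (mul_mem (ofNat_mem _ _) (pow_mem hc _))

theorem yForm_dimLE_two_of_eighteen (hk : inv18hk.toInv ∈ P) (hi : inv18hi.toInv ∈ P) :
    DimLE P 2 := by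
  classical
  have := charZero_of_algebra_complex K
  have e1 := h.yForm_of_inv18hk h0 hk
  have e2 := h.yForm_of_inv18hi h0 hi
  by_cases hd : d = 0
  · subst hd
    have : b = 0 ∨ c = 0 := by simpa using e1
    rcases this with hb | hc
    · refine h.yForm_dimLE {a, c} Finset.card_le_two (subset_algCl (by simp)) ?_
        (subset_algCl (by simp)) (zero_mem _)
      rw [hb]; exact zero_mem _
    · refine h.yForm_dimLE {a, b} Finset.card_le_two (subset_algCl (by simp))
        (subset_algCl (by simp)) ?_ (zero_mem _)
      rw [hc]; exact zero_mem _
  · obtain ⟨q, hq⟩ : ∃ q, c = q * d := ⟨c / d, by field_simp⟩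
    have ha : a = (b + d ^ 2) * q := by
      refine mul_right_cancel₀ hd ?_
      rw [hq] at e1
      linear_combination e1
    rw [ha, hq] at e2
    obtain ⟨S, hS, hx⟩ := exists_algCl_of_eval_ne ![b, q, d]
      (X 2 * yQuarticThree ((X 0 + X 2 ^ 2) * X 1) (X 0) (X 1 * X 2) (X 2) -
        2 * (X 1 * X 2) * yQuarticFour ((X 0 + X 2 ^ 2) * X 1) (X 0) (X 1 * X 2) (X 2)) ![1, 1, 1]
      (by simp [yQuarticThree, yQuarticFour]; norm_num)
      (by simpa [yQuarticThree, yQuarticFour] using e2)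
    have hb : b ∈ algCl (S : Set K) := hx 0
    have hqm : q ∈ algCl (S : Set K) := hx 1
    have hdm : d ∈ algCl (S : Set K) := hx 2
    refine h.yForm_dimLE S hS ?_ hb ?_ hdm
    · rw [ha]; exact mul_mem (add_mem hb (pow_mem hdm _)) hqm
    · rw [hq]; exact mul_mem hqm hdm

theorem yForm_dimLE_two_of_fourteen (hk : inv14hk.toInv ∈ P) (hi : inv14ki.toInv ∈ P) :
    DimLE P 2 := by
  classical
  have := charZero_of_algebra_complex K
  have e1 := h.yForm_of_inv14hk h0 hk
  have e2 := h.yForm_of_inv14ki h0 hi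
  obtain ⟨g, hb⟩ : ∃ g, b = 9 * d ^ 2 + g := ⟨b - 9 * d ^ 2, by ring⟩
  by_cases hg : g = 0
  · subst hg
    have : c * (16 * d ^ 3 - c ^ 2) = 0 := by
      rw [hb] at e1
      linear_combination e1 / 18
    rcases mul_eq_zero.1 this with hc | hc
    · refine h.yForm_dimLE {a, d} Finset.card_le_two (subset_algCl (by simp)) ?_
        ?_ (subset_algCl (by simp))
      · rw [hb, add_zero]; exact mul_mem (ofNat_mem _ _) (pow_mem (subset_algCl (by simp)) _)
      · rw [hc]; exact zero_mem _
    · have hd : d ∈ algCl ((({a, d} : Finset K)) : Set K) := subset_algCl (by simp)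
      refine h.yForm_dimLE {a, d} Finset.card_le_two (subset_algCl (by simp)) ?_
        (algCl_of_pow (n := 2) (by norm_num) ?_) hd
      · rw [hb, add_zero]; exact mul_mem (ofNat_mem _ _) (pow_mem hd _)
      · rw [show c ^ 2 = 16 * d ^ 3 by linear_combination - hc]
        exact mul_mem (ofNat_mem _ _) (pow_mem hd _)
  · obtain ⟨q, hq⟩ : ∃ q, c = g * q := ⟨c / g, by field_simp⟩
    have ha : a = 18 * g ^ 2 * q ^ 3 - 32 * (9 * d ^ 2 + g) * q * d := by
      refine mul_right_cancel₀ hg ?_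
      rw [hq, hb] at e1
      linear_combination e1
    rw [ha, hq, hb] at e2
    obtain ⟨S, hS, hx⟩ := exists_algCl_of_eval_ne ![g, q, d]
      ((9 * X 2 ^ 2 + X 0 + 3 * X 2 ^ 2) *
        yQuarticThree (18 * X 0 ^ 2 * X 1 ^ 3 - 32 * (9 * X 2 ^ 2 + X 0) * X 1 * X 2)
          (9 * X 2 ^ 2 + X 0) (X 0 * X 1) (X 2) -
        2 * (18 * X 0 ^ 2 * X 1 ^ 3 - 32 * (9 * X 2 ^ 2 + X 0) * X 1 * X 2 +
          2 * (X 0 * X 1) * X 2) *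
        yQuarticFour (18 * X 0 ^ 2 * X 1 ^ 3 - 32 * (9 * X 2 ^ 2 + X 0) * X 1 * X 2)
          (9 * X 2 ^ 2 + X 0) (X 0 * X 1) (X 2)) ![1, 1, 1]
      (by simp [yQuarticThree, yQuarticFour]; norm_num)
      (by simpa [yQuarticThree, yQuarticFour] using e2)
    have hgm : g ∈ algCl (S : Set K) := hx 0
    have hqm : q ∈ algCl (S : Set K) := hx 1
    have hdm : d ∈ algCl (S : Set K) := hx 2
    have hbm : b ∈ algCl (S : Set K) := by
      rw [hb]; exact add_mem (mul_mem (ofNat_mem _ _) (pow_mem hdm _)) hgm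
    refine h.yForm_dimLE S hS ?_ hbm ?_ hdm
    · rw [ha, ← hb]
      exact sub_mem (mul_mem (mul_mem (ofNat_mem _ _) (pow_mem hgm _)) (pow_mem hqm _))
        (mul_mem (mul_mem (mul_mem (ofNat_mem _ _) hbm) hqm) hdm)
    · rw [hq]; exact mul_mem hgm hqm

end IsPt

/-- The normal form of a septimic with `ψ = ψ₀ x²`, `v 7 = 0` and `v 6 ≠ 0`. -/
def sForm {B : Type} [CommRing B] (a b c : B) : Fin 8 → B :=
  ![a, -3 * b * c, -15 * c ^ 2, b, 3 * c, 0, 1, 0]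

/-- The normal form of a septimic with `ψ = ψ₀ x²`, `v 7 = v 6 = 0` and `v 5 ≠ 0`. -/
def rForm {B : Type} [CommRing B] (a b : B) : Fin 8 → B := ![a, b, 0, 0, 0, 1, 0, 0]

section SValues
variable {B : Type} [CommRing B] (a b c : B)

theorem psiT_sForm : psiT (sForm a b c) 1 = 0 ∧ psiT (sForm a b c) 2 = 0 := by
  refine ⟨?_, ?_⟩ <;> simp [psiT, sForm] <;> ring

theorem kT_sForm : kT (sForm a b c) 3 = 30 * (b * c) ∧ kT (sForm a b c) 4 = 240 * c ^ 2 ∧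
    kT (sForm a b c) 5 = -30 * b ∧ kT (sForm a b c) 6 = -240 * c := by
  refine ⟨?_, ?_, ?_, ?_⟩ <;> simp [kT, sForm] <;> ring

theorem hT_sForm : hT (sForm a b c) 9 = 0 ∧ hT (sForm a b c) 10 = -252 := by
  refine ⟨?_, ?_⟩ <;> simp [hT, sForm]

theorem iT_sForm : iT (sForm a b c) 3 = 1080 * (a * b + 5 * b ^ 3 + 285 * b * c ^ 3) ∧
    iT (sForm a b c) 4 = 1440 * (-4 * a * c - 5 * b ^ 2 * c - 180 * c ^ 4) := by
  refine ⟨?_, ?_⟩ <;> simp [iT, sextic4, kT, sForm] <;> ring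

theorem psiT_rForm : psiT (rForm a b) 1 = 0 ∧ psiT (rForm a b) 2 = 0 := by
  refine ⟨?_, ?_⟩ <;> simp [psiT, rForm]

theorem kT_rForm : kT (rForm a b) 6 = 60 := by
  simp [kT, rForm]

theorem iT_rForm : iT (rForm a b) 2 = 0 ∧ iT (rForm a b) 3 = 1800 * a := by
  refine ⟨?_, ?_⟩ <;> simp [iT, sextic4, kT, rForm] <;> ring

end SValues

namespace IsPt
variable {K : Type} [Field K] [Algebra ℂ K] {P : Ideal (invariantRing 7)} {a b c : K}

theorem sForm_mem_algCl {S : Set K} (ha : a ∈ algCl S) (hb : b ∈ algCl S) (hc : c ∈ algCl S)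
    (i : Fin 8) : sForm a b c i ∈ algCl S := by
  fin_cases i <;> simp only [sForm, Fin.zero_eta, Fin.mk_one, Fin.reduceFinMk, Matrix.cons_val] <;>
  repeat' first
    | exact ha | exact hb | exact hc | apply mul_mem | apply neg_mem | apply pow_mem
    | exact ofNat_mem _ _ | exact zero_mem _ | exact one_mem _

theorem rForm_mem_algCl {S : Set K} (ha : a ∈ algCl S) (hb : b ∈ algCl S) (i : Fin 8) :
    rForm a b i ∈ algCl S := by
  fin_cases i <;> simp only [rForm, Fin.zero_eta, Fin.mk_one, Fin.reduceFinMk, Matrix.cons_val] <;>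
  first
    | exact ha | exact hb | exact zero_mem _ | exact one_mem _

section SForm
variable (h : IsPt P (sForm a b c)) (h0 : psiT (sForm a b c) 0 ≠ 0)
include h

theorem sForm_dimLE_two (hz : b = 0 ∨ c = 0) : DimLE P 2 := by
  classical
  rcases hz with rfl | rfl
  · exact DimLE.of_ev h {a, c} Finset.card_le_two fun i =>
      sForm_mem_algCl (subset_algCl (by simp)) (zero_mem _) (subset_algCl (by simp)) i
  · exact DimLE.of_ev h {a, b} Finset.card_le_two fun i =>
      sForm_mem_algCl (subset_algCl (by simp)) (subset_algCl (by simp)) (zero_mem _) i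

include h0

theorem sForm_of_inv8 (h8 : inv8.toInv ∈ P) : c = 0 := by
  have := charZero_of_algebra_complex K
  obtain ⟨p1, p2⟩ := psiT_sForm a b c
  have e := (h _).1 h8
  rw [ev_inv8 p1 p2, (kT_sForm a b c).2.2.2] at e
  simpa [h0] using e

theorem sForm_false_of_inv12 (h12 : inv12.toInv ∈ P) : False := by
  have := charZero_of_algebra_complex K
  obtain ⟨p1, p2⟩ := psiT_sForm a b c
  have e := (h _).1 h12
  rw [ev_inv12 p1 p2, (hT_sForm a b c).2] at e
  simp [h0] at e

theorem sForm_of_inv18hk (h18 : inv18hk.toInv ∈ P) : b = 0 := by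
  have := charZero_of_algebra_complex K
  obtain ⟨p1, p2⟩ := psiT_sForm a b c
  obtain ⟨k3, k4, k5, k6⟩ := kT_sForm a b c
  obtain ⟨h9, h10⟩ := hT_sForm a b c
  have e := (h _).1 h18
  rw [ev_inv18hk p1 p2, h9, h10, k5, k6] at e
  have e := (mul_eq_zero.1 e).resolve_left (pow_ne_zero _ h0)
  linear_combination e / 7560

theorem sForm_dimLE_two_of_inv14ki (h14 : inv14ki.toInv ∈ P) : DimLE P 2 := by
  have := charZero_of_algebra_complex K
  obtain ⟨p1, p2⟩ := psiT_sForm a b c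
  obtain ⟨k3, k4, k5, k6⟩ := kT_sForm a b c
  obtain ⟨i3, i4⟩ := iT_sForm a b c
  have e := (h _).1 h14
  rw [ev_inv14ki p1 p2, i3, i4, k5, k6] at e
  have e := (mul_eq_zero.1 e).resolve_left (pow_ne_zero _ h0)
  obtain ⟨S, hS, hx⟩ := exists_algCl_of_eval_ne ![a, b, c]
    (-240 * X 2 * (1080 * (X 0 * X 1 + 5 * X 1 ^ 3 + 285 * X 1 * X 2 ^ 3)) -
      -30 * X 1 * (1440 * (-4 * X 0 * X 2 - 5 * X 1 ^ 2 * X 2 - 180 * X 2 ^ 4))) ![1, 1, 1]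
    (by simp; norm_num) (by simpa using e)
  exact DimLE.of_ev h S hS fun i => sForm_mem_algCl (hx 0) (hx 1) (hx 2) i

theorem sForm_dimLE_one_of_eight (h8 : inv8.toInv ∈ P) (h18 : inv18hk.toInv ∈ P) :
    DimLE P 1 := by
  have hc := h.sForm_of_inv8 h0 h8
  have hb := h.sForm_of_inv18hk h0 h18
  refine DimLE.of_ev h {a} (by simp) fun i => sForm_mem_algCl (subset_algCl (by simp)) ?_ ?_ i
  · rw [hb]; exact zero_mem _
  · rw [hc]; exact zero_mem _

end SForm

section RForm
variable (h : IsPt P (rForm a b)) (h0 : psiT (rForm a b) 0 ≠ 0)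
include h

theorem rForm_dimLE_two : DimLE P 2 := by
  classical
  exact DimLE.of_ev h {a, b} Finset.card_le_two fun i =>
    rForm_mem_algCl (subset_algCl (by simp)) (subset_algCl (by simp)) i

include h0

theorem rForm_false_of_inv8 (h8 : inv8.toInv ∈ P) : False := by
  have := charZero_of_algebra_complex K
  obtain ⟨p1, p2⟩ := psiT_rForm a b
  have e := (h _).1 h8
  rw [ev_inv8 p1 p2, kT_rForm] at e
  simp [h0] at e

theorem rForm_dimLE_one_of_inv12ii (h12 : inv12ii.toInv ∈ P) : DimLE P 1 := by
  have := charZero_of_algebra_complex K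
  obtain ⟨p1, p2⟩ := psiT_rForm a b
  obtain ⟨i2, i3⟩ := iT_rForm a b
  have e := (h _).1 h12
  rw [ev_inv12ii p1 p2, i2, i3] at e
  have ha : a = 0 := by simpa [h0] using e
  refine DimLE.of_ev h {b} (by simp) fun i => rForm_mem_algCl ?_ (subset_algCl (by simp)) i
  rw [ha]; exact zero_mem _

end RForm

variable {v : Fin 8 → K}

theorem exists_form [IsAlgClosed K] (h : IsPt P v) (h4 : inv4.toInv ∈ P) :
    irr ≤ P ∨ (∃ w : Fin 8 → K, IsPt P w ∧ psiT w 1 = 0 ∧ psiT w 2 = 0 ∧ psiT w 0 = 0) ∨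
      (∃ a b c d : K, IsPt P (yForm a b c d) ∧ psiT (yForm a b c d) 0 ≠ 0) ∨
      (∃ a b c : K, IsPt P (sForm a b c) ∧ psiT (sForm a b c) 0 ≠ 0) ∨
      ∃ a b : K, IsPt P (rForm a b) ∧ psiT (rForm a b) 0 ≠ 0 := by
  have := charZero_of_algebra_complex K
  obtain ⟨u, hu, u1, u2⟩ := h.exists_psi h4
  by_cases u0 : psiT u 0 = 0
  · exact Or.inr (Or.inl ⟨u, hu, u1, u2, u0⟩)
  rcases hu.exists_normal u1 u2 u0 with hP | ⟨w, hw, w1, w2, w0, ⟨e7, e6⟩ | ⟨e7, e6, e5⟩ |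
    ⟨e7, e6, e5, e4⟩⟩
  · exact Or.inl hP
  · refine Or.inr (Or.inr (Or.inl ⟨w 2, w 3, w 4, w 5, ?_⟩))
    have a1 : w 1 = 10 * w 4 ^ 2 - 15 * w 3 * w 5 := by
      simp only [psiT, e7, e6] at w2
      linear_combination w2 / 2
    have a0 : w 0 = 5 * w 3 * w 4 - 9 * w 2 * w 5 := by
      simp only [psiT, e7, e6] at w1
      linear_combination w1
    have : w = yForm (w 2) (w 3) (w 4) (w 5) := by
      funext i
      fin_cases i <;> simp [yForm, a0, a1, e6, e7]
    exact this ▸ ⟨hw, w0⟩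
  · refine Or.inr (Or.inr (Or.inr (Or.inl ⟨w 0, w 3, w 4 / 3, ?_⟩)))
    have a2 : w 2 = -15 * (w 4 / 3) ^ 2 := by
      simp only [psiT, e7, e6, e5] at w2
      linear_combination (-1 / 12 : K) * w2
    have a1 : w 1 = -3 * w 3 * (w 4 / 3) := by
      simp only [psiT, e7, e6, e5] at w1
      linear_combination (-1 / 5 : K) * w1
    have : w = sForm (w 0) (w 3) (w 4 / 3) := by
      funext i
      fin_cases i <;> simp [sForm, a1, a2, e5, e6, e7]
      ring
    exact this ▸ ⟨hw, w0⟩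
  · refine Or.inr (Or.inr (Or.inr (Or.inr ⟨w 0, w 1, ?_⟩)))
    have a3 : w 3 = 0 := by
      simp only [psiT, e7, e6, e5, e4] at w2
      linear_combination w2 / 30
    have a2 : w 2 = 0 := by
      simp only [psiT, e7, e6, e5, e4] at w1
      linear_combination w1 / 9
    have : w = rForm (w 0) (w 1) := by
      funext i
      fin_cases i <;> simp [rForm, a2, a3, e4, e5, e6, e7]
    exact this ▸ ⟨hw, w0⟩

end IsPt

/-- All invariants of degree `d` lie in `P`. -/
def Van (P : Ideal (invariantRing 7)) (d : ℕ) : Prop := ∀ x ∈ homInv d, x ∈ P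

namespace Van
variable {P : Ideal (invariantRing 7)} [P.IsPrime]

omit [P.IsPrime] in
theorem cov {d : ℕ} (h : Van P d) (c : Cov 0 0 d) : c.toInv ∈ P := h _ c.toInv_mem

theorem four_of_eight (h : Van P 8) : inv4.toInv ∈ P := by
  have := h _ (homInv_mul inv4.toInv_mem inv4.toInv_mem)
  exact (‹P.IsPrime›.mem_or_mem this).elim id id

theorem four_of_twelve (h : Van P 12) : inv4.toInv ∈ P := by
  have := h _ (homInv_mul inv4.toInv_mem (homInv_mul inv4.toInv_mem inv4.toInv_mem))
  rcases ‹P.IsPrime›.mem_or_mem this with h | h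
  · exact h
  · exact (‹P.IsPrime›.mem_or_mem h).elim id id

theorem dimLE_two_of_eight (h : Van P 8) : DimLE P 2 := by
  obtain ⟨K, _, _, _, v, hv⟩ := exists_point P
  have hv : IsPt P v := hv
  rcases hv.exists_form h.four_of_eight with hP | ⟨w, hw, w1, w2, w0⟩ | ⟨a, b, c, d, hw, w0⟩ |
    ⟨a, b, c, hw, w0⟩ | ⟨a, b, hw, w0⟩
  · exact IsPt.dimLE_of_irr_le hP
  · exact hw.zero_dimLE_two w1 w2 w0
  · exact hw.yForm_dimLE_two_of_eight w0 (h.cov _) (h.cov _)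
  · exact hw.sForm_dimLE_two (Or.inr (hw.sForm_of_inv8 w0 (h.cov _)))
  · exact hw.rForm_dimLE_two

theorem dimLE_two_of_fourteen (h4 : Van P 4) (h : Van P 14) : DimLE P 2 := by
  obtain ⟨K, _, _, _, v, hv⟩ := exists_point P
  have hv : IsPt P v := hv
  rcases hv.exists_form (h4.cov _) with hP | ⟨w, hw, w1, w2, w0⟩ | ⟨a, b, c, d, hw, w0⟩ |
    ⟨a, b, c, hw, w0⟩ | ⟨a, b, hw, w0⟩
  · exact IsPt.dimLE_of_irr_le hP
  · exact hw.zero_dimLE_two w1 w2 w0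
  · exact hw.yForm_dimLE_two_of_fourteen w0 (h.cov _) (h.cov _)
  · exact hw.sForm_dimLE_two_of_inv14ki w0 (h.cov _)
  · exact hw.rForm_dimLE_two

theorem dimLE_two_of_eighteen (h4 : Van P 4) (h : Van P 18) : DimLE P 2 := by
  obtain ⟨K, _, _, _, v, hv⟩ := exists_point P
  have hv : IsPt P v := hv
  rcases hv.exists_form (h4.cov _) with hP | ⟨w, hw, w1, w2, w0⟩ | ⟨a, b, c, d, hw, w0⟩ |
    ⟨a, b, c, hw, w0⟩ | ⟨a, b, hw, w0⟩
  · exact IsPt.dimLE_of_irr_le hP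
  · exact hw.zero_dimLE_two w1 w2 w0
  · exact hw.yForm_dimLE_two_of_eighteen w0 (h.cov _) (h.cov _)
  · exact hw.sForm_dimLE_two (Or.inl (hw.sForm_of_inv18hk w0 (h.cov _)))
  · exact hw.rForm_dimLE_two

theorem dimLE_one_of_twelve (h : Van P 12) : DimLE P 1 := by
  obtain ⟨K, _, _, _, v, hv⟩ := exists_point P
  have hv : IsPt P v := hv
  rcases hv.exists_form h.four_of_twelve with hP | ⟨w, hw, w1, w2, w0⟩ | ⟨a, b, c, d, hw, w0⟩ |
    ⟨a, b, c, hw, w0⟩ | ⟨a, b, hw, w0⟩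
  · exact IsPt.dimLE_of_irr_le hP
  · exact hw.zero_dimLE_one_of_inv12c w1 w2 w0 (h.cov _)
  · exact hw.yForm_dimLE_one_of_twelve w0 (h.cov _) (h.cov _) (h.cov _)
  · exact (hw.sForm_false_of_inv12 w0 (h.cov _)).elim
  · exact hw.rForm_dimLE_one_of_inv12ii w0 (h.cov _)

theorem dimLE_one_of_eighteen (h : Van P 8) (h18 : Van P 18) (hq : Van P 20 ∨ Van P 30) :
    DimLE P 1 := by
  obtain ⟨K, _, _, _, v, hv⟩ := exists_point P
  have hv : IsPt P v := hv
  rcases hv.exists_form h.four_of_eight with hP | ⟨w, hw, w1, w2, w0⟩ | ⟨a, b, c, d, hw, w0⟩ |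
    ⟨a, b, c, hw, w0⟩ | ⟨a, b, hw, w0⟩
  · exact IsPt.dimLE_of_irr_le hP
  · rcases hq with hq | hq
    · exact hw.zero_dimLE_one_of_inv20 w1 w2 w0 (hq.cov _)
    · exact hw.zero_dimLE_one_of_inv30 w1 w2 w0 (hq.cov _)
  · exact hw.yForm_dimLE_one_of_eight w0 (h.cov _) (h.cov _) (h18.cov _)
  · exact hw.sForm_dimLE_one_of_eight w0 (h.cov _) (h18.cov _)
  · exact (hw.rForm_false_of_inv8 w0 (h.cov _)).elim

theorem irr_le (h : Van P 8) (h12 : Van P 12) (hq : Van P 20 ∨ Van P 30) : irr ≤ P := by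
  obtain ⟨K, _, _, _, v, hv⟩ := exists_point P
  have hv : IsPt P v := hv
  rcases hv.exists_form h.four_of_eight with hP | ⟨w, hw, w1, w2, w0⟩ | ⟨a, b, c, d, hw, w0⟩ |
    ⟨a, b, c, hw, w0⟩ | ⟨a, b, hw, w0⟩
  · exact hP
  · exact hw.zero_irr_le w1 w2 w0 (h12.cov _) (hq.imp (fun q => q.cov _) fun q => q.cov _)
  · exact (hw.yForm_false_of_zero w0 (h.cov _) (h.cov _) (hw.yForm_of_inv12 w0 (h12.cov _))).elim
  · exact (hw.sForm_false_of_inv12 w0 (h12.cov _)).elim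
  · exact (hw.rForm_false_of_inv8 w0 (h.cov _)).elim

end Van

theorem inv4_ne_zero : inv4.toInv ≠ 0 := by
  intro h
  have e := ev_inv4 (![0, 0, 1, 0, 1, 0, 0, 0] : Fin 8 → ℂ)
  rw [h, map_zero] at e
  simp [psiT] at e

namespace Van
variable {P : Ideal (invariantRing 7)} [P.IsPrime]

theorem or_of_add {a b : ℕ} (h : Van P (a + b)) : Van P a ∨ Van P b := by
  by_contra! hc
  simp only [Van, not_forall] at hc
  obtain ⟨⟨x, hx, hxP⟩, y, hy, hyP⟩ := hc
  exact (‹P.IsPrime›.mem_or_mem (h _ (homInv_mul hx hy))).elim hxP hyP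

theorem of_mul {a : ℕ} (n : ℕ) (h : Van P ((n + 1) * a)) : Van P a := by
  induction n with
  | zero => simpa using h
  | succ n ih =>
    rw [add_mul, one_mul] at h
    exact h.or_of_add.elim ih id

omit [P.IsPrime] in
theorem four_of_inv4 (h : inv4.toInv ∈ P) : Van P 4 := by
  intro x hx
  by_cases h0 : inv4.toInv = 0
  · exact absurd h0 inv4_ne_zero
  · obtain ⟨c, rfl⟩ := homInv_four inv4.toInv_mem hx h0
    rw [Algebra.smul_def]
    exact P.mul_mem_left _ h

theorem dimLE_zero_of_many (h : Van P 120) : DimLE P 0 :=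
  IsPt.dimLE_zero_of_irr_le (irr_le (h.of_mul 14) (h.of_mul 9) (Or.inl (h.of_mul 5)))

theorem dimLE_three {d : ℕ} (hd : 0 < d)
    (H : ∀ Q : Ideal (invariantRing 7), Q.IsPrime → Van Q 4 → Van Q d → DimLE Q 2)
    (h : Van P d) : DimLE P 3 := by
  classical
  have := invariantRing_isNoetherianRing
  obtain ⟨p, hp, hP0⟩ := exists_selection 2 (insert inv4.toInv (homInv d : Set (invariantRing 7)))
    (fun _ => homInv 120) (by
      intro J Q hQ hJ0 hJ
      rcases J.eq_empty_or_nonempty with rfl | ⟨j, hj⟩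
      · exact H Q hQ (four_of_inv4 (hJ0 (Set.mem_insert _ _)))
          fun x hx => hJ0 (Set.mem_insert_of_mem _ hx)
      · exact (dimLE_zero_of_many (hJ j hj)).mono (Nat.zero_le _))
  obtain ⟨G, hG, hspan⟩ := (Submodule.fg_span_iff_fg_span_finset_subset
    (R := invariantRing 7) (homInv d : Set (invariantRing 7))).1 (IsNoetherian.noetherian _)
  let F : Finset (invariantRing 7) := insert inv4.toInv (insert (p 0) (insert (p 1) G))
  have hF : ∀ g ∈ F, g = inv4.toInv ∨ g = p 0 ∨ g = p 1 ∨ g ∈ G := fun g hg => by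
    simpa [F] using hg
  have hdeg : ∀ g : F, ∃ e, 0 < e ∧ g.1 ∈ homInv e := by
    rintro ⟨g, hg⟩
    rcases hF g hg with rfl | rfl | rfl | hg
    · exact ⟨4, by norm_num, inv4.toInv_mem⟩
    · exact ⟨120, by norm_num, hp 0⟩
    · exact ⟨120, by norm_num, hp 1⟩
    · exact ⟨d, hd, hG hg⟩
  choose e he0 he using hdeg
  have key : ∀ Q : Ideal (invariantRing 7), Q.IsPrime → (F : Set (invariantRing 7)) ⊆ Q →
      DimLE Q 0 := by
    intro Q hQ hFQ
    refine hP0 Q hQ ?_ fun i => ?_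
    · refine Set.insert_subset (hFQ (by simp [F])) fun x hx => ?_
      have hx : x ∈ Submodule.span (invariantRing 7) (homInv d : Set (invariantRing 7)) :=
        Submodule.subset_span hx
      rw [hspan] at hx
      exact Submodule.span_le.2 (fun g hg => hFQ (by simp [F, Finset.mem_coe.1 hg])) hx
    · fin_cases i
      · exact hFQ (by simp [F])
      · exact hFQ (by simp [F])
  have hfin := finite_of_irr_le he0 he fun Q hQ hFQ =>
    irr_le_of_dimLE_zero (G := F) (fun g hg => ⟨_, he ⟨g, hg⟩⟩) key Q fun g hg => hFQ ⟨g, hg⟩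
  obtain ⟨K, _, _, _, v, hv⟩ := exists_point P
  refine DimLE.of_finset (ev v) (fun x hx => (hv x).2 hx)
    {ev v inv4.toInv, ev v (p 0), ev v (p 1)} Finset.card_le_three
    (mem_algCl_of_finite hfin (ev v) ?_)
  rintro _ ⟨⟨g, hg⟩, rfl⟩
  rcases hF g hg with rfl | rfl | rfl | hg
  · exact subset_algCl (by simp)
  · exact subset_algCl (by simp)
  · exact subset_algCl (by simp)
  · rw [(hv g).1 (h g (hG hg))]
    exact zero_mem _

theorem dimLE_three_of_fourteen (h : Van P 14) : DimLE P 3 :=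
  dimLE_three (by norm_num) (fun _ _ h4 => dimLE_two_of_fourteen h4) h

theorem dimLE_three_of_eighteen (h : Van P 18) : DimLE P 3 :=
  dimLE_three (by norm_num) (fun _ _ h4 => dimLE_two_of_eighteen h4) h

end Van

theorem dimLE_five (P : Ideal (invariantRing 7)) [P.IsPrime] : DimLE P 5 := by
  obtain ⟨K, _, _, _, v, hv⟩ := exists_point P
  exact IsPt.dimLE_five (v := v) hv

theorem dimLE_four {P : Ideal (invariantRing 7)} [P.IsPrime] (h : P ≠ ⊥) : DimLE P 4 :=
  DimLE.of_lt (bot_lt_iff_ne_bot.2 h) (dimLE_five ⊥)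

section KerEv
variable {B : Type} [CommRing B] [Algebra ℂ B] {C : Type} [CommRing C] [Algebra ℂ C]

/-- The ideal of invariants vanishing on a family of septimics. -/
def kerEv (v : Fin 8 → B) : Ideal (invariantRing 7) := RingHom.ker (ev v)

theorem mem_kerEv {v : Fin 8 → B} {p : invariantRing 7} : p ∈ kerEv v ↔ ev v p = 0 :=
  RingHom.mem_ker

instance kerEv_isPrime [IsDomain B] (v : Fin 8 → B) : (kerEv v).IsPrime :=
  RingHom.ker_isPrime _

theorem kerEv_le (φ : B →ₐ[ℂ] C) {v : Fin 8 → B} {w : Fin 8 → C} (h : ∀ i, φ (v i) = w i) :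
    kerEv v ≤ kerEv w := by
  intro p hp
  rw [mem_kerEv] at hp ⊢
  have := map_ev φ v p
  rw [hp, map_zero, funext h] at this
  exact this.symm

theorem notMem_kerEv (φ : B →ₐ[ℂ] C) {v : Fin 8 → B} {w : Fin 8 → C} (h : ∀ i, φ (v i) = w i)
    {p : invariantRing 7} (hp : ev w p ≠ 0) : p ∉ kerEv v := fun hv =>
  hp (mem_kerEv.1 (kerEv_le φ h hv))

theorem not_dimLE_zero {P Q : Ideal (invariantRing 7)} [P.IsPrime] [Q.IsPrime] (hPQ : P ≤ Q)
    {p : invariantRing 7} (hp : p ∉ P) (hq : p ∈ Q) : ¬ DimLE P 0 := fun h =>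
  h.not_lt (lt_of_le_of_ne hPQ fun e => hp (e ▸ hq))

theorem not_dimLE_succ {P Q : Ideal (invariantRing 7)} [P.IsPrime] [Q.IsPrime] (hPQ : P ≤ Q)
    {p : invariantRing 7} (hp : p ∉ P) (hq : p ∈ Q) {k : ℕ} (h : ¬ DimLE Q k) :
    ¬ DimLE P (k + 1) := fun hP =>
  h (DimLE.of_lt (lt_of_le_of_ne hPQ fun e => hp (e ▸ hq)) hP)

end KerEv

theorem kerEv_le_irr (v : Fin 8 → ℂ) (hv : ∀ i : Fin 8, (i : ℕ) < 4 → v i = 0) :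
    kerEv v ≤ irr := by
  have h1 : irr ≤ kerEv v := IsPt.irr_le_of_lower (v := v) (fun _ => mem_kerEv) hv
  have := irr_isPrime
  rcases h1.eq_or_lt with h | h
  · exact h.ge
  · exact absurd h (DimLE.not_lt (IsPt.dimLE_zero_of_irr_le le_rfl))

theorem ev_eq_zero_of_weights {m : ℕ} {r : ℤ} (hm : m ≠ 0) (hr : IsCoprime (m : ℤ) r)
    {v : Fin 8 → ℂ} (hv : ∀ i : Fin 8, v i = 0 ∨ (m : ℤ) ∣ (7 - 2 * ((i : ℕ) : ℤ)) - r)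
    {d : ℕ} (hd : ¬ m ∣ d) {p : invariantRing 7} (hp : p ∈ homInv d) : ev v p = 0 := by
  have hζ := Complex.isPrimitiveRoot_exp m hm
  set ζ := Complex.exp (2 * Real.pi * Complex.I / m)
  have h0 : ζ ≠ 0 := hζ.ne_zero hm
  have h1 := ev_torus h0 v p
  have h2 : (fun i : Fin 8 => ζ ^ (7 - 2 * ((i : ℕ) : ℤ)) * v i) = fun i => ζ ^ r * v i := by
    funext i
    rcases hv i with h | ⟨k, hk⟩
    · simp [h]
    · rw [show (7 - 2 * ((i : ℕ) : ℤ)) = r + m * k by linarith, zpow_add₀ h0, zpow_mul,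
        zpow_natCast,
        hζ.pow_eq_one, one_zpow, mul_one]
  rw [h2, ev_homInv_smul hp] at h1
  by_contra hne
  apply hd
  have h3 : (ζ ^ r) ^ d = 1 := mul_right_cancel₀ hne (by rw [h1, one_mul])
  rw [← zpow_natCast, ← zpow_mul, hζ.zpow_eq_one_iff_dvd] at h3
  exact_mod_cast hr.dvd_of_dvd_mul_left h3

theorem mem_kerEv_of_weights {n m : ℕ} {r : ℤ} (hm : m ≠ 0) (hr : IsCoprime (m : ℤ) r)
    {v : Fin 8 → MvPolynomial (Fin n) ℂ}
    (hv : ∀ i : Fin 8, v i = 0 ∨ (m : ℤ) ∣ (7 - 2 * ((i : ℕ) : ℤ)) - r)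
    {d : ℕ} (hd : ¬ m ∣ d) {p : invariantRing 7} (hp : p ∈ homInv d) : p ∈ kerEv v := by
  rw [mem_kerEv]
  refine MvPolynomial.funext fun a => ?_
  have := map_ev (aeval a) v p
  rw [map_zero, ← coe_aeval_eq_eval, RingHom.coe_coe, this]
  exact ev_eq_zero_of_weights hm hr (fun i => (hv i).imp (fun h => by rw [h, map_zero]) id) hd hp

section LowerBounds

theorem yForm_map {B C : Type} [CommRing B] [Algebra ℂ B] [CommRing C] [Algebra ℂ C]
    (φ : B →ₐ[ℂ] C) {a b c d : B} {a' b' c' d' : C} (ha : φ a = a') (hb : φ b = b')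
    (hc : φ c = c') (hd : φ d = d') (i : Fin 8) :
    φ (yForm a b c d i) = yForm a' b' c' d' i := by
  have h5 : φ 5 = 5 := map_ofNat φ 5
  have h9 : φ 9 = 9 := map_ofNat φ 9
  have h10 : φ 10 = 10 := map_ofNat φ 10
  have h15 : φ 15 = 15 := map_ofNat φ 15
  fin_cases i <;> simp [yForm, ha, hb, hc, hd, h5, h9, h10, h15]

theorem kerEv_yForm_le {B C : Type} [CommRing B] [Algebra ℂ B] [CommRing C] [Algebra ℂ C]
    (φ : B →ₐ[ℂ] C) {a b c d : B} {a' b' c' d' : C} (ha : φ a = a') (hb : φ b = b')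
    (hc : φ c = c') (hd : φ d = d') :
    kerEv (yForm a b c d) ≤ kerEv (yForm a' b' c' d') :=
  kerEv_le φ (yForm_map φ ha hb hc hd)

theorem notMem_kerEv_yForm {B C : Type} [CommRing B] [Algebra ℂ B] [CommRing C] [Algebra ℂ C]
    (φ : B →ₐ[ℂ] C) {a b c d : B} {a' b' c' d' : C} (ha : φ a = a') (hb : φ b = b')
    (hc : φ c = c') (hd : φ d = d') {p : invariantRing 7} (hp : ev (yForm a' b' c' d') p ≠ 0) :
    p ∉ kerEv (yForm a b c d) :=
  notMem_kerEv φ (yForm_map φ ha hb hc hd) hp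

theorem ev_inv4_yForm {B : Type} [CommRing B] [Algebra ℂ B] (a b c d : B) :
    ev (yForm a b c d) inv4.toInv = 0 := by
  obtain ⟨-, p1, p2⟩ := psiT_yForm a b c d
  rw [ev_inv4, p1, p2]
  ring

theorem ev_inv8_yForm {B : Type} [CommRing B] [Algebra ℂ B] (a b c d : B) :
    ev (yForm a b c d) inv8.toInv = psiT (yForm a b c d) 0 ^ 3 * (20 * (b + 3 * d ^ 2)) := by
  obtain ⟨-, p1, p2⟩ := psiT_yForm a b c d
  rw [ev_inv8 p1 p2, (kT_yForm a b c d).2.2.2]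

theorem ev_inv12_yForm {B : Type} [CommRing B] [Algebra ℂ B] (a b c d : B) :
    ev (yForm a b c d) inv12.toInv = psiT (yForm a b c d) 0 ^ 5 * (252 * d) := by
  obtain ⟨-, p1, p2⟩ := psiT_yForm a b c d
  rw [ev_inv12 p1 p2, (hT_yForm a b c d).2.2.2]

theorem ev_inv12c_yForm : ev (yForm 0 0 1 0 : Fin 8 → ℂ) inv12c.toInv ≠ 0 := by
  rw [ev_inv12c]
  simp [iT, sextic4, kT, yForm]
  norm_num

theorem kerEv_yForm_one_le_irr : kerEv (yForm 0 0 (X 0) 0 :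
    Fin 8 → MvPolynomial (Fin 1) ℂ) ≤ irr := by
  refine (kerEv_yForm_le (aeval ![(0 : ℂ)]) (map_zero _) (map_zero _) (aeval_X _ _)
    (map_zero _)).trans (kerEv_le_irr _ fun i hi => ?_)
  fin_cases i <;> simp at hi <;> simp [yForm]

theorem kerEv_yForm_one_not_dimLE : ¬ DimLE (kerEv (yForm 0 0 (X 0) 0 :
    Fin 8 → MvPolynomial (Fin 1) ℂ)) 0 := by
  have := irr_isPrime
  refine not_dimLE_zero kerEv_yForm_one_le_irr (p := inv12c.toInv) ?_
    (homInv_le_irr (by norm_num) inv12c.toInv_mem)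
  refine notMem_kerEv_yForm (aeval ![(1 : ℂ)]) (a' := 0) (b' := 0) (c' := 1) (d' := 0)
      (by simp) (by simp) (by simp) (by simp) ?_
  exact ev_inv12c_yForm

theorem kerEv_yForm_two_not_dimLE : ¬ DimLE (kerEv (yForm (X 0) 0 (X 1) 0 :
    Fin 8 → MvPolynomial (Fin 2) ℂ)) 1 := by
  refine not_dimLE_succ (Q := kerEv (yForm 0 0 (X 0) 0 : Fin 8 →
      MvPolynomial (Fin 1) ℂ)) ?_ (p := inv12kk.toInv) ?_ ?_
    kerEv_yForm_one_not_dimLE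
  · exact kerEv_yForm_le (aeval ![(0 : MvPolynomial (Fin 1) ℂ),
      X 0]) (by simp) (by simp) (by simp) (by simp)
  · refine notMem_kerEv_yForm (aeval ![(1 : ℂ), 1]) (a' := 1) (b' := 0) (c' := 1) (d' := 0)
      (by simp) (by simp) (by simp) (by simp) ?_
    obtain ⟨p0, p1, p2⟩ := psiT_yForm (1 : ℂ) 0 1 0
    obtain ⟨k3, k4, k5, k6⟩ := kT_yForm (1 : ℂ) 0 1 0
    rw [ev_inv12kk p1 p2, p0, k4, k5, k6]
    norm_num
  · obtain ⟨p0, p1, p2⟩ := psiT_yForm 0 0 (X 0 : MvPolynomial (Fin 1) ℂ) 0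
    rw [mem_kerEv, ev_inv12kk p1 p2, p0]
    ring

theorem kerEv_yForm_three_not_dimLE :
    ¬ DimLE (kerEv (yForm (X 0) (-3 * X 2 ^ 2) (X 1) (X 2) : Fin 8 →
        MvPolynomial (Fin 3) ℂ)) 2 := by
  refine not_dimLE_succ (Q := kerEv (yForm (X 0) 0 (X 1) 0 : Fin 8 →
      MvPolynomial (Fin 2) ℂ)) ?_ (p := inv12.toInv) ?_ ?_
    kerEv_yForm_two_not_dimLE
  · exact kerEv_yForm_le (aeval ![(X 0 : MvPolynomial (Fin 2) ℂ), X 1,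
      0]) (by simp) (by simp) (by simp) (by simp)
  · refine notMem_kerEv_yForm (aeval ![(1 : ℂ), 1, 1]) (a' := 1) (b' := -3) (c' := 1) (d' := 1)
      (by simp) (by simp) (by simp) (by simp) ?_
    rw [ev_inv12_yForm, (psiT_yForm _ _ _ _).1]
    simp
    norm_num
  · rw [mem_kerEv, ev_inv12_yForm]
    ring

theorem kerEv_yForm_not_dimLE :
    ¬ DimLE (kerEv (yForm (X 0) (X 1) (X 2) (X 3) : Fin 8 → MvPolynomial (Fin 4) ℂ)) 3 := by
  refine not_dimLE_succ (Q := kerEv (yForm (X 0) (-3 * X 2 ^ 2) (X 1) (X 2) : Fin 8 →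
      MvPolynomial (Fin 3) ℂ)) ?_
    (p := inv8.toInv) ?_ ?_ kerEv_yForm_three_not_dimLE
  · exact kerEv_yForm_le (aeval ![(X 0 : MvPolynomial (Fin 3) ℂ), -3 * X 2 ^ 2, X 1,
      X 2]) (by simp) (by simp)
      (by simp) (by simp)
  · refine notMem_kerEv_yForm (aeval ![(1 : ℂ), 1, 1, 1]) (a' := 1) (b' := 1) (c' := 1) (d' := 1)
      (by simp) (by simp) (by simp) (by simp) ?_
    rw [ev_inv8_yForm, (psiT_yForm _ _ _ _).1]
    simp
    norm_num
  · rw [mem_kerEv, ev_inv8_yForm]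
    ring

theorem bot_not_dimLE : ¬ DimLE (⊥ : Ideal (invariantRing 7)) 4 :=
  not_dimLE_succ bot_le (p := inv4.toInv) inv4_ne_zero (mem_kerEv.2 (ev_inv4_yForm _ _ _ _))
    kerEv_yForm_not_dimLE

section Sparse

theorem sparse_four_not_dimLE :
    ¬ DimLE (kerEv (![0, X 0, 0, X 1, 0, X 2, 0, X 3] : Fin 8 → MvPolynomial (Fin 4) ℂ)) 2 := by
  have h1 : ¬ DimLE (kerEv (yForm 0 (-3 * X 0 ^ 2) 0 (X 0) : Fin 8 →
      MvPolynomial (Fin 1) ℂ)) 0 := by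
    have := irr_isPrime
    refine not_dimLE_zero (Q := irr) ?_ (p := inv12.toInv) ?_
      (homInv_le_irr (by norm_num) inv12.toInv_mem)
    · refine (kerEv_yForm_le (aeval ![(0 : ℂ)]) (a' := 0) (b' := 0) (c' := 0) (d' := 0)
        (by simp) (by simp) (by simp) (by simp)).trans (kerEv_le_irr _ fun i hi => ?_)
      fin_cases i <;> simp at hi <;> simp [yForm]
    · refine notMem_kerEv_yForm (aeval ![(1 : ℂ)]) (a' := 0) (b' := -3) (c' := 0) (d' := 1)
        (by simp) (by simp) (by simp) (by simp) ?_
      rw [ev_inv12_yForm, (psiT_yForm _ _ _ _).1]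
      simp
      norm_num
  have h2 : ¬ DimLE (kerEv (yForm 0 (X 0) 0 (X 1) : Fin 8 → MvPolynomial (Fin 2) ℂ)) 1 := by
    refine not_dimLE_succ (Q := kerEv (yForm 0 (-3 * X 0 ^ 2) 0 (X 0) : Fin 8 →
        MvPolynomial (Fin 1) ℂ)) ?_
      (p := inv8.toInv) ?_ ?_ h1
    · exact kerEv_yForm_le (aeval ![(-3 * X 0 ^ 2 : MvPolynomial (Fin 1) ℂ),
        X 0]) (by simp) (by simp) (by simp)
        (by simp)
    · refine notMem_kerEv_yForm (aeval ![(1 : ℂ), 1]) (a' := 0) (b' := 1) (c' := 0) (d' := 1)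
        (by simp) (by simp) (by simp) (by simp) ?_
      rw [ev_inv8_yForm, (psiT_yForm _ _ _ _).1]
      simp
      norm_num
    · rw [mem_kerEv, ev_inv8_yForm]
      ring
  refine not_dimLE_succ (Q := kerEv (yForm 0 (X 0) 0 (X 1) : Fin 8 → MvPolynomial (Fin 2) ℂ)) ?_
    (p := inv4.toInv) ?_ (mem_kerEv.2 (ev_inv4_yForm _ _ _ _)) h2
  · refine kerEv_le (aeval ![(-15 * X 0 * X 1 : MvPolynomial (Fin 2) ℂ), X 0, X 1, 1]) fun i => ?_
    fin_cases i <;> simp [yForm]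
  · refine notMem_kerEv (aeval ![(0 : ℂ), 1, 1, 1]) (w := ![0, 0, 0, 1, 0, 1, 0, 1]) (fun i =>
      ?_) ?_
    · fin_cases i <;> simp
    · rw [ev_inv4]
      simp [psiT]

theorem ev_inv12_sparse (a b c : ℂ) :
    ev ![0, a, 0, 0, b, 0, 0, c] inv12.toInv = (2 * a * c - 20 * b ^ 2) ^ 5 * (-252 * a ^ 2) := by
  rw [← ev_swapXY]
  have h0 : psiT (_root_.swapXY ![0, a, 0, 0, b, 0, 0, c]) 0 = 2 * a * c - 20 * b ^ 2 := by
    simp [psiT, _root_.swapXY]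
    ring
  have h1 : psiT (_root_.swapXY ![0, a, 0, 0, b, 0, 0, c]) 1 = 0 := by
    simp [psiT, _root_.swapXY]
  have h2 : psiT (_root_.swapXY ![0, a, 0, 0, b, 0, 0, c]) 2 = 0 := by
    simp [psiT, _root_.swapXY]
  have h10 : hT (_root_.swapXY ![0, a, 0, 0, b, 0, 0, c]) 10 = -252 * a ^ 2 := by
    simp [hT, _root_.swapXY]
    ring
  rw [ev_inv12 h1 h2, h0, h10]

theorem sparse_six_not_dimLE :
    ¬ DimLE (kerEv (![0, X 0, 0, 0, X 1, 0, 0, X 2] : Fin 8 → MvPolynomial (Fin 3) ℂ)) 1 := by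
  refine not_dimLE_succ (Q := kerEv (yForm 0 0 (X 0) 0 : Fin 8 →
      MvPolynomial (Fin 1) ℂ)) ?_ (p := inv12.toInv) ?_ ?_
    kerEv_yForm_one_not_dimLE
  · refine kerEv_le (aeval ![(10 * X 0 ^ 2 : MvPolynomial (Fin 1) ℂ), X 0, 1]) fun i => ?_
    fin_cases i <;> simp [yForm]
  · refine notMem_kerEv (aeval ![(1 : ℂ), 0, 1]) (w := ![0, 1, 0, 0, 0, 0, 0, 1]) (fun i => ?_) ?_
    · fin_cases i <;> simp
    · rw [ev_inv12_sparse]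
      norm_num
  · rw [mem_kerEv, ev_inv12_yForm]
    ring

theorem sparse_eight_not_dimLE :
    ¬ DimLE (kerEv (![0, X 0, 0, 0, 0, X 1, 0, 0] : Fin 8 → MvPolynomial (Fin 2) ℂ)) 0 := by
  have := irr_isPrime
  refine not_dimLE_zero (Q := irr) ?_ (p := inv8.toInv) ?_
    (homInv_le_irr (by norm_num) inv8.toInv_mem)
  · refine (kerEv_le (aeval ![(0 : ℂ), 1]) (w := ![0, 0, 0, 0, 0, 1, 0, 0]) fun i => ?_).trans
      (kerEv_le_irr _ fun i hi => ?_)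
    · fin_cases i <;> simp
    · fin_cases i <;> simp at hi <;> simp
  · refine notMem_kerEv (aeval ![(1 : ℂ), 1]) (w := rForm 0 1) (fun i => ?_) ?_
    · fin_cases i <;> simp [rForm]
    · obtain ⟨p1, p2⟩ := psiT_rForm (0 : ℂ) 1
      rw [ev_inv8 p1 p2, kT_rForm]
      simp [psiT, rForm]

theorem sparse_ten_not_dimLE :
    ¬ DimLE (kerEv (![0, 0, X 0, 0, 0, 0, 0, X 1] : Fin 8 → MvPolynomial (Fin 2) ℂ)) 0 := by
  have := irr_isPrime
  refine not_dimLE_zero (Q := irr) ?_ (p := inv20.toInv) ?_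
    (homInv_le_irr (by norm_num) inv20.toInv_mem)
  · refine (kerEv_le (aeval ![(0 : ℂ), 1]) (w := ![0, 0, 0, 0, 0, 0, 0, 1]) fun i => ?_).trans
      (kerEv_le_irr _ fun i hi => ?_)
    · fin_cases i <;> simp
    · fin_cases i <;> simp at hi <;> simp
  · refine notMem_kerEv (aeval ![(1 : ℂ), 1]) (w := twoForm 1) (fun i => ?_) ?_
    · fin_cases i <;> simp [twoForm]
    · rw [ev_inv20_twoForm]
      norm_num

theorem sparse_twelve_not_dimLE :
    ¬ DimLE (kerEv (![0, X 0, 0, 0, 0, 0, 0, X 1] : Fin 8 → MvPolynomial (Fin 2) ℂ)) 0 := by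
  have := irr_isPrime
  refine not_dimLE_zero (Q := irr) ?_ (p := inv12.toInv) ?_
    (homInv_le_irr (by norm_num) inv12.toInv_mem)
  · refine (kerEv_le (aeval ![(0 : ℂ), 1]) (w := ![0, 0, 0, 0, 0, 0, 0, 1]) fun i => ?_).trans
      (kerEv_le_irr _ fun i hi => ?_)
    · fin_cases i <;> simp
    · fin_cases i <;> simp at hi <;> simp
  · refine notMem_kerEv (aeval ![(1 : ℂ), 1]) (w := ![0, 1, 0, 0, 0, 0, 0, 1]) (fun i => ?_) ?_
    · fin_cases i <;> simp
    · rw [ev_inv12_sparse]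
      norm_num

end Sparse

end LowerBounds

/-- The icosahedral pencil of binary septimics. -/
def uForm {B : Type} [CommRing B] (a b : B) : Fin 8 → B := ![3 * a, 0, b, 0, 0, -a, 0, 3 * b]

theorem uForm_map {B C : Type} [CommRing B] [Algebra ℂ B] [CommRing C] [Algebra ℂ C]
    (φ : B →ₐ[ℂ] C) (a b : B) (i : Fin 8) : φ (uForm a b i) = uForm (φ a) (φ b) i := by
  have h3 : φ 3 = 3 := map_ofNat φ 3
  fin_cases i <;> simp [uForm, h3]

section Icosahedral
variable {a b : ℂ} (r : invariantRing 7)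

theorem ev_uForm_swap (a b : ℂ) : ev (uForm (-b) a) r = ev (uForm a b) r := by
  rw [← ev_swapXY (uForm a b)]
  congr 2
  funext i
  fin_cases i <;> simp [uForm, _root_.swapXY]

theorem ev_uForm_rotate {ζ : ℂ} (hζ : ζ ^ 5 = 1) (a b : ℂ) :
    ev (uForm (ζ ^ 2 * a) (ζ ^ 3 * b)) r = ev (uForm a b) r := by
  have h0 : ζ ≠ 0 := fun h => by simp [h] at hζ
  rw [← ev_torus h0 (uForm a b)]
  congr 2
  have h2 : ζ ^ (-3 : ℤ) = ζ ^ 2 := by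
    rw [zpow_neg]
    exact inv_eq_of_mul_eq_one_right (by norm_cast; rw [← pow_add, hζ])
  have h3 : ζ ^ (-7 : ℤ) = ζ ^ 3 := by
    rw [zpow_neg]
    refine inv_eq_of_mul_eq_one_right ?_
    norm_cast
    rw [← pow_add, show 7 + 3 = 5 * 2 by norm_num, pow_mul, hζ, one_pow]
  have h7 : ζ ^ (7 : ℤ) = ζ ^ 2 := by
    norm_cast
    rw [show 7 = 5 + 2 by norm_num, pow_add, hζ, one_mul]
  have h3' : ζ ^ (3 : ℤ) = ζ ^ 3 := by norm_cast
  have key : ∀ i : Fin 8, ∀ w : ℤ, 7 - 2 * ((i : ℕ) : ℤ) = w →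
      uForm (ζ ^ 2 * a) (ζ ^ 3 * b) i = ζ ^ w * uForm a b i →
      uForm (ζ ^ 2 * a) (ζ ^ 3 * b) i = ζ ^ (7 - 2 * ((i : ℕ) : ℤ)) * uForm a b i := by
    rintro i w rfl h
    exact h
  funext i
  fin_cases i
  · refine key 0 7 (by norm_num) ?_
    rw [h7]
    simp [uForm]
    ring
  · simp [uForm]
  · refine key 2 3 (by norm_num) ?_
    rw [h3']
    simp [uForm]
  · simp [uForm]
  · simp [uForm]
  · refine key 5 (-3) (by norm_num) ?_
    rw [h2]
    simp [uForm]
  · simp [uForm]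
  · refine key 7 (-7) (by norm_num) ?_
    rw [h3]
    simp [uForm]
    ring

theorem uForm_reflect_identity {u : ℂ} (hu : u ^ 2 = u + 1) (a b x y : ℂ) :
    a * ((x + u * y) ^ 7 - 7 * (x + u * y) ^ 2 * (u * x - y) ^ 5) +
      b * (7 * (x + u * y) ^ 5 * (u * x - y) ^ 2 + (u * x - y) ^ 7) =
    -(u + 2) ^ 3 * ((u * a - b) * (x ^ 7 - 7 * x ^ 2 * y ^ 5) -
      (a + u * b) * (7 * x ^ 5 * y ^ 2 + y ^ 7)) := by
  have h3 : u ^ 3 = 2 * u + 1 := by linear_combination (u + 1) * hu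
  have h4 : u ^ 4 = 3 * u + 2 := by linear_combination u * h3 + 2 * hu
  have h5 : u ^ 5 = 5 * u + 3 := by linear_combination u * h4 + 3 * hu
  have h6 : u ^ 6 = 8 * u + 5 := by linear_combination u * h5 + 5 * hu
  have h7 : u ^ 7 = 13 * u + 8 := by linear_combination u * h6 + 8 * hu
  ring_nf
  simp only [hu, h3, h4, h5, h6, h7]
  ring

theorem ev_uForm_reflect {u p : ℂ} (hu : u ^ 2 = u + 1) (hp : p ^ 2 * (u + 2) = -1) (a b : ℂ) :
    ev (uForm (p * (u * a - b)) (-(p * (a + u * b)))) r = ev (uForm a b) r := by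
  have h := r.2 ⟨!![p, p * u; p * u, -p], by
    rw [Matrix.det_fin_two_of]; linear_combination -hp - p ^ 2 * hu⟩ (nrm (uForm a b))
  rw [ev_apply, ev_apply, aeval_eq_eval, aeval_eq_eval]
  refine Eq.trans ?_ h
  congr 2
  refine (sl2Act_eq_of_formVal fun x y => ?_).symm
  simp [formVal, Fin.sum_univ_eight, nrm, uForm, Nat.choose]
  linear_combination (-3 * p ^ 7) * uForm_reflect_identity hu a b x y +
    3 * p * ((p ^ 2 * (u + 2)) ^ 2 - p ^ 2 * (u + 2) + 1) *
      ((u * a - b) * (x ^ 7 - 7 * x ^ 2 * y ^ 5) - (a + u * b) * (7 * x ^ 5 * y ^ 2 + y ^ 7)) * hp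

/-- The restriction of an invariant to the icosahedral pencil. -/
def uPoly : Polynomial ℂ := ev (uForm 1 Polynomial.X) r

theorem eval_uPoly (z : ℂ) : (uPoly r).eval z = ev (uForm 1 z) r := by
  rw [← Polynomial.coe_aeval_eq_eval, uPoly, map_ev]
  congr 2
  funext i
  rw [uForm_map, map_one, Polynomial.aeval_X]

variable {r} {e : ℕ} (hr : r ∈ homInv (2 * e))
include hr

theorem ev_uForm_smul (c : ℂ) : ev (uForm (c * a) (c * b)) r = c ^ (2 * e) * ev (uForm a b) r := by
  rw [← ev_homInv_smul hr]
  congr 2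
  funext i
  fin_cases i <;> simp [uForm] <;> ring

theorem ev_uForm (ha : a ≠ 0) : ev (uForm a b) r = a ^ (2 * e) * (uPoly r).eval (b / a) := by
  rw [eval_uPoly, ← ev_uForm_smul hr, mul_one, mul_div_cancel₀ _ ha]

theorem uPoly_natDegree_le : (uPoly r).natDegree ≤ 2 * e := by
  have h : (r : MvPolynomial (Fin 8) ℂ).totalDegree ≤ 2 * e := IsHomogeneous.totalDegree_le hr
  have := MvPolynomial.aeval_natDegree_le (r : MvPolynomial (Fin 8) ℂ) h
    (nrm (uForm 1 Polynomial.X)) (n := 1) (fun i => by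
      rw [nrm]
      refine (Polynomial.natDegree_mul_le).trans ?_
      rw [Polynomial.natDegree_natCast, zero_add]
      fin_cases i <;> simp [uForm])
  rwa [mul_one] at this

theorem eval_uPoly_rotate {ζ : ℂ} (hζ : ζ ^ 5 = 1) (z : ℂ) :
    (uPoly r).eval (ζ * z) = ζ ^ e * (uPoly r).eval z := by
  have h0 : ζ ≠ 0 := fun h => by simp [h] at hζ
  have h := ev_uForm_rotate r hζ 1 z
  rw [mul_one, ev_uForm hr (pow_ne_zero 2 h0), ← eval_uPoly,
    show ζ ^ 3 * z / ζ ^ 2 = ζ * z by field_simp] at h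
  rw [← h, ← mul_assoc, ← pow_mul, ← pow_add, show e + 2 * (2 * e) = 5 * e by ring, pow_mul, hζ,
    one_pow, one_mul]

end Icosahedral

section Icosahedral
variable {r : invariantRing 7} {e : ℕ} (hr : r ∈ homInv (2 * e))
include hr

theorem uPoly_comp_rotate {ζ : ℂ} (hζ : ζ ^ 5 = 1) :
    (uPoly r).comp (Polynomial.C ζ * Polynomial.X) = Polynomial.C (ζ ^ e) * uPoly r :=
  Polynomial.funext fun z => by simp [eval_uPoly_rotate hr hζ]

theorem uPoly_coeff_mod {j : ℕ} (hj : (uPoly r).coeff j ≠ 0) : j % 5 = e % 5 := by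
  have hζ := Complex.isPrimitiveRoot_exp 5 (by norm_num)
  set ζ := Complex.exp (2 * Real.pi * Complex.I / (5 : ℕ))
  have h := congrArg (fun q => Polynomial.coeff q j) (uPoly_comp_rotate hr hζ.pow_eq_one)
  simp only [Polynomial.comp_C_mul_X_coeff, Polynomial.coeff_C_mul] at h
  rw [mul_comm] at h
  have h1 := mul_right_cancel₀ hj h
  rw [pow_eq_pow_mod j hζ.pow_eq_one, pow_eq_pow_mod e hζ.pow_eq_one] at h1
  exact hζ.pow_inj (Nat.mod_lt _ (by norm_num)) (Nat.mod_lt _ (by norm_num)) h1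

theorem uPoly_coeff_bounds {j : ℕ} (hj : (uPoly r).coeff j ≠ 0) :
    e % 5 ≤ j ∧ j + e % 5 ≤ 2 * e := by
  have h1 := uPoly_coeff_mod hr hj
  have h2 := (Polynomial.le_natDegree_of_ne_zero hj).trans (uPoly_natDegree_le hr)
  omega

theorem uPoly_natDegree_add_le (h0 : uPoly r ≠ 0) : (uPoly r).natDegree + e % 5 ≤ 2 * e :=
  (uPoly_coeff_bounds hr (Polynomial.leadingCoeff_ne_zero.2 h0)).2

theorem uPoly_eq_sum {u p : ℂ} (hu : u ^ 2 = u + 1) (hp : p ^ 2 * (u + 2) = -1) :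
    uPoly r = ∑ j ∈ Finset.range (2 * e + 1), Polynomial.C ((uPoly r).coeff j) *
      (Polynomial.C p * (Polynomial.C u - Polynomial.X)) ^ (2 * e - j) *
      (-(Polynomial.C p * (1 + Polynomial.C u * Polynomial.X))) ^ j := by
  have hp0 : p ≠ 0 := fun h => by simp [h] at hp
  have hA : (Polynomial.C u - Polynomial.X : Polynomial ℂ) ≠ 0 := fun h => by
    have := congrArg (fun q => Polynomial.coeff q 1) h
    simp [Polynomial.coeff_C] at this
  refine mul_left_cancel₀ hA (Polynomial.funext fun z => ?_)
  rw [Polynomial.eval_mul, Polynomial.eval_mul]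
  rcases eq_or_ne (u - z) 0 with h | h
  · simp [h]
  · congr 1
    have ha : p * (u * 1 - z) ≠ 0 := by
      rw [mul_one]
      exact mul_ne_zero hp0 h
    rw [eval_uPoly, ← ev_uForm_reflect r hu hp 1 z, ev_uForm hr ha,
      Polynomial.eval_eq_sum_range' (Nat.lt_succ_of_le (uPoly_natDegree_le hr)),
      Polynomial.eval_finsetSum, Finset.mul_sum]
    refine Finset.sum_congr rfl fun j hj => ?_
    have hj' : j ≤ 2 * e := Nat.lt_succ_iff.1 (Finset.mem_range.1 hj)
    simp only [Polynomial.eval_mul, Polynomial.eval_pow, Polynomial.eval_C, Polynomial.eval_sub,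
      Polynomial.eval_X, Polynomial.eval_neg, Polynomial.eval_add, Polynomial.eval_one]
    rw [mul_one] at ha ⊢
    rw [div_pow, ← Nat.sub_add_cancel hj', pow_add, Nat.sub_add_cancel hj']
    field_simp

theorem uPoly_dvd_of_reflect {u p : ℂ} (hu : u ^ 2 = u + 1) (hp : p ^ 2 * (u + 2) = -1) :
    (Polynomial.X - Polynomial.C u) ^ (e % 5) ∣ uPoly r ∧
      (Polynomial.X - Polynomial.C (1 - u)) ^ (e % 5) ∣ uPoly r := by
  have h := uPoly_eq_sum hr hu hp
  constructor
  · rw [h]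
    refine Finset.dvd_sum fun j _ => ?_
    by_cases hj : (uPoly r).coeff j = 0
    · simp [hj]
    · have := (uPoly_coeff_bounds hr hj).2
      refine Dvd.dvd.mul_right (Dvd.dvd.mul_left ?_ _) _
      refine (pow_dvd_pow _ (by omega : e % 5 ≤ 2 * e - j)).trans (pow_dvd_pow_of_dvd ?_ _)
      exact ⟨-Polynomial.C p, by ring⟩
  · rw [h]
    refine Finset.dvd_sum fun j _ => ?_
    by_cases hj : (uPoly r).coeff j = 0
    · simp [hj]
    · refine Dvd.dvd.mul_left ?_ _
      refine (pow_dvd_pow _ (uPoly_coeff_bounds hr hj).1).trans (pow_dvd_pow_of_dvd ?_ _)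
      have hu' : (Polynomial.C u : Polynomial ℂ) ^ 2 = Polynomial.C u + 1 := by
        rw [← Polynomial.C_pow, hu, Polynomial.C_add, Polynomial.C_1]
      refine ⟨-Polynomial.C p * Polynomial.C u, ?_⟩
      rw [Polynomial.C_sub, Polynomial.C_1]
      linear_combination Polynomial.C p * hu'

theorem uPoly_dvd_rotate {ζ z : ℂ} (hζ : ζ ^ 5 = 1) {m : ℕ}
    (h : (Polynomial.X - Polynomial.C z) ^ m ∣ uPoly r) :
    (Polynomial.X - Polynomial.C (ζ * z)) ^ m ∣ uPoly r := by
  have h0 : ζ ≠ 0 := fun h => by simp [h] at hζ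
  have hi : (ζ⁻¹) ^ 5 = 1 := by rw [inv_pow, hζ, inv_one]
  obtain ⟨q, hq⟩ := h
  have h1 := uPoly_comp_rotate hr hi
  rw [hq, Polynomial.mul_comp, Polynomial.pow_comp, Polynomial.sub_comp, Polynomial.X_comp,
    Polynomial.C_comp, ← hq] at h1
  have h2 : Polynomial.C ζ * Polynomial.C ζ⁻¹ = (1 : Polynomial ℂ) := by
    rw [← Polynomial.C_mul, mul_inv_cancel₀ h0, Polynomial.C_1]
  have h3 : Polynomial.C (ζ ^ e) * Polynomial.C (ζ⁻¹ ^ e) = (1 : Polynomial ℂ) := by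
    rw [← Polynomial.C_mul, ← mul_pow, mul_inv_cancel₀ h0, one_pow, Polynomial.C_1]
  have h4 : Polynomial.X - Polynomial.C (ζ * z) =
      Polynomial.C ζ * (Polynomial.C ζ⁻¹ * Polynomial.X - Polynomial.C z) := by
    rw [mul_sub, ← mul_assoc, h2, one_mul, Polynomial.C_mul]
  refine ⟨Polynomial.C (ζ ^ e) * Polynomial.C (ζ⁻¹) ^ m *
    q.comp (Polynomial.C ζ⁻¹ * Polynomial.X), ?_⟩
  rw [h4, mul_pow]
  have h5 : Polynomial.C ζ ^ m * Polynomial.C ζ⁻¹ ^ m = (1 : Polynomial ℂ) := by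
    rw [← mul_pow, h2, one_pow]
  linear_combination -(uPoly r) * h3 - Polynomial.C (ζ ^ e) * h1 -
    Polynomial.C (ζ ^ e) * (Polynomial.C ζ⁻¹ * Polynomial.X - Polynomial.C z) ^ m *
    q.comp (Polynomial.C ζ⁻¹ * Polynomial.X) * h5

theorem uPoly_dvd {z : ℂ} (hz : z ^ 11 - 11 * z ^ 6 - z = 0) {u p : ℂ} (hu : u ^ 2 = u + 1)
    (hp : p ^ 2 * (u + 2) = -1) : (Polynomial.X - Polynomial.C z) ^ (e % 5) ∣ uPoly r := by
  have hu0 : u ≠ 0 := fun h => by simp [h] at hu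
  have hu1 : 1 - u ≠ 0 := fun h => by
    rw [← sub_eq_zero.1 h] at hu
    norm_num at hu
  rcases eq_or_ne z 0 with rfl | h0
  · rw [Polynomial.C_0, sub_zero, Polynomial.X_pow_dvd_iff]
    intro j hj
    by_contra h
    exact absurd (uPoly_coeff_bounds hr h).1 (by omega)
  · have h5 : u ^ 5 = 5 * u + 3 := by
      linear_combination (u ^ 3 + u ^ 2 + 2 * u + 3) * hu
    have h5' : (1 - u) ^ 5 = 8 - 5 * u := by
      linear_combination (-u ^ 3 + 4 * u ^ 2 - 7 * u + 7) * hu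
    have key : (z ^ 5 - u ^ 5) * (z ^ 5 - (1 - u) ^ 5) = 0 := by
      refine mul_left_cancel₀ h0 ?_
      rw [h5, h5']
      linear_combination hz - 25 * z * hu
    obtain ⟨d1, d2⟩ := uPoly_dvd_of_reflect hr hu hp
    rcases mul_eq_zero.1 key with h | h
    · have := uPoly_dvd_rotate hr (ζ := z / u)
        (by rw [div_pow, sub_eq_zero.1 h, div_self (pow_ne_zero 5 hu0)]) d1
      rwa [div_mul_cancel₀ _ hu0] at this
    · have := uPoly_dvd_rotate hr (ζ := z / (1 - u))
        (by rw [div_pow, sub_eq_zero.1 h, div_self (pow_ne_zero 5 hu1)]) d2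
      rwa [div_mul_cancel₀ _ hu1] at this

end Icosahedral

/-- The polynomial whose roots are the finite vertices of the icosahedron. -/
def icosPoly : Polynomial ℂ := Polynomial.X ^ 11 - 11 * Polynomial.X ^ 6 - Polynomial.X

/-- The polynomial whose roots are the edge midpoints of the icosahedron on the unit circle. -/
def edgePoly : Polynomial ℂ := Polynomial.X ^ 10 + 1

theorem icosPoly_ne_zero : icosPoly ≠ 0 := fun h => by
  have := congrArg (Polynomial.eval 1) h
  norm_num [icosPoly] at this

theorem edgePoly_ne_zero : edgePoly ≠ 0 := fun h => by
  have := congrArg (Polynomial.eval 1) h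
  norm_num [edgePoly] at this

theorem icosPoly_nodup : icosPoly.roots.Nodup := by
  refine Polynomial.nodup_roots ?_
  rw [Polynomial.separable_def']
  refine ⟨Polynomial.C (49489 / 625) * Polynomial.X ^ 4 - Polynomial.C (8228 / 625) *
      Polynomial.X ^ 9,
    -1 - Polynomial.C (8239 / 625) * Polynomial.X ^ 5 + Polynomial.C (748 / 625) *
        Polynomial.X ^ 10,
    Polynomial.funext fun z => ?_⟩
  simp [icosPoly]
  ring

theorem edgePoly_nodup : edgePoly.roots.Nodup := by
  refine Polynomial.nodup_roots ?_
  rw [Polynomial.separable_def']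
  refine ⟨1, -Polynomial.C (1 / 10) * Polynomial.X, Polynomial.funext fun z => ?_⟩
  simp [edgePoly]
  ring

theorem card_icosPoly_roots : icosPoly.roots.card = 11 := by
  rw [IsAlgClosed.card_roots_eq_natDegree]
  unfold icosPoly
  compute_degree!

theorem card_edgePoly_roots : edgePoly.roots.card = 10 := by
  rw [IsAlgClosed.card_roots_eq_natDegree]
  unfold edgePoly
  compute_degree!

theorem mem_icosPoly_roots {z : ℂ} : z ∈ icosPoly.roots ↔ z ^ 11 - 11 * z ^ 6 - z = 0 := by
  rw [Polynomial.mem_roots icosPoly_ne_zero]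
  simp [icosPoly]

theorem mem_edgePoly_roots {z : ℂ} : z ∈ edgePoly.roots ↔ z ^ 10 + 1 = 0 := by
  rw [Polynomial.mem_roots edgePoly_ne_zero]
  simp [edgePoly]

theorem notMem_edgePoly_roots {z : ℂ} (hz : z ∈ icosPoly.roots) : z ∉ edgePoly.roots := by
  rw [mem_icosPoly_roots] at hz
  rw [mem_edgePoly_roots]
  intro h
  have h1 : z ^ 5 = -2 / 11 := by
    have h0 : z ≠ 0 := fun h0 => by simp [h0] at h
    refine mul_left_cancel₀ h0 ?_
    linear_combination (z * h - hz) / 11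
  have h2 : (z ^ 5) ^ 2 = -1 := by linear_combination h
  rw [h1] at h2
  norm_num at h2

section Icosahedral
variable {r : invariantRing 7} {e : ℕ} (hr : r ∈ homInv (2 * e))
include hr

theorem uPoly_eval_eq_zero_of_edge (he : Odd e) {z : ℂ} (hz : z ^ 10 + 1 = 0) :
    (uPoly r).eval z = 0 := by
  have key : ∀ i : ℂ, i ^ 2 = -1 → (uPoly r).eval i = 0 := by
    intro i hi
    have h := ev_uForm_smul hr (a := 1) (b := i) (-i)
    rw [mul_one, show -i * i = 1 by linear_combination -hi, ev_uForm_swap r 1 i, pow_mul, neg_sq,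
      hi, he.neg_one_pow] at h
    rw [eval_uPoly]
    linear_combination h / 2
  have h5 : (z ^ 5) ^ 2 = -1 := by linear_combination hz
  have h0 : z ^ 5 ≠ 0 := fun h0 => by simp [h0] at h5
  have hζ : (z / z ^ 5) ^ 5 = 1 := by
    rw [div_pow, div_eq_one_iff_eq (pow_ne_zero 5 h0)]
    linear_combination z ^ 5 * (1 - (z ^ 5) ^ 2) * h5
  have := eval_uPoly_rotate hr hζ (z ^ 5)
  rwa [div_mul_cancel₀ _ h0, key _ h5, mul_zero] at this

theorem uPoly_eval_eq_zero_of_axis (he : Odd e) {u s : ℂ} (hu : u ^ 2 = u + 1)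
    (hs : s ^ 2 = u + 2) (hs0 : s ≠ 0) : (uPoly r).eval (u + s) = 0 := by
  have hI := Complex.I_sq
  have h := ev_uForm_reflect r (p := Complex.I / s) hu (by
    rw [div_pow, hs, hI]
    field_simp [show u + 2 ≠ 0 from hs ▸ pow_ne_zero 2 hs0]) 1 (u + s)
  rw [show Complex.I / s * (u * 1 - (u + s)) = -Complex.I * 1 by field_simp; ring,
    show -(Complex.I / s * (1 + u * (u + s))) = -Complex.I * (u + s) by
      field_simp
      linear_combination -hu + hs,
    ev_uForm_smul hr, pow_mul, neg_sq, hI, he.neg_one_pow] at h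
  rw [eval_uPoly]
  linear_combination -h / 2

theorem uPoly_eq_zero (h : 2 * e < 12 * (e % 5) ∨ Odd e ∧ 2 * e ≤ 12 * (e % 5) + 10) :
    uPoly r = 0 := by
  by_contra h0
  have hdeg := (Polynomial.card_roots' (uPoly r)).trans
    (Nat.le_sub_of_add_le (uPoly_natDegree_add_le hr h0))
  set t := √5
  have ht : t ^ 2 = 5 := Real.sq_sqrt (by norm_num)
  have ht2 : 2 ≤ t := Real.le_sqrt_of_sq_le (by norm_num)
  set s := √((1 + t) / 2 + 2)
  have hs : s ^ 2 = (1 + t) / 2 + 2 := Real.sq_sqrt (by linarith)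
  have hs2 : 3 / 2 ≤ s := Real.le_sqrt_of_sq_le (by norm_num; linarith)
  have hu : (((1 + t) / 2 : ℝ) : ℂ) ^ 2 = ((1 + t) / 2 : ℝ) + 1 := by
    have : ((1 + t) / 2) ^ 2 = (1 + t) / 2 + 1 := by linear_combination ht / 4
    exact_mod_cast this
  have hsC : (s : ℂ) ^ 2 = ((1 + t) / 2 : ℝ) + 2 := by exact_mod_cast hs
  have hs0 : (s : ℂ) ≠ 0 := by exact_mod_cast (by linarith : s ≠ 0)
  have hmult : ∀ z ∈ icosPoly.roots, e % 5 ≤ (uPoly r).roots.count z := by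
    intro z hz
    rw [Polynomial.count_roots, Polynomial.le_rootMultiplicity_iff h0]
    refine uPoly_dvd hr (mem_icosPoly_roots.1 hz) hu (p := Complex.I / s) ?_
    rw [div_pow, hsC, Complex.I_sq]
    rw [div_mul_cancel₀ _ (hsC ▸ pow_ne_zero 2 hs0)]
  rcases h with h | ⟨he, h⟩
  · have hle : (e % 5) • icosPoly.roots ≤ (uPoly r).roots := by
      rw [Multiset.le_iff_count]
      intro z
      rw [Multiset.count_nsmul, Multiset.count_eq_of_nodup icosPoly_nodup]
      split_ifs with hz
      · simpa using hmult z hz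
      · simp
    have := (Multiset.card_le_card hle).trans hdeg
    rw [Multiset.card_nsmul, card_icosPoly_roots] at this
    omega
  · have hedge : ∀ z ∈ edgePoly.roots, 1 ≤ (uPoly r).roots.count z := by
      intro z hz
      rw [Multiset.one_le_count_iff_mem, Polynomial.mem_roots h0]
      exact uPoly_eval_eq_zero_of_edge hr he (mem_edgePoly_roots.1 hz)
    set x := (1 + t) / 2 + s with hx
    have hx3 : 3 ≤ x := by linarith
    have hx5 : 243 ≤ x ^ 5 := by
      calc (243 : ℝ) = 3 ^ 5 := by norm_num
        _ ≤ x ^ 5 := by gcongr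
    have hx1 : (x : ℂ) ∉ icosPoly.roots := by
      rw [mem_icosPoly_roots]
      intro hh
      have : x ^ 11 - 11 * x ^ 6 - x = 0 := by exact_mod_cast hh
      nlinarith [mul_nonneg (show 0 ≤ x by linarith) (mul_nonneg (show 0 ≤ x ^ 5 by
          positivity) (show 0 ≤ x ^ 5 - 243 by linarith)), mul_nonneg (show 0 ≤ x by
          linarith) (show 0 ≤ x ^ 5 - 243 by linarith)]
    have hx2 : (x : ℂ) ∉ edgePoly.roots := by
      rw [mem_edgePoly_roots]
      intro hh
      have : x ^ 10 + 1 = 0 := by exact_mod_cast hh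
      have : 0 < x ^ 10 + 1 := by positivity
      linarith
    have haxis : 1 ≤ (uPoly r).roots.count (x : ℂ) := by
      rw [Multiset.one_le_count_iff_mem, Polynomial.mem_roots h0]
      have := uPoly_eval_eq_zero_of_axis hr he hu hsC hs0
      rw [Polynomial.IsRoot.def, hx, Complex.ofReal_add]
      exact this
    have hle : (e % 5) • icosPoly.roots + edgePoly.roots + {(x : ℂ)} ≤ (uPoly r).roots := by
      rw [Multiset.le_iff_count]
      intro z
      rw [Multiset.count_add, Multiset.count_add, Multiset.count_nsmul,
        Multiset.count_eq_of_nodup icosPoly_nodup, Multiset.count_eq_of_nodup edgePoly_nodup,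
        Multiset.count_singleton]
      rcases eq_or_ne z x with rfl | hzx
      · simpa [hx1, hx2] using haxis
      · by_cases hz : z ∈ icosPoly.roots
        · simpa [hz, notMem_edgePoly_roots hz, hzx] using hmult z hz
        · by_cases hz' : z ∈ edgePoly.roots
          · simpa [hz, hz', hzx] using hedge z hz'
          · simp [hz, hz', hzx]
    have := (Multiset.card_le_card hle).trans hdeg
    rw [Multiset.card_add, Multiset.card_add, Multiset.card_nsmul, card_icosPoly_roots,
      card_edgePoly_roots, Multiset.card_singleton] at this
    omega

end Icosahedral

theorem mem_kerEv_uForm {r : invariantRing 7} {e : ℕ} (hr : r ∈ homInv (2 * e))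
    (h : 2 * e < 12 * (e % 5) ∨ Odd e ∧ 2 * e ≤ 12 * (e % 5) + 10) :
    r ∈ kerEv (uForm (X 0) (X 1) : Fin 8 → MvPolynomial (Fin 2) ℂ) := by
  rw [mem_kerEv]
  refine mul_left_cancel₀ (X_ne_zero (0 : Fin 2)) (MvPolynomial.funext fun a => ?_)
  rw [mul_zero, map_zero, map_mul, eval_X]
  rcases eq_or_ne (a 0) 0 with ha | ha
  · rw [ha, zero_mul]
  · have := map_ev (aeval a) (uForm (X 0) (X 1)) r
    simp only [uForm_map, aeval_X] at this
    rw [← coe_aeval_eq_eval, RingHom.coe_coe, this, ev_uForm hr ha, uPoly_eq_zero hr h,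
      Polynomial.eval_zero, mul_zero, mul_zero]

theorem kerEv_uForm_not_dimLE :
    ¬ DimLE (kerEv (uForm (X 0) (X 1) : Fin 8 → MvPolynomial (Fin 2) ℂ)) 1 := by
  have h1 : ¬ DimLE (kerEv (uForm 0 (X 0) : Fin 8 → MvPolynomial (Fin 1) ℂ)) 0 := by
    have := irr_isPrime
    refine not_dimLE_zero (Q := irr) ?_ (p := inv20.toInv) ?_
      (homInv_le_irr (by norm_num) inv20.toInv_mem)
    · refine (kerEv_le (aeval ![(0 : ℂ)]) (w := 0) fun i => ?_).trans
        (kerEv_le_irr _ fun _ _ => rfl)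
      rw [uForm_map]
      fin_cases i <;> simp [uForm]
    · refine notMem_kerEv (aeval ![(1 : ℂ)]) (w := twoForm 3) (fun i => ?_) ?_
      · rw [uForm_map]
        fin_cases i <;> simp [twoForm, uForm]
      · rw [ev_inv20_twoForm]
        norm_num
  refine not_dimLE_succ (Q := kerEv (uForm 0 (X 0) : Fin 8 → MvPolynomial (Fin 1) ℂ)) ?_
    (p := inv12c.toInv) ?_ ?_ h1
  · refine kerEv_le (aeval ![(0 : MvPolynomial (Fin 1) ℂ), X 0]) fun i => ?_
    rw [uForm_map]
    simp
  · refine notMem_kerEv (aeval ![(1 : ℂ), 1]) (w := uForm 1 1) (fun i => ?_) ?_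
    · rw [uForm_map]
      simp
    · rw [ev_inv12c]
      simp [iT, sextic4, kT, uForm]
      norm_num
  · rw [mem_kerEv, ev_inv12c]
    simp [iT, sextic4, kT, uForm]

namespace Van
variable {P : Ideal (invariantRing 7)} [P.IsPrime] {d : ℕ}

theorem of_mul_add {a b : ℕ} (n : ℕ) (h : Van P (n * a + b)) : Van P a ∨ Van P b := by
  rcases n with - | n
  · rw [zero_mul, zero_add] at h
    exact Or.inr h
  · exact h.or_of_add.imp (of_mul n) id

theorem of_dvd {a : ℕ} (hd : 0 < d) (ha : a ∣ d) (h : Van P d) : Van P a := by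
  obtain ⟨k, rfl⟩ := ha
  obtain ⟨n, rfl⟩ : ∃ n, k = n + 1 := Nat.exists_eq_succ_of_ne_zero (by rintro rfl; simp at hd)
  rw [mul_comm] at h
  exact h.of_mul n

theorem eight_or_twelve (h4 : 4 ∣ d) (h8 : 8 ≤ d) (h : Van P d) : Van P 8 ∨ Van P 12 := by
  obtain ⟨k, rfl⟩ := h4
  rcases Nat.even_or_odd' k with ⟨n, rfl | rfl⟩
  · exact Or.inl (h.of_dvd (by omega) ⟨n, by ring⟩)
  · rw [show 4 * (2 * n + 1) = (n - 1) * 8 + 12 by omega] at h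
    exact h.of_mul_add _

theorem of_even (h2 : 2 ∣ d) (h0 : 0 < d) (hd : d ∉ ({2, 6, 10} : Set ℕ)) (hd4 : d ≠ 4)
    (h : Van P d) : Van P 8 ∨ Van P 12 ∨ Van P 14 ∨ Van P 18 := by
  simp only [Set.mem_insert_iff, Set.mem_singleton_iff, not_or] at hd
  by_cases h4 : 4 ∣ d
  · exact (h.eight_or_twelve h4 (by omega)).imp id Or.inl
  · by_cases h8 : d % 8 = 6
    · rw [show d = (d - 14) / 8 * 8 + 14 by omega] at h
      exact (h.of_mul_add _).imp id fun h => Or.inr (Or.inl h)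
    · rw [show d = (d - 18) / 8 * 8 + 18 by omega] at h
      exact (h.of_mul_add _).imp id fun h => Or.inr (Or.inr h)

theorem twelve_or_eighteen (h6 : 6 ∣ d) (h0 : 0 < d) (hd : d ≠ 6) (h : Van P d) :
    Van P 12 ∨ Van P 18 := by
  by_cases h12 : 12 ∣ d
  · exact Or.inl (h.of_dvd h0 h12)
  · rw [show d = (d - 18) / 12 * 12 + 18 by omega] at h
    exact h.of_mul_add _

theorem twenty_or_thirty (h10 : 10 ∣ d) (h0 : 0 < d) (hd : d ≠ 10) (h : Van P d) :
    Van P 20 ∨ Van P 30 := by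
  by_cases h20 : 20 ∣ d
  · exact Or.inl (h.of_dvd h0 h20)
  · rw [show d = (d - 30) / 20 * 20 + 30 by omega] at h
    exact h.of_mul_add _

theorem of_notMem (h2 : 2 ∣ d) (h0 : 0 < d) (hd : d ∉ ({2, 6, 10} : Set ℕ))
    (hB : d ∉ ({4, 8, 14, 16, 18, 22, 26, 28, 34, 38, 46, 58} : Finset ℕ)) (h : Van P d) :
    Van P 12 ∨ Van P 20 ∨ Van P 30 := by
  simp only [Set.mem_insert_iff, Set.mem_singleton_iff, not_or] at hd
  simp only [Finset.mem_insert, Finset.mem_singleton, not_or] at hB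
  have hr : d % 12 = 0 ∨ d % 12 = 2 ∨ d % 12 = 4 ∨ d % 12 = 6 ∨ d % 12 = 8 ∨ d % 12 = 10 := by
    omega
  rcases hr with hr | hr | hr | hr | hr | hr
  · exact Or.inl (h.of_dvd h0 (Nat.dvd_of_mod_eq_zero hr))
  · rw [show d = (d - 50) / 12 * 12 + (20 + 30) by omega] at h
    exact (h.of_mul_add _).imp id or_of_add
  · rw [show d = (d - 40) / 12 * 12 + (20 + 20) by omega] at h
    exact (h.of_mul_add _).imp id fun h => Or.inl (h.or_of_add.elim id id)
  · rw [show d = (d - 30) / 12 * 12 + 30 by omega] at h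
    exact (h.of_mul_add _).imp id Or.inr
  · rw [show d = (d - 20) / 12 * 12 + 20 by omega] at h
    exact (h.of_mul_add _).imp id Or.inl
  · rw [show d = (d - 70) / 12 * 12 + (20 + (20 + 30)) by omega] at h
    exact (h.of_mul_add _).imp id fun h => h.or_of_add.elim Or.inl or_of_add

theorem dimLE_three_of_even (h2 : 2 ∣ d) (h0 : 0 < d) (hd : d ∉ ({2, 6, 10} : Set ℕ)) (hd4 : d ≠ 4)
    (h : Van P d) : DimLE P 3 := by
  rcases h.of_even h2 h0 hd hd4 with h | h | h | h
  · exact h.dimLE_two_of_eight.mono (by norm_num)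
  · exact h.dimLE_one_of_twelve.mono (by norm_num)
  · exact h.dimLE_three_of_fourteen
  · exact h.dimLE_three_of_eighteen

theorem ne_bot (h2 : 2 ∣ d) (h0 : 0 < d) (hd : d ∉ ({2, 6, 10} : Set ℕ)) (h : Van P d) :
    P ≠ ⊥ := by
  rintro rfl
  rcases eq_or_ne d 4 with rfl | hd4
  · exact inv4_ne_zero (h _ inv4.toInv_mem)
  · exact bot_not_dimLE ((h.dimLE_three_of_even h2 h0 hd hd4).mono (by norm_num))

end Van

theorem Finset.exists_mem_of_card_lt {J : Finset (Fin 5)} {p : Fin 5 → Prop} [DecidablePred p]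
    (h : 5 < J.card + (Finset.univ.filter p).card) : ∃ j ∈ J, p j := by
  obtain ⟨j, hj⟩ := Finset.inter_nonempty_of_card_lt_card_add_card (Finset.subset_univ J)
    (Finset.subset_univ (Finset.univ.filter p)) (by simpa using h)
  simp only [Finset.mem_inter, Finset.mem_filter, Finset.mem_univ, true_and] at hj
  exact ⟨j, hj⟩

section Sufficiency
variable {d : Fin 5 → ℕ} (hd : ∀ k, 0 < d k) (h2 : ∀ k, 2 ∣ d k)
  (hne : ∀ k, d k ∉ ({2, 6, 10} : Set ℕ))
  (hc4 : (Finset.univ.filter fun k => d k = 4).card ≤ 1)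
  (hB : (Finset.univ.filter fun k =>
    d k ∈ ({4, 8, 14, 16, 18, 22, 26, 28, 34, 38, 46, 58} : Finset ℕ)).card ≤ 3)
  (h4 : 3 ≤ (Finset.univ.filter fun k => 4 ∣ d k).card)
  (h6 : 2 ≤ (Finset.univ.filter fun k => 6 ∣ d k).card)
  (h8 : ∃ k, 8 ∣ d k) (h10 : ∃ k, 10 ∣ d k) (h12 : ∃ k, 12 ∣ d k)
include hd h2 hne hc4 hB h4 h6 h8 h10 h12

theorem dimLE_of_van {P : Ideal (invariantRing 7)} [P.IsPrime] {J : Finset (Fin 5)}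
    (hJ : ∀ j ∈ J, Van P (d j)) : DimLE P (5 - J.card) := by
  have hJ5 : J.card ≤ 5 := by simpa using Finset.card_le_univ J
  have hc4' : 4 ≤ (Finset.univ.filter fun k => ¬d k = 4).card := by
    have := Finset.card_filter_add_card_filter_not (s := Finset.univ) (fun k => d k = 4)
    rw [Finset.card_univ, Fintype.card_fin] at this
    omega
  have hne4 : 2 ≤ J.card → ∃ j ∈ J, d j ≠ 4 := fun h =>
    Finset.exists_mem_of_card_lt (p := fun k => ¬d k = 4) (by omega)
  have hlist : J.card = 0 ∨ J.card = 1 ∨ J.card = 2 ∨ J.card = 3 ∨ J.card = 4 ∨ J.card = 5 := by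
    omega
  rcases hlist with hc | hc | hc | hc | hc | hc <;> rw [hc]
  · exact dimLE_five P
  · obtain ⟨j, hj⟩ := Finset.card_pos.1 (by omega : 0 < J.card)
    exact dimLE_four ((hJ j hj).ne_bot (h2 j) (hd j) (hne j))
  · obtain ⟨j, hj, hj4⟩ := hne4 (by omega)
    exact (hJ j hj).dimLE_three_of_even (h2 j) (hd j) (hne j) hj4
  · obtain ⟨i, hi, hi4⟩ := Finset.exists_mem_of_card_lt (J := J) (p := fun k => 4 ∣ d k) (by omega)
    obtain ⟨j, hj, hj4⟩ := hne4 (by omega)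
    have hV := (hJ i hi).of_dvd (hd i) hi4
    rcases (hJ j hj).of_even (h2 j) (hd j) (hne j) hj4 with h | h | h | h
    · exact h.dimLE_two_of_eight
    · exact h.dimLE_one_of_twelve.mono (by norm_num)
    · exact hV.dimLE_two_of_fourteen h
    · exact hV.dimLE_two_of_eighteen h
  · by_cases hV : Van P 12
    · exact hV.dimLE_one_of_twelve
    obtain ⟨i, hi, hi4⟩ : ∃ i ∈ J, 4 ∣ d i ∧ 8 ≤ d i := by
      have : 2 ≤ (Finset.univ.filter fun k => 4 ∣ d k ∧ 8 ≤ d k).card := by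
        have hsub : (Finset.univ.filter fun k => 4 ∣ d k) ⊆
            (Finset.univ.filter fun k => 4 ∣ d k ∧ 8 ≤ d k) ∪
              (Finset.univ.filter fun k => d k = 4) := by
          intro k hk
          have := hd k
          simp only [Finset.mem_union, Finset.mem_filter, Finset.mem_univ, true_and] at hk ⊢
          omega
        have := (Finset.card_le_card hsub).trans (Finset.card_union_le _ _)
        omega
      exact Finset.exists_mem_of_card_lt (by omega)
    obtain ⟨j, hj, hj6⟩ := Finset.exists_mem_of_card_lt (J := J) (p := fun k => 6 ∣ d k) (by omega)
    obtain ⟨k, hk, hkB⟩ := Finset.exists_mem_of_card_lt (J := J) (p := fun k =>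
        d k ∉ ({4, 8, 14, 16, 18, 22, 26, 28, 34, 38, 46, 58} : Finset ℕ)) (by
      have := Finset.card_filter_add_card_filter_not (s := Finset.univ) (fun k =>
        d k ∈ ({4, 8, 14, 16, 18, 22, 26, 28, 34, 38, 46, 58} : Finset ℕ))
      rw [Finset.card_univ, Fintype.card_fin] at this
      omega)
    have h8' := ((hJ i hi).eight_or_twelve hi4.1 hi4.2).resolve_right hV
    have h18 := ((hJ j hj).twelve_or_eighteen hj6 (hd j) fun h =>
        hne j (by simp [h])).resolve_left hV
    have hq := ((hJ k hk).of_notMem (h2 k) (hd k) (hne k) hkB).resolve_left hV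
    exact h8'.dimLE_one_of_eighteen h18 hq
  · have hu : J = Finset.univ := Finset.eq_univ_of_card J (by simpa using hc)
    subst hu
    obtain ⟨i, hi⟩ := h8
    obtain ⟨j, hj⟩ := h10
    obtain ⟨k, hk⟩ := h12
    exact IsPt.dimLE_zero_of_irr_le (((hJ i (Finset.mem_univ i)).of_dvd (hd i) hi).irr_le
      ((hJ k (Finset.mem_univ k)).of_dvd (hd k) hk)
      ((hJ j (Finset.mem_univ j)).twenty_or_thirty hj (hd j) fun h => hne j (by simp [h])))

theorem exists_isHSOP : ∃ p : Fin (7 - 2) → invariantRing 7, IsHSOP 7 d p := by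
  have := invariantRing_isNoetherianRing
  obtain ⟨p, hp, hP0⟩ := exists_selection 5 (∅ : Set (invariantRing 7)) (fun k => homInv (d k))
    fun J P hP _ hJ => dimLE_of_van hd h2 hne hc4 hB h4 h6 h8 h10 h12 hJ
  have hfin := finite_of_irr_le hd hp fun Q hQ hpQ =>
    irr_le_of_dimLE_zero (G := Set.range p) (by rintro _ ⟨i, rfl⟩; exact ⟨_, hp i⟩)
      (fun P hP hG => hP0 P hP (Set.empty_subset _) fun i => hG ⟨i, rfl⟩) Q
      (by rintro _ ⟨i, rfl⟩; exact hpQ i)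
  exact ⟨p, hd, hp, algebraicIndependent_of_finite_adjoin hfin bot_not_dimLE, hfin⟩

end Sufficiency

theorem AlgebraicIndependent.card_filter_eq_four_le {d : Fin 5 → ℕ} {p : Fin 5 → invariantRing 7}
    (hp : AlgebraicIndependent ℂ p) (hhom : ∀ k, p k ∈ homInv (d k)) :
    (Finset.univ.filter fun k => d k = 4).card ≤ 1 := by
  refine Finset.card_le_one.2 fun i hi j hj => ?_
  simp only [Finset.mem_filter, Finset.mem_univ, true_and] at hi hj
  by_contra hij
  obtain ⟨c, hc⟩ := homInv_four (hi ▸ hhom i) (hj ▸ hhom j) (hp.ne_zero i)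
  refine hp.linearIndependent.notMem_span_image (s := {i}) (x := j) (by simpa using Ne.symm hij) ?_
  rw [Set.image_singleton, Submodule.mem_span_singleton]
  exact ⟨c, hc.symm⟩

section Necessity
variable {d : Fin 5 → ℕ} {p : Fin 5 → invariantRing 7} (hhom : ∀ k, p k ∈ homInv (d k))
  (hfin : Module.Finite (Algebra.adjoin ℂ (Set.range p)) (invariantRing 7))
include hhom hfin

theorem lt_card_filter_dvd {n m k : ℕ} {r : ℤ} (hm : m ≠ 0) (hr : IsCoprime (m : ℤ) r)
    {v : Fin 8 → MvPolynomial (Fin n) ℂ} (hv : ∀ i, v i = 0 ∨ (m : ℤ) ∣ (7 - 2 * i) - r)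
    (hk : ¬DimLE (kerEv v) k) : k < (Finset.univ.filter fun i => m ∣ d i).card := by
  by_contra h
  refine hk ((DimLE.of_finite_of_mem hfin _ (Finset.univ.filter fun i => m ∣ d i)
    fun i hi => ?_).mono (not_lt.1 h))
  exact mem_kerEv_of_weights hm hr hv (by simpa using hi) (hhom i)

theorem three_le_card_filter_four_dvd : 3 ≤ (Finset.univ.filter fun i => 4 ∣ d i).card :=
  lt_card_filter_dvd hhom hfin (r := 1) (by norm_num) (by norm_num)
    (fun i => by fin_cases i <;> simp) sparse_four_not_dimLE

theorem two_le_card_filter_six_dvd : 2 ≤ (Finset.univ.filter fun i => 6 ∣ d i).card :=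
  lt_card_filter_dvd hhom hfin (r := -1) (by norm_num) (by norm_num)
    (fun i => by fin_cases i <;> simp) sparse_six_not_dimLE

theorem exists_dvd_of_not_dimLE {n m : ℕ} {r : ℤ} (hm : m ≠ 0) (hr : IsCoprime (m : ℤ) r)
    {v : Fin 8 → MvPolynomial (Fin n) ℂ} (hv : ∀ i, v i = 0 ∨ (m : ℤ) ∣ (7 - 2 * i) - r)
    (hk : ¬DimLE (kerEv v) 0) : ∃ i, m ∣ d i := by
  obtain ⟨i, hi⟩ := Finset.card_pos.1 (lt_card_filter_dvd hhom hfin hm hr hv hk)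
  exact ⟨i, by simpa using hi⟩

theorem exists_eight_dvd : ∃ i, 8 ∣ d i :=
  exists_dvd_of_not_dimLE hhom hfin (r := 5) (by norm_num) (by norm_num)
    (fun i => by fin_cases i <;> simp) sparse_eight_not_dimLE

theorem exists_ten_dvd : ∃ i, 10 ∣ d i :=
  exists_dvd_of_not_dimLE hhom hfin (r := 3) (by norm_num) (by norm_num)
    (fun i => by fin_cases i <;> simp) sparse_ten_not_dimLE

theorem exists_twelve_dvd : ∃ i, 12 ∣ d i :=
  exists_dvd_of_not_dimLE hhom hfin (r := 5) (by norm_num) (by norm_num)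
    (fun i => by fin_cases i <;> simp) sparse_twelve_not_dimLE

theorem card_filter_mem_le_three : (Finset.univ.filter fun k =>
    d k ∈ ({4, 8, 14, 16, 18, 22, 26, 28, 34, 38, 46, 58} : Finset ℕ)).card ≤ 3 := by
  by_contra h
  have hsum := Finset.card_filter_add_card_filter_not (s := Finset.univ) (fun k =>
    d k ∈ ({4, 8, 14, 16, 18, 22, 26, 28, 34, 38, 46, 58} : Finset ℕ))
  rw [Finset.card_univ, Fintype.card_fin] at hsum
  refine kerEv_uForm_not_dimLE ((DimLE.of_finite_of_mem hfin _ (Finset.univ.filter fun k =>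
    ¬d k ∈ ({4, 8, 14, 16, 18, 22, 26, 28, 34, 38, 46, 58} : Finset ℕ)) fun i hi => ?_).mono
    (by omega))
  have hB : d i ∈ ({4, 8, 14, 16, 18, 22, 26, 28, 34, 38, 46, 58} : Finset ℕ) := by
    simpa only [Finset.mem_filter, Finset.mem_univ, true_and, not_not] using hi
  obtain ⟨e, he, hlt⟩ : ∃ e, d i = 2 * e ∧
      (2 * e < 12 * (e % 5) ∨ Odd e ∧ 2 * e ≤ 12 * (e % 5) + 10) := by
    refine ⟨d i / 2, ?_⟩
    generalize d i = t at hB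
    revert t
    decide
  exact mem_kerEv_uForm (he ▸ hhom i) hlt

end Necessity

theorem stmt_16 (d : Fin 5 → ℕ) (hd : ∀ k, 0 < d k) :
    (∃ p : Fin (7-2) → invariantRing 7, IsHSOP 7 d p) ↔
      ((∀ k, 2 ∣ d k) ∧
       (∀ k, d k ∉ ({2, 6, 10} : Set ℕ)) ∧
       (Finset.univ.filter fun k => d k = 4).card ≤ 1 ∧
       (Finset.univ.filter fun k =>
          d k ∈ ({4, 8, 14, 16, 18, 22, 26, 28, 34, 38, 46, 58} : Finset ℕ)).card ≤ 3 ∧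
       3 ≤ (Finset.univ.filter fun k => 4 ∣ d k).card ∧
       2 ≤ (Finset.univ.filter fun k => 6 ∣ d k).card ∧
       (∃ k, 8 ∣ d k) ∧ (∃ k, 10 ∣ d k) ∧ (∃ k, 12 ∣ d k)) := by
  constructor
  · rintro ⟨p, -, hhom, hp, hfin⟩
    have hhom' : ∀ k, p k ∈ homInv (d k) := hhom
    refine ⟨fun k => ?_, fun k hk => ?_, hp.card_filter_eq_four_le hhom,
      card_filter_mem_le_three hhom hfin, three_le_card_filter_four_dvd hhom hfin,
      two_le_card_filter_six_dvd hhom hfin, exists_eight_dvd hhom hfin,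
      exists_ten_dvd hhom hfin, exists_twelve_dvd hhom hfin⟩
    · by_contra h
      exact hp.ne_zero k (homInv_odd h (hhom' k))
    · rcases hk with hk | hk | hk
      · exact hp.ne_zero k (homInv_two (hk ▸ hhom' k))
      · exact hp.ne_zero k (homInv_six (hk ▸ hhom' k))
      · exact hp.ne_zero k (homInv_ten (hk ▸ hhom' k))
  · rintro ⟨h2, hne, hc4, hB, h4, h6, h8, h10, h12⟩
    exact exists_isHSOP hd h2 hne hc4 hB h4 h6 h8 h10 h12
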